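/- Let 0 < p < 1 and let g, f_1, ..., f_n be functions in H^∞(D) ∩ Q_p. If |g(z)| ≤ (Σ_{j=1}^n |f_j(z)|^2)^{1/2} for all z in the unit disk D, then there exist functions g_1, ..., g_n in H^∞(D) ∩ Q_p such that Σ_{j=1}^n f_j(z) g_j(z) = g(z)^3 for all z ∈ D. -/

import Mathlib

open MeasureTheory Complex Metric Set Filter
open scoped ENNReal Real

noncomputable section

/-- The open unit disk in `ℂ`. -/
def unitDisk : Set ℂ := Metric.ball 0 1

/-- The Möbius automorphism `φ_a(z) = (a - z)/(1 - ā z)` of the unit disk. -/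
def moebius (a z : ℂ) : ℂ := (a - z) / (1 - (starRingEnd ℂ) a * z)

/-- Membership in `H^∞(𝔻)`: bounded analytic functions on the unit disk. -/
def MemHinf (f : ℂ → ℂ) : Prop :=
  DifferentiableOn ℂ f unitDisk ∧ ∃ M : ℝ, ∀ z ∈ unitDisk, ‖f z‖ ≤ M

/-- The integral `∫_𝔻 |f'(z)|² (1 - |φ_a(z)|²)^p dA(z)`. -/
def qpIntegral (p : ℝ) (f : ℂ → ℂ) (a : ℂ) : ℝ≥0∞ :=
  ∫⁻ z in unitDisk, ENNReal.ofReal (‖deriv f z‖ ^ 2 * (1 - ‖moebius a z‖ ^ 2) ^ p)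

/-- Finiteness of the `H²`-part of the `Q_p` norm: the integrals of `|f|²` over circles of
radius `r < 1` are uniformly bounded (equivalently, the boundary integral `∫ |f|² dσ`
is finite). -/
def h2Bounded (f : ℂ → ℂ) : Prop :=
  ∃ M : ℝ, ∀ r ∈ Set.Ico (0 : ℝ) 1,
    (∫ t in (0 : ℝ)..(2 * Real.pi), ‖f ((r : ℂ) * Complex.exp (Complex.I * t))‖ ^ 2) ≤ M

/-- Membership in the space `Q_p`: `f` is analytic on the unit disk and
`‖f‖_{Q_p}² = ∫_𝕋 |f|² dσ + sup_{a ∈ 𝔻} ∫_𝔻 |f'(z)|² (1 - |φ_a(z)|²)^p dA(z) < ∞`. -/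
def MemQp (p : ℝ) (f : ℂ → ℂ) : Prop :=
  DifferentiableOn ℂ f unitDisk ∧ h2Bounded f ∧
    ∃ C : ℝ, ∀ a ∈ unitDisk, qpIntegral p f a ≤ ENNReal.ofReal C

/-- The multiplier algebra `M(Q_p)`. -/
def MemMQp (p : ℝ) (φ : ℂ → ℂ) : Prop :=
  MemQp p φ ∧ ∀ f : ℂ → ℂ, MemQp p f → MemQp p (fun z => φ z * f z)

/-- The Carleson square `S(I)` over the arc of the unit circle centered at `e^{iθ}` with
normalized length `h`. -/
def carlesonBox (θ h : ℝ) : Set ℂ :=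
  {z : ℂ | 1 - h < ‖z‖ ∧ ‖z‖ < 1 ∧
    ∃ t : ℝ, |t - θ| < Real.pi * h ∧ z = (‖z‖ : ℂ) * Complex.exp (Complex.I * t)}

/-- A measure `μ` on the unit disk is a `p`-Carleson measure if `μ(S(I)) ≤ C |I|^p`
for every arc `I` of the unit circle. -/
def IsPCarleson (p : ℝ) (μ : Measure ℂ) : Prop :=
  ∃ C : ℝ, ∀ θ : ℝ, ∀ h ∈ Set.Ioc (0 : ℝ) 1,
    μ (carlesonBox θ h) ≤ ENNReal.ofReal (C * h ^ p)

/-- The `p`-Carleson constant `‖μ‖_p = sup_{I ⊂ 𝕋} μ(S(I))/|I|^p`. -/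
def pCarlesonNorm (p : ℝ) (μ : Measure ℂ) : ℝ≥0∞ :=
  ⨆ (θ : ℝ) (h : ℝ) (_ : h ∈ Set.Ioc (0 : ℝ) 1),
    μ (carlesonBox θ h) / ENNReal.ofReal (h ^ p)

/-- The measure `w(z) dA(z)` on the unit disk. -/
def diskMeasure (w : ℂ → ℝ) : Measure ℂ :=
  (volume.restrict unitDisk).withDensity fun z => ENNReal.ofReal (w z)

/-- The Wirtinger derivative `∂F/∂z`. -/
def wderiv (F : ℂ → ℂ) (z : ℂ) : ℂ :=
  (fderiv ℝ F z 1 - Complex.I * fderiv ℝ F z Complex.I) / 2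

/-- The Wirtinger derivative `∂F/∂z̄`. -/
def wderivBar (F : ℂ → ℂ) (z : ℂ) : ℂ :=
  (fderiv ℝ F z 1 + Complex.I * fderiv ℝ F z Complex.I) / 2

/-- The squared length of the (real) gradient: `|∇F|² = 2|∂F/∂z|² + 2|∂F/∂z̄|²`. -/
def gradSq (F : ℂ → ℂ) (z : ℂ) : ℝ :=
  2 * ‖wderiv F z‖ ^ 2 + 2 * ‖wderivBar F z‖ ^ 2

/-- The arc of the unit circle centered at `e^{iθ}` of normalized length `h`, parametrized
by angle. -/
def arcInterval (θ h : ℝ) : Set ℝ := Set.Ioo (θ - Real.pi * h) (θ + Real.pi * h)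

/-- The double integral `∫_I ∫_I |f(ξ) - f(η)|²/|ξ - η|^{2-p} |dξ| |dη|` over the arc
centered at `e^{iθ}` of normalized length `h`. -/
def qpTDouble (p : ℝ) (f : ℝ → ℂ) (θ h : ℝ) : ℝ≥0∞ :=
  ∫⁻ s in arcInterval θ h, ∫⁻ u in arcInterval θ h,
    ENNReal.ofReal (‖f s - f u‖ ^ 2 /
      ‖Complex.exp (Complex.I * s) - Complex.exp (Complex.I * u)‖ ^ (2 - p))

/-- The integral `∫_𝕋 |f|² dσ` of a function on the unit circle (parametrized by angle). -/
def l2Circle (f : ℝ → ℂ) : ℝ≥0∞ :=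
  ∫⁻ t in Set.Ioc (0 : ℝ) (2 * Real.pi), (‖f t‖₊ : ℝ≥0∞) ^ 2

/-- Membership in `Q_p(𝕋)` for a function on the unit circle (parametrized by angle):
`f ∈ L²(𝕋)` and `sup_{I ⊂ 𝕋} |I|^{-p} ∫_I ∫_I |f(ξ) - f(η)|²/|ξ - η|^{2-p} |dξ||dη| < ∞`. -/
def MemQpT (p : ℝ) (f : ℝ → ℂ) : Prop :=
  Function.Periodic f (2 * Real.pi) ∧ Measurable f ∧ l2Circle f < ⊤ ∧
    ∃ C : ℝ, ∀ θ : ℝ, ∀ h ∈ Set.Ioc (0 : ℝ) 1, qpTDouble p f θ h ≤ ENNReal.ofReal (C * h ^ p)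

/-- The square of the `Q_p` norm of an analytic function `f` on the disk with boundary
values `fb`. -/
def qpNormSq (p : ℝ) (f : ℂ → ℂ) (fb : ℝ → ℂ) : ℝ≥0∞ :=
  l2Circle fb + ⨆ a ∈ unitDisk, qpIntegral p f a

/-- The square of the `Q_p(𝕋)` norm of a function on the unit circle. -/
def qpTNormSq (p : ℝ) (fb : ℝ → ℂ) : ℝ≥0∞ :=
  l2Circle fb + ⨆ (θ : ℝ) (h : ℝ) (_ : h ∈ Set.Ioc (0 : ℝ) 1),
    qpTDouble p fb θ h / ENNReal.ofReal (h ^ p)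

/-- `fb` is the a.e. radial boundary-value function of `F`. -/
def RadialLimit (F : ℂ → ℂ) (fb : ℝ → ℂ) : Prop :=
  ∀ᵐ t : ℝ, Filter.Tendsto (fun r : ℝ => F ((r : ℂ) * Complex.exp (Complex.I * t)))
    (nhdsWithin 1 (Set.Iio 1)) (nhds (fb t))

/-- The Poisson integral (harmonic extension) of a function on the unit circle. -/
def poissonExt (f : ℝ → ℂ) (z : ℂ) : ℂ :=
  (1 / (2 * Real.pi)) • ∫ t in (0 : ℝ)..(2 * Real.pi),
    ((1 - ‖z‖ ^ 2) / ‖Complex.exp (Complex.I * t) - z‖ ^ 2) • f t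


open scoped ComplexConjugate Topology

section

lemma norm_one_sub_sq (z ζ : ℂ) :
    ‖1 - conj ζ * z‖ ^ 2 = ‖z - ζ‖ ^ 2 + (1 - ‖z‖ ^ 2) * (1 - ‖ζ‖ ^ 2) := by
  simp only [← Complex.normSq_eq_norm_sq, Complex.normSq_apply]
  simp
  ring

lemma one_sub_le_den {z ζ : ℂ} (hz : ‖z‖ ≤ 1) : 1 - ‖ζ‖ ≤ ‖1 - conj ζ * z‖ := by
  have h1 : ‖(1:ℂ)‖ - ‖conj ζ * z‖ ≤ ‖1 - conj ζ * z‖ := norm_sub_norm_le _ _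
  rw [norm_mul, RCLike.norm_conj, norm_one] at h1
  nlinarith [norm_nonneg ζ, norm_nonneg z]

lemma one_sub_le_den' {z ζ : ℂ} (hζ : ‖ζ‖ ≤ 1) : 1 - ‖z‖ ≤ ‖1 - conj ζ * z‖ := by
  have h1 : ‖(1:ℂ)‖ - ‖conj ζ * z‖ ≤ ‖1 - conj ζ * z‖ := norm_sub_norm_le _ _
  rw [norm_mul, RCLike.norm_conj, norm_one] at h1
  nlinarith [norm_nonneg ζ, norm_nonneg z]

lemma den_pos {z ζ : ℂ} (hz : ‖z‖ ≤ 1) (hζ : ‖ζ‖ < 1) : 0 < ‖1 - conj ζ * z‖ := by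
  have := one_sub_le_den (ζ := ζ) hz
  linarith

lemma den_ne {z ζ : ℂ} (hz : ‖z‖ ≤ 1) (hζ : ‖ζ‖ < 1) : 1 - conj ζ * z ≠ 0 :=
  norm_pos_iff.1 (den_pos hz hζ)

lemma dist_le_den {z ζ : ℂ} (hz : ‖z‖ ≤ 1) (hζ : ‖ζ‖ ≤ 1) : ‖z - ζ‖ ≤ ‖1 - conj ζ * z‖ := by
  have := norm_one_sub_sq z ζ
  have h2 : 0 ≤ (1 - ‖z‖ ^ 2) * (1 - ‖ζ‖ ^ 2) :=
    mul_nonneg (by nlinarith [norm_nonneg z]) (by nlinarith [norm_nonneg ζ])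
  exact le_of_sq_le_sq (by linarith) (norm_nonneg _)

lemma one_sub_sq_le_den {z ζ : ℂ} (hz : ‖z‖ ≤ 1) (hζ : ‖ζ‖ ≤ 1) :
    1 - ‖ζ‖ ^ 2 ≤ 2 * ‖1 - conj ζ * z‖ := by
  have := one_sub_le_den (ζ := ζ) hz
  nlinarith [norm_nonneg ζ]

/-- polar coordinates on the disk -/
lemma lintegral_disk_polar (h : ℂ → ℝ≥0∞) (hm : Measurable h) :
    ∫⁻ ζ in ball (0:ℂ) 1, h ζ = ∫⁻ r in Ioo (0:ℝ) 1, ENNReal.ofReal r *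
      ∫⁻ θ in Ioo (-π) π, h (r * exp (θ * I)) := by
  rw [← lintegral_indicator measurableSet_ball, ← Complex.lintegral_comp_polarCoord_symm]
  have hpm : Measurable (fun p : ℝ × ℝ => Complex.polarCoord.symm p) := by
    have : (fun p : ℝ × ℝ => Complex.polarCoord.symm p) =
      fun p => p.1 * (Real.cos p.2 + Real.sin p.2 * Complex.I) := by
        ext p; exact Complex.polarCoord_symm_apply p
    rw [this]; fun_prop
  have hmi : Measurable ((ball (0:ℂ) 1).indicator h) := hm.indicator measurableSet_ball
  rw [polarCoord_target, Measure.volume_eq_prod, ← Measure.prod_restrict, lintegral_prod]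
  · rw [← lintegral_indicator measurableSet_Ioi, ← lintegral_indicator measurableSet_Ioo]
    congr 1
    ext r
    by_cases h0 : 0 < r
    · simp only [indicator, mem_Ioi, h0, if_true, mem_Ioo, true_and]
      by_cases h1 : r < 1
      · simp only [h1, if_true, smul_eq_mul]
        rw [← lintegral_const_mul]
        · congr 1; ext θ
          have hb : Complex.polarCoord.symm (r, θ) ∈ ball (0:ℂ) 1 := by
            rw [mem_ball_zero_iff, Complex.norm_polarCoord_symm]; simp [abs_of_pos h0, h1]
          rw [if_pos hb]
          congr 2
          rw [Complex.polarCoord_symm_apply, Complex.exp_mul_I]; simp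
        · fun_prop
      · simp only [h1, if_false]
        rw [lintegral_eq_zero_iff]
        · filter_upwards with θ
          have hb : Complex.polarCoord.symm (r, θ) ∉ ball (0:ℂ) 1 := by
            rw [mem_ball_zero_iff, Complex.norm_polarCoord_symm]; simp [abs_of_pos h0]; linarith
          rw [if_neg hb]; simp
        · have := (hmi.comp hpm).comp (measurable_prodMk_left (x := r))
          exact (measurable_const.mul this)
    · simp only [indicator, mem_Ioi, h0, if_false, mem_Ioo, false_and]
  · refine Measurable.aemeasurable ?_
    exact (by fun_prop : Measurable fun p : ℝ × ℝ => ENNReal.ofReal p.1).mul (hmi.comp hpm)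

lemma circle_kernel {c : ℂ} (hc : ‖c‖ < 1) :
    ∫⁻ θ in Ioo (-π) π, ENNReal.ofReal (1 / ‖exp (θ * I) - c‖ ^ 2) =
      ENNReal.ofReal (2 * π / (1 - ‖c‖ ^ 2)) := by
  have hd : ∀ θ : ℝ, 0 < ‖exp (θ * I) - c‖ := by
    intro θ
    have := norm_sub_norm_le (exp (θ * I)) c
    rw [Complex.norm_exp_ofReal_mul_I] at this
    linarith
  have h1c : 0 < 1 - ‖c‖ ^ 2 := by nlinarith [norm_nonneg c]
  have hcont : Continuous fun θ : ℝ => 1 / ‖exp (θ * I) - c‖ ^ 2 := by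
    refine Continuous.div continuous_const (by fun_prop) fun θ => (pow_pos (hd θ) 2).ne'
  have hper : Function.Periodic (fun θ : ℝ => 1 / ‖exp (θ * I) - c‖ ^ 2) (2 * π) := by
    intro θ
    have : exp (((θ + 2 * π : ℝ):ℂ) * I) = exp (θ * I) := by
      rw [Complex.ofReal_add, add_mul, Complex.exp_add]
      simp [Complex.exp_two_pi_mul_I]
    simp only [this]
  rw [← ofReal_integral_eq_lintegral_ofReal]
  · congr 1
    rw [← integral_Ioc_eq_integral_Ioo, ← intervalIntegral.integral_of_le (by linarith [Real.pi_pos])]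
    have h2 := hper.intervalIntegral_add_eq (-π) 0
    rw [show -π + 2 * π = π by ring, zero_add] at h2
    rw [h2]
    have h3 := DiffContOnCl.circleAverage_poissonKernel_smul' (f := fun _ => (1:ℂ)) (c := 0) (R := 1)
      (w := c) diffContOnCl_const (by simpa using hc)
    rw [Real.circleAverage_def] at h3
    simp only [sub_zero, circleMap_zero, Complex.ofReal_one, one_mul,
      Complex.norm_exp_ofReal_mul_I, one_pow] at h3
    have h4 : ∀ θ : ℝ, ((1 - ‖c‖ ^ 2) / ‖exp (θ * I) - c‖ ^ 2) • (1:ℂ) =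
       (((1 - ‖c‖ ^ 2) * (1 / ‖exp (θ * I) - c‖ ^ 2) : ℝ) : ℂ) := by
      intro θ; rw [Complex.real_smul]; simp [div_eq_mul_inv]
    simp only [h4] at h3
    rw [intervalIntegral.integral_ofReal, intervalIntegral.integral_const_mul, Complex.real_smul] at h3
    have h5 : (2 * π)⁻¹ * ((1 - ‖c‖ ^ 2) * ∫ x in (0:ℝ)..2 * π, 1 / ‖exp (x * I) - c‖ ^ 2) = 1 := by
      exact_mod_cast h3
    have hpi := Real.pi_pos
    generalize (∫ x in (0:ℝ)..2 * π, 1 / ‖exp (x * I) - c‖ ^ 2) = J at h5 ⊢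
    field_simp at h5 ⊢
    linarith
  · exact (hcont.integrableOn_Icc (a := -π) (b := π)).mono_set Ioo_subset_Icc_self
  · filter_upwards with θ
    positivity

lemma radial_bound {s : ℝ} (hs0 : 0 < s) (hs1 : s < 1) {d : ℝ} (hd0 : 0 < d) (hd1 : d ≤ 1) :
    ∫⁻ r in Ioo (0:ℝ) 1, ENNReal.ofReal ((1 - r) ^ (-s) / max d (1 - r)) ≤
      ENNReal.ofReal ((1 / (1 - s) + 1 / s) * d ^ (-s)) := by
  have e1 : ∫⁻ r in Ioo (0:ℝ) 1, ENNReal.ofReal ((1 - r) ^ (-s) / max d (1 - r)) =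
      ∫⁻ t in Ioo (0:ℝ) 1, ENNReal.ofReal (t ^ (-s) / max d t) := by
    have hmp : MeasurePreserving (fun r : ℝ => 1 - r) volume volume :=
      Measure.measurePreserving_sub_left volume 1
    have := hmp.setLIntegral_comp_preimage (s := Ioo (0:ℝ) 1) measurableSet_Ioo
      (f := fun t => ENNReal.ofReal (t ^ (-s) / max d t)) (by fun_prop)
    rw [← this]
    have hset : (fun r : ℝ => 1 - r) ⁻¹' Ioo (0:ℝ) 1 = Ioo 0 1 := by
      ext r; simp only [mem_preimage, mem_Ioo]
      constructor <;> rintro ⟨a, b⟩ <;> constructor <;> linarith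
    rw [hset]
  rw [e1]
  have hsub : Ioo (0:ℝ) 1 ⊆ Ioc 0 d ∪ Ioi d := by
    intro t ht
    rcases le_or_gt t d with h | h
    · exact Or.inl ⟨ht.1, h⟩
    · exact Or.inr h
  have a1 : ∫⁻ t in Ioc (0:ℝ) d, ENNReal.ofReal (t ^ (-s) / max d t) ≤
      ENNReal.ofReal (1 / (1 - s) * d ^ (-s)) := by
    calc _ ≤ ∫⁻ t in Ioc (0:ℝ) d, ENNReal.ofReal (t ^ (-s) * d⁻¹) := by
          refine setLIntegral_mono (by fun_prop) fun t ht => ENNReal.ofReal_le_ofReal ?_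
          rw [max_eq_left ht.2, div_eq_mul_inv]
      _ = ENNReal.ofReal (∫ t in Ioc (0:ℝ) d, t ^ (-s) * d⁻¹) := by
          rw [ofReal_integral_eq_lintegral_ofReal]
          · have := intervalIntegral.intervalIntegrable_rpow' (a := 0) (b := d) (r := -s) (by linarith)
            rw [intervalIntegrable_iff_integrableOn_Ioc_of_le hd0.le] at this
            exact this.mul_const _
          · refine (ae_restrict_iff' measurableSet_Ioc).2 (Eventually.of_forall fun t ht => ?_)
            have := Real.rpow_nonneg ht.1.le (-s)
            have := inv_pos.2 hd0
            simp only [Pi.zero_apply]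
            positivity
      _ ≤ _ := by
          refine ENNReal.ofReal_le_ofReal (le_of_eq ?_)
          rw [← intervalIntegral.integral_of_le hd0.le, intervalIntegral.integral_mul_const,
            integral_rpow (Or.inl (by linarith)), Real.zero_rpow (by linarith), Real.rpow_add hd0,
            Real.rpow_one]
          have : (1 - s) ≠ 0 := by linarith
          have : (-s + 1) ≠ 0 := by linarith
          rw [show -s + 1 = 1 - s by ring]
          field_simp
          simp
  have a2 : ∫⁻ t in Ioi d, ENNReal.ofReal (t ^ (-s) / max d t) ≤
      ENNReal.ofReal (1 / s * d ^ (-s)) := by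
    calc _ ≤ ∫⁻ t in Ioi d, ENNReal.ofReal (t ^ (-s - 1)) := by
          refine setLIntegral_mono (by fun_prop) fun t ht => ENNReal.ofReal_le_ofReal ?_
          have ht' : d < t := ht
          rw [max_eq_right ht'.le, Real.rpow_sub (hd0.trans ht'), Real.rpow_one]
      _ = ENNReal.ofReal (∫ t in Ioi d, t ^ (-s - 1)) := by
          rw [ofReal_integral_eq_lintegral_ofReal]
          · exact integrableOn_Ioi_rpow_of_lt (by linarith) hd0
          · refine (ae_restrict_iff' measurableSet_Ioi).2 (Eventually.of_forall fun t ht => ?_)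
            exact Real.rpow_nonneg (hd0.le.trans (le_of_lt ht)) _
      _ ≤ _ := by
          refine ENNReal.ofReal_le_ofReal (le_of_eq ?_)
          rw [integral_Ioi_rpow_of_lt (by linarith) hd0]
          rw [show -s - 1 + 1 = -s by ring]
          field_simp
  calc _ ≤ ∫⁻ t in Ioc (0:ℝ) d ∪ Ioi d, ENNReal.ofReal (t ^ (-s) / max d t) :=
        lintegral_mono_set hsub
    _ ≤ _ := lintegral_union_le _ _ _
    _ ≤ ENNReal.ofReal (1 / (1 - s) * d ^ (-s)) + ENNReal.ofReal (1 / s * d ^ (-s)) :=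
        add_le_add a1 a2
    _ = _ := by
      have h3 : 0 < d ^ (-s) := Real.rpow_pos_of_pos hd0 _
      have h4 : 0 < 1 - s := by linarith
      rw [← ENNReal.ofReal_add (by positivity) (by positivity), add_mul]

/-- the kernel `1/|1 - ζ̄ z|²` -/
def Kk (z ζ : ℂ) : ℝ≥0∞ := ENNReal.ofReal (1 / ‖1 - conj ζ * z‖ ^ 2)

lemma measurable_Kk : Measurable (fun q : ℂ × ℂ => Kk q.1 q.2) := by
  unfold Kk
  have : Measurable fun q : ℂ × ℂ => conj q.2 := Complex.continuous_conj.measurable.comp measurable_snd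
  fun_prop

lemma measurable_Kk_right (z : ℂ) : Measurable (fun ζ => Kk z ζ) := by
  unfold Kk
  have : Measurable fun q : ℂ => conj q := Complex.continuous_conj.measurable
  fun_prop

lemma measurable_Kk_left (ζ : ℂ) : Measurable (fun z => Kk z ζ) := by
  unfold Kk
  fun_prop

lemma Kk_symm (z ζ : ℂ) : Kk z ζ = Kk ζ z := by
  unfold Kk
  congr 3
  rw [← RCLike.norm_conj]
  simp [mul_comm]

/-- Forelli-Rudin type estimate. -/
lemma forelli_rudin {s : ℝ} (hs0 : 0 < s) (hs1 : s < 1) :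
    ∃ C : ℝ, 0 < C ∧ ∀ z ∈ ball (0:ℂ) 1,
      ∫⁻ ζ in ball (0:ℂ) 1, Kk z ζ * ENNReal.ofReal ((1 - ‖ζ‖ ^ 2) ^ (-s)) ≤
        ENNReal.ofReal (C * (1 - ‖z‖ ^ 2) ^ (-s)) := by
  have h4 : 0 < 1 - s := by linarith
  refine ⟨2 * π * (1 / (1 - s) + 1 / s), by have := Real.pi_pos; positivity, fun z hz => ?_⟩
  have hz1 : ‖z‖ < 1 := by simpa using hz
  have hd0 : 0 < 1 - ‖z‖ ^ 2 := by nlinarith [norm_nonneg z]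
  have hd1 : 1 - ‖z‖ ^ 2 ≤ 1 := by nlinarith [norm_nonneg z]
  rw [lintegral_disk_polar]
  · calc _ ≤ ∫⁻ r in Ioo (0:ℝ) 1, ENNReal.ofReal (2 * π) *
          ENNReal.ofReal ((1 - r) ^ (-s) / max (1 - ‖z‖ ^ 2) (1 - r)) := by
          refine setLIntegral_mono (by fun_prop) fun r hr => ?_
          have hr0 := hr.1
          have hr1 := hr.2
          have hnorm : ∀ θ : ℝ, ‖(r * exp (θ * I) : ℂ)‖ = r := by
            intro θ
            rw [norm_mul, Complex.norm_exp_ofReal_mul_I]; simp [abs_of_pos hr0]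
          have hk : ∀ θ : ℝ, Kk z (r * exp (θ * I)) =
              ENNReal.ofReal (1 / ‖exp (θ * I) - r * z‖ ^ 2) := by
            intro θ
            unfold Kk
            congr 3
            rw [← one_mul ‖1 - _‖, ← Complex.norm_exp_ofReal_mul_I θ, ← norm_mul]
            congr 1
            have h1 : exp (θ * I) * conj (exp (θ * I)) = 1 := by
              rw [Complex.mul_conj, Complex.normSq_eq_norm_sq, Complex.norm_exp_ofReal_mul_I]; simp
            rw [map_mul, Complex.conj_ofReal]
            linear_combination (-(r * z : ℂ)) * h1
          simp only [hnorm, hk]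
          rw [lintegral_mul_const _ (by fun_prop), circle_kernel (by
            rw [norm_mul]; simp [abs_of_pos hr0]; nlinarith [norm_nonneg z])]
          have hrz : ‖(r * z : ℂ)‖ = r * ‖z‖ := by rw [norm_mul]; simp [abs_of_pos hr0]
          rw [hrz]
          have hden : 0 < 1 - (r * ‖z‖) ^ 2 := by
            have : r * ‖z‖ < 1 := by nlinarith [norm_nonneg z]
            nlinarith [mul_nonneg hr0.le (norm_nonneg z)]
          have hpi := Real.pi_pos
          rw [← ENNReal.ofReal_mul (by positivity), ← ENNReal.ofReal_mul hr0.le,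
            ← ENNReal.ofReal_mul (by positivity)]
          refine ENNReal.ofReal_le_ofReal ?_
          have hmax : max (1 - ‖z‖ ^ 2) (1 - r) ≤ 1 - (r * ‖z‖) ^ 2 := by
            have hz2 : ‖z‖ ^ 2 ≤ 1 := by nlinarith [norm_nonneg z]
            have hr2 : r ^ 2 ≤ r := by nlinarith
            refine max_le ?_ ?_
            · nlinarith [mul_nonneg (sq_nonneg ‖z‖) (by nlinarith : 0 ≤ 1 - r ^ 2)]
            · nlinarith [mul_nonneg (sq_nonneg r) (by linarith : 0 ≤ 1 - ‖z‖ ^ 2)]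
          have hpow : (1 - r ^ 2) ^ (-s) ≤ (1 - r) ^ (-s) :=
            Real.rpow_le_rpow_of_nonpos (by linarith) (by nlinarith) (by linarith)
          have hp0 : 0 ≤ (1 - r) ^ (-s) := Real.rpow_nonneg (by linarith) _
          have hpp : 0 ≤ (1 - r^2) ^ (-s) := Real.rpow_nonneg (by nlinarith) _
          have hm0 : 0 < max (1 - ‖z‖ ^ 2) (1 - r) := lt_max_of_lt_left hd0
          have hpi := Real.pi_pos
          calc r * (2 * π / (1 - (r * ‖z‖) ^ 2) * (1 - r ^ 2) ^ (-s))
              ≤ 1 * (2 * π / max (1 - ‖z‖ ^ 2) (1 - r) * (1 - r) ^ (-s)) := by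
                gcongr
            _ = _ := by field_simp
      _ = ENNReal.ofReal (2 * π) * ∫⁻ r in Ioo (0:ℝ) 1,
          ENNReal.ofReal ((1 - r) ^ (-s) / max (1 - ‖z‖ ^ 2) (1 - r)) := by
          rw [lintegral_const_mul _ (by fun_prop)]
      _ ≤ ENNReal.ofReal (2 * π) * ENNReal.ofReal ((1 / (1 - s) + 1 / s) * (1 - ‖z‖ ^ 2) ^ (-s)) := by
          gcongr; exact radial_bound hs0 hs1 hd0 hd1
      _ = _ := by rw [← ENNReal.ofReal_mul (by have := Real.pi_pos; positivity)]; congr 1; ring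
  · exact (measurable_Kk_right z).mul (by fun_prop)

end

section

/-- modulus of the derivative of the Moebius map -/
def jac (a z : ℂ) : ℝ := (1 - ‖a‖ ^ 2) / ‖1 - conj a * z‖ ^ 2

/-- `1 - |φ_a|²` -/
def Qa (a z : ℂ) : ℝ := 1 - ‖moebius a z‖ ^ 2

lemma Qa_eq {a z : ℂ} (ha : ‖a‖ < 1) (hz : ‖z‖ < 1) :
    Qa a z = (1 - ‖a‖ ^ 2) * (1 - ‖z‖ ^ 2) / ‖1 - conj a * z‖ ^ 2 := by
  have h := norm_one_sub_sq z a
  have hd := den_pos hz.le ha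
  unfold Qa moebius
  rw [norm_div, div_pow, norm_sub_rev a z, eq_div_iff (by positivity), sub_mul,
    div_mul_cancel₀ _ (by positivity)]
  linarith

lemma one_sub_sq_pos {z : ℂ} (hz : ‖z‖ < 1) : 0 < 1 - ‖z‖ ^ 2 := by
  nlinarith [norm_nonneg z]

lemma Qa_pos {a z : ℂ} (ha : ‖a‖ < 1) (hz : ‖z‖ < 1) : 0 < Qa a z := by
  rw [Qa_eq ha hz]
  have := one_sub_sq_pos ha
  have := one_sub_sq_pos hz
  have := den_pos hz.le ha
  positivity

lemma jac_pos {a z : ℂ} (ha : ‖a‖ < 1) (hz : ‖z‖ < 1) : 0 < jac a z := by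
  unfold jac
  have := one_sub_sq_pos ha
  have := den_pos hz.le ha
  positivity

lemma moebius_lt {a z : ℂ} (ha : ‖a‖ < 1) (hz : ‖z‖ < 1) : ‖moebius a z‖ < 1 := by
  have := Qa_pos ha hz
  unfold Qa at this
  nlinarith [norm_nonneg (moebius a z)]

lemma one_sub_conj_moebius {a z : ℂ} (ha : ‖a‖ < 1) (hz : ‖z‖ < 1) :
    1 - conj a * moebius a z = ((1 - ‖a‖ ^ 2 : ℝ) : ℂ) / (1 - conj a * z) := by
  have hd := den_ne hz.le ha
  unfold moebius
  have h1 : (((1 - ‖a‖ ^ 2 : ℝ)) : ℂ) = 1 - conj a * a := by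
    rw [mul_comm, Complex.mul_conj, Complex.normSq_eq_norm_sq]; push_cast; ring
  rw [h1, eq_div_iff hd, sub_mul, one_mul, mul_assoc, div_mul_cancel₀ _ hd]
  ring

lemma moebius_moebius {a z : ℂ} (ha : ‖a‖ < 1) (hz : ‖z‖ < 1) :
    moebius a (moebius a z) = z := by
  have hd := den_ne hz.le ha
  have hm := den_ne (moebius_lt ha hz).le ha
  have hmm : moebius a z * (1 - conj a * z) = a - z := div_mul_cancel₀ _ hd
  rw [moebius, div_eq_iff hm]
  linear_combination -hmm

lemma jac_moebius {a z : ℂ} (ha : ‖a‖ < 1) (hz : ‖z‖ < 1) :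
    jac a (moebius a z) * jac a z = 1 := by
  have hd := den_pos hz.le ha
  have ha' := one_sub_sq_pos ha
  unfold jac
  rw [one_sub_conj_moebius ha hz, norm_div, Complex.norm_real, Real.norm_of_nonneg ha'.le]
  field_simp

lemma kernel_moebius {a z η : ℂ} (ha : ‖a‖ < 1) (hz : ‖z‖ < 1) (hη : ‖η‖ < 1) :
    1 / ‖1 - conj (moebius a η) * z‖ ^ 2 * jac a η =
      1 / ‖1 - conj η * moebius a z‖ ^ 2 * jac a z := by
  have hdz := den_pos hz.le ha
  have hdη := den_pos hη.le ha
  have hdz' := den_ne hz.le ha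
  have hdη' := den_ne hη.le ha
  have hda : 1 - a * conj η ≠ 0 := by
    have := (map_ne_zero (starRingEnd ℂ)).2 hdη'
    simpa using this
  have e1 : ‖1 - conj (moebius a η) * z‖ * ‖1 - conj a * η‖ =
      ‖1 - a * conj η - conj a * z + conj η * z‖ := by
    rw [← RCLike.norm_conj (1 - conj a * η), ← norm_mul]
    congr 1
    have hmm : moebius a η * (1 - conj a * η) = a - η := div_mul_cancel₀ _ hdη'
    have hc := congrArg (starRingEnd ℂ) hmm
    simp only [map_sub, map_mul, map_one, Complex.conj_conj] at hc ⊢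
    linear_combination (-z) * hc
  have e2 : ‖1 - conj η * moebius a z‖ * ‖1 - conj a * z‖ =
      ‖1 - a * conj η - conj a * z + conj η * z‖ := by
    rw [← norm_mul]
    congr 1
    have hmm : moebius a z * (1 - conj a * z) = a - z := div_mul_cancel₀ _ hdz'
    linear_combination (-conj η) * hmm
  have e3 : ‖1 - conj (moebius a η) * z‖ ^ 2 * ‖1 - conj a * η‖ ^ 2 =
      ‖1 - conj η * moebius a z‖ ^ 2 * ‖1 - conj a * z‖ ^ 2 := by
    rw [← mul_pow, ← mul_pow, e1, e2]
  unfold jac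
  rw [div_mul_div_comm, div_mul_div_comm, e3]

lemma Kk_moebius {a z η : ℂ} (ha : ‖a‖ < 1) (hz : ‖z‖ < 1) (hη : ‖η‖ < 1) :
    Kk z (moebius a η) * ENNReal.ofReal (jac a η) =
      Kk (moebius a z) η * ENNReal.ofReal (jac a z) := by
  unfold Kk
  rw [← ENNReal.ofReal_mul (by positivity), ← ENNReal.ofReal_mul (by positivity),
    kernel_moebius ha hz hη]

lemma hasDerivAt_moebius {a z : ℂ} (ha : ‖a‖ < 1) (hz : ‖z‖ < 1) :
    HasDerivAt (moebius a) ((conj a * a - 1) / (1 - conj a * z) ^ 2) z := by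
  have hd := den_ne hz.le ha
  unfold moebius
  have h1 : HasDerivAt (fun z => a - z) (-1) z := by simpa using (hasDerivAt_id z).const_sub a
  have h2 : HasDerivAt (fun z => 1 - conj a * z) (-(conj a)) z := by
    simpa using ((hasDerivAt_id z).const_mul (conj a)).const_sub 1
  refine (h1.div h2 hd).congr_deriv ?_
  congr 1; ring

lemma det_mul_complex (c : ℂ) :
    (((ContinuousLinearMap.toSpanSingleton ℂ c : ℂ →L[ℂ] ℂ).restrictScalars ℝ)).det = ‖c‖ ^ 2 := by
  rw [← Complex.normSq_eq_norm_sq, ← Algebra.norm_complex_apply, Algebra.norm_apply]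
  unfold ContinuousLinearMap.det
  congr 1
  ext x; simp [mul_comm]

lemma measurable_moebius (a : ℂ) : Measurable (moebius a) := by
  unfold moebius; fun_prop

lemma moebius_cv {a : ℂ} (ha : ‖a‖ < 1) (h : ℂ → ℝ≥0∞) :
    ∫⁻ ζ in ball (0:ℂ) 1, h (moebius a ζ) * ENNReal.ofReal (jac a ζ ^ 2) =
      ∫⁻ η in ball (0:ℂ) 1, h η := by
  have him : moebius a '' ball (0:ℂ) 1 = ball 0 1 := by
    ext w
    simp only [mem_image, mem_ball_zero_iff]
    constructor
    · rintro ⟨z, hz, rfl⟩; exact moebius_lt ha hz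
    · intro hw; exact ⟨moebius a w, moebius_lt ha hw, moebius_moebius ha hw⟩
  have hinj : InjOn (moebius a) (ball 0 1) := by
    intro x hx y hy hxy
    rw [mem_ball_zero_iff] at hx hy
    rw [← moebius_moebius ha hx, hxy, moebius_moebius ha hy]
  conv_rhs => rw [← him]
  rw [lintegral_image_eq_lintegral_abs_det_fderiv_mul volume measurableSet_ball
    (f' := fun z => (ContinuousLinearMap.toSpanSingleton ℂ
      ((conj a * a - 1) / (1 - conj a * z) ^ 2) : ℂ →L[ℂ] ℂ).restrictScalars ℝ) ?_ hinj]
  · refine setLIntegral_congr_fun measurableSet_ball fun z hz => ?_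
    rw [mem_ball_zero_iff] at hz
    rw [mul_comm, det_mul_complex, abs_of_nonneg (by positivity)]
    congr 3
    unfold jac
    rw [norm_div, norm_pow, norm_sub_rev (conj a * a) 1]
    congr 1
    rw [mul_comm, Complex.mul_conj, Complex.normSq_eq_norm_sq, ← Complex.ofReal_one,
      ← Complex.ofReal_sub, Complex.norm_real, Real.norm_of_nonneg (one_sub_sq_pos ha).le]
  · intro z hz
    rw [mem_ball_zero_iff] at hz
    exact ((hasDerivAt_moebius ha hz).hasFDerivAt.restrictScalars ℝ).hasFDerivWithinAt

lemma measurable_jac (a : ℂ) : Measurable (jac a) := by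
  unfold jac; fun_prop

lemma measurable_Qa (a : ℂ) : Measurable (Qa a) := by
  unfold Qa; have := measurable_moebius a; fun_prop

lemma schur_test {s : ℝ} (hs0 : 0 < s) (hs1 : s < 1) :
    ∃ C : ℝ, 0 < C ∧ ∀ a : ℂ, ‖a‖ < 1 → ∀ z : ℂ, ‖z‖ < 1 →
      ∫⁻ ζ in ball (0:ℂ) 1, Kk z ζ * ENNReal.ofReal (jac a ζ * Qa a ζ ^ (-s)) ≤
        ENNReal.ofReal (C * (jac a z * Qa a z ^ (-s))) := by
  obtain ⟨C, hC, h⟩ := forelli_rudin hs0 hs1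
  refine ⟨C, hC, fun a ha z hz => ?_⟩
  have h1 := h (moebius a z) (by simpa using moebius_lt ha hz)
  calc _ = ∫⁻ ζ in ball (0:ℂ) 1, (fun η => Kk z (moebius a η) * ENNReal.ofReal (jac a η) *
        ENNReal.ofReal ((1 - ‖η‖ ^ 2) ^ (-s))) (moebius a ζ) * ENNReal.ofReal (jac a ζ ^ 2) := by
        refine setLIntegral_congr_fun measurableSet_ball fun ζ hζ => ?_
        rw [mem_ball_zero_iff] at hζ
        have hj := jac_pos ha hζ
        have hj' := jac_pos ha (moebius_lt ha hζ)
        beta_reduce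
        rw [moebius_moebius ha hζ, mul_assoc, mul_assoc]
        congr 1
        have hQ : 0 < Qa a ζ := Qa_pos ha hζ
        have hQ' : 0 ≤ Qa a ζ ^ (-s) := Real.rpow_nonneg hQ.le _
        change _ = _ * (ENNReal.ofReal (Qa a ζ ^ (-s)) * _)
        rw [← ENNReal.ofReal_mul hQ', ← ENNReal.ofReal_mul hj'.le]
        congr 1
        have := jac_moebius ha hζ
        linear_combination (- jac a ζ * Qa a ζ ^ (-s)) * this
    _ = ∫⁻ η in ball (0:ℂ) 1, Kk z (moebius a η) * ENNReal.ofReal (jac a η) *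
        ENNReal.ofReal ((1 - ‖η‖ ^ 2) ^ (-s)) := moebius_cv ha
          (fun η => Kk z (moebius a η) * ENNReal.ofReal (jac a η) *
            ENNReal.ofReal ((1 - ‖η‖ ^ 2) ^ (-s)))
    _ = ∫⁻ η in ball (0:ℂ) 1, ENNReal.ofReal (jac a z) * (Kk (moebius a z) η  *
        ENNReal.ofReal ((1 - ‖η‖ ^ 2) ^ (-s))) := by
        refine setLIntegral_congr_fun measurableSet_ball fun η hη => ?_
        rw [mem_ball_zero_iff] at hη
        rw [Kk_moebius ha hz hη]; ring
    _ = ENNReal.ofReal (jac a z) * ∫⁻ η in ball (0:ℂ) 1, (Kk (moebius a z) η  *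
        ENNReal.ofReal ((1 - ‖η‖ ^ 2) ^ (-s))) := by
        rw [lintegral_const_mul]
        exact (measurable_Kk_right _).mul (by fun_prop)
    _ ≤ ENNReal.ofReal (jac a z) * ENNReal.ofReal (C * (1 - ‖moebius a z‖ ^ 2) ^ (-s)) := by gcongr
    _ = _ := by
        rw [← ENNReal.ofReal_mul (jac_pos ha hz).le]
        congr 1
        unfold Qa; ring

/-- the positive Bergman operator -/
def TT (ω : ℂ → ℝ≥0∞) (z : ℂ) : ℝ≥0∞ := ∫⁻ ζ in ball (0:ℂ) 1, Kk z ζ * ω ζ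

lemma measurable_TT {ω : ℂ → ℝ≥0∞} (hω : Measurable ω) : Measurable (TT ω) := by
  unfold TT
  exact Measurable.lintegral_prod_right' (f := fun q : ℂ × ℂ => Kk q.1 q.2 * ω q.2)
    (measurable_Kk.mul (hω.comp measurable_snd))

def wt (p : ℝ) (a z : ℂ) : ℝ≥0∞ := ENNReal.ofReal (Qa a z ^ p)

lemma measurable_wt (p : ℝ) (a : ℂ) : Measurable (wt p a) := by
  unfold wt; have := measurable_Qa a; fun_prop

lemma cs_sqrt {μ : Measure ℂ} {u v : ℂ → ℝ≥0∞} (hu : AEMeasurable u μ) (hv : AEMeasurable v μ) :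
    (∫⁻ x, (u x * v x) ^ (1/2:ℝ) ∂μ) ^ 2 ≤ (∫⁻ x, u x ∂μ) * ∫⁻ x, v x ∂μ := by
  have h := ENNReal.lintegral_mul_le_Lp_mul_Lq μ (p := 2) (q := 2) Real.HolderConjugate.two_two
    (f := fun x => u x ^ (1/2:ℝ)) (g := fun x => v x ^ (1/2:ℝ))
    (hu.pow_const _) (hv.pow_const _)
  have e : ∀ x : ℝ≥0∞, (x ^ (1/2:ℝ)) ^ (2:ℝ) = x := fun x => by
    rw [← ENNReal.rpow_mul]; norm_num
  simp only [Pi.mul_apply, e] at h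
  have e2 : ∀ x, (u x * v x) ^ (1/2:ℝ) = u x ^ (1/2:ℝ) * v x ^ (1/2:ℝ) := fun x =>
    ENNReal.mul_rpow_of_nonneg _ _ (by norm_num)
  simp only [e2]
  calc _ ≤ ((∫⁻ x, u x ∂μ) ^ (1/2:ℝ) * (∫⁻ x, v x ∂μ) ^ (1/2:ℝ)) ^ 2 := by gcongr
    _ = _ := by
      rw [mul_pow, ← ENNReal.rpow_two, ← ENNReal.rpow_two, e, e]

theorem TT_bound {p : ℝ} (hp0 : 0 < p) (hp1 : p < 1) :
    ∃ C : ℝ, 0 < C ∧ ∀ a : ℂ, ‖a‖ < 1 → ∀ ω : ℂ → ℝ≥0∞, Measurable ω →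
      ∫⁻ z in ball (0:ℂ) 1, TT ω z ^ 2 * wt p a z ≤
        ENNReal.ofReal C * ∫⁻ ζ in ball (0:ℂ) 1, ω ζ ^ 2 * wt p a ζ := by
  set s := (1 + p) / 2 with hs
  obtain ⟨C1, hC1, h1⟩ := schur_test (s := s) (by linarith) (by linarith)
  obtain ⟨C2, hC2, h2⟩ := schur_test (s := s - p) (by linarith) (by linarith)
  refine ⟨C1 * C2, by positivity, fun a ha ω hω => ?_⟩
  set H : ℂ → ℝ := fun ζ => jac a ζ * Qa a ζ ^ (-s) with hH
  have hHm : Measurable H := by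
    have := measurable_jac a; have := measurable_Qa a; fun_prop
  have hHpos : ∀ ζ, ‖ζ‖ < 1 → 0 < H ζ := fun ζ hζ =>
    mul_pos (jac_pos ha hζ) (Real.rpow_pos_of_pos (Qa_pos ha hζ) _)
  have step1 : ∀ z, ‖z‖ < 1 → TT ω z ^ 2 ≤ ENNReal.ofReal (C1 * H z) *
      ∫⁻ ζ in ball (0:ℂ) 1, Kk z ζ * (ω ζ ^ 2 * ENNReal.ofReal (H ζ)⁻¹) := by
    intro z hz
    calc TT ω z ^ 2 = (∫⁻ ζ in ball (0:ℂ) 1, ((Kk z ζ * ENNReal.ofReal (H ζ)) *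
          (Kk z ζ * (ω ζ ^ 2 * ENNReal.ofReal (H ζ)⁻¹))) ^ (1/2:ℝ)) ^ 2 := by
          unfold TT
          congr 1
          refine setLIntegral_congr_fun measurableSet_ball fun ζ hζ => ?_
          rw [mem_ball_zero_iff] at hζ
          have hpos := hHpos ζ hζ
          have e1 : ENNReal.ofReal (H ζ) * ENNReal.ofReal (H ζ)⁻¹ = 1 := by
            rw [← ENNReal.ofReal_mul hpos.le, mul_inv_cancel₀ hpos.ne', ENNReal.ofReal_one]
          rw [show (Kk z ζ * ENNReal.ofReal (H ζ)) * (Kk z ζ * (ω ζ ^ 2 * ENNReal.ofReal (H ζ)⁻¹)) =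
            (Kk z ζ * ω ζ) ^ 2 * (ENNReal.ofReal (H ζ) * ENNReal.ofReal (H ζ)⁻¹) by ring, e1, mul_one,
            ← ENNReal.rpow_two, ← ENNReal.rpow_mul]
          norm_num
      _ ≤ _ := cs_sqrt (by have := measurable_Kk_right z; fun_prop)
            (by have := measurable_Kk_right z; fun_prop)
      _ ≤ _ := by gcongr; exact h1 a ha z hz
  calc _ ≤ ∫⁻ z in ball (0:ℂ) 1, ∫⁻ ζ in ball (0:ℂ) 1, (ENNReal.ofReal (C1 * H z) * wt p a z) *
        (Kk z ζ * (ω ζ ^ 2 * ENNReal.ofReal (H ζ)⁻¹)) := by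
        refine setLIntegral_mono' measurableSet_ball fun z hz => ?_
        rw [mem_ball_zero_iff] at hz
        rw [lintegral_const_mul _ (by have := measurable_Kk_right z; fun_prop)]
        calc _ ≤ (ENNReal.ofReal (C1 * H z) *
      ∫⁻ ζ in ball (0:ℂ) 1, Kk z ζ * (ω ζ ^ 2 * ENNReal.ofReal (H ζ)⁻¹)) * wt p a z := by
              gcongr; exact step1 z hz
          _ = _ := by ring
    _ = ∫⁻ ζ in ball (0:ℂ) 1, ∫⁻ z in ball (0:ℂ) 1, (ENNReal.ofReal (C1 * H z) * wt p a z) *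
        (Kk z ζ * (ω ζ ^ 2 * ENNReal.ofReal (H ζ)⁻¹)) := by
        refine lintegral_lintegral_swap ?_
        refine Measurable.aemeasurable ?_
        have m1 := measurable_wt p a
        have m2 := measurable_Kk
        change Measurable fun q : ℂ × ℂ => (ENNReal.ofReal (C1 * H q.1) * wt p a q.1) *
          (Kk q.1 q.2 * (ω q.2 ^ 2 * ENNReal.ofReal (H q.2)⁻¹))
        fun_prop
    _ ≤ ∫⁻ ζ in ball (0:ℂ) 1, ENNReal.ofReal (C1 * C2) * (ω ζ ^ 2 * wt p a ζ) := by
        refine setLIntegral_mono' measurableSet_ball fun ζ hζ => ?_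
        rw [mem_ball_zero_iff] at hζ
        have hpos := hHpos ζ hζ
        have e0 : ∀ z, ‖z‖ < 1 → H z * Qa a z ^ p = jac a z * Qa a z ^ (-(s - p)) := by
          intro z hz
          change jac a z * Qa a z ^ (-s) * _ = _
          rw [mul_assoc, ← Real.rpow_add (Qa_pos ha hz)]; congr 2; ring
        calc _ = ∫⁻ z in ball (0:ℂ) 1, (ENNReal.ofReal C1 * (ω ζ ^ 2 * ENNReal.ofReal (H ζ)⁻¹)) *
              (Kk ζ z * ENNReal.ofReal (jac a z * Qa a z ^ (-(s - p)))) := by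
              refine setLIntegral_congr_fun measurableSet_ball fun z hz => ?_
              rw [mem_ball_zero_iff] at hz
              rw [← e0 z hz, ENNReal.ofReal_mul hC1.le, ENNReal.ofReal_mul (hHpos z hz).le, Kk_symm z ζ,
                wt]
              ring
          _ = (ENNReal.ofReal C1 * (ω ζ ^ 2 * ENNReal.ofReal (H ζ)⁻¹)) * ∫⁻ z in ball (0:ℂ) 1,
              (Kk ζ z * ENNReal.ofReal (jac a z * Qa a z ^ (-(s - p)))) := by
              rw [lintegral_const_mul]
              have := measurable_Kk_right ζ; have := measurable_jac a; have := measurable_Qa a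
              fun_prop
          _ ≤ (ENNReal.ofReal C1 * (ω ζ ^ 2 * ENNReal.ofReal (H ζ)⁻¹)) *
              ENNReal.ofReal (C2 * (jac a ζ * Qa a ζ ^ (-(s - p)))) := by
              gcongr; exact h2 a ha ζ hζ
          _ = _ := by
              rw [← e0 ζ hζ, ENNReal.ofReal_mul hC2.le, ENNReal.ofReal_mul hpos.le, wt]
              have e1 : ENNReal.ofReal (H ζ)⁻¹ * ENNReal.ofReal (H ζ) = 1 := by
                rw [← ENNReal.ofReal_mul (inv_pos.2 hpos).le, inv_mul_cancel₀ hpos.ne', ENNReal.ofReal_one]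
              rw [ENNReal.ofReal_mul hC1.le]
              calc _ = (ENNReal.ofReal (H ζ)⁻¹ * ENNReal.ofReal (H ζ)) * (ENNReal.ofReal C1 * ENNReal.ofReal C2 *
                (ω ζ ^ 2 * ENNReal.ofReal (Qa a ζ ^ p))) := by ring
                _ = _ := by rw [e1, one_mul]
    _ = _ := by
        rw [lintegral_const_mul]
        have := measurable_wt p a
        fun_prop

/-- Carleson-type bound from the weighted `L²` bound. -/
theorem carleson_bound {p : ℝ} (hp0 : 0 < p) (hp1 : p < 1) :
    ∃ C : ℝ, 0 < C ∧ ∀ a : ℂ, ‖a‖ < 1 → ∀ ω : ℂ → ℝ≥0∞, Measurable ω →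
      (∫⁻ ζ in ball (0:ℂ) 1, ω ζ * ENNReal.ofReal (jac a ζ)) ^ 2 ≤
        ENNReal.ofReal C * ∫⁻ ζ in ball (0:ℂ) 1, ω ζ ^ 2 * wt p a ζ := by
  obtain ⟨C, hC, h⟩ := forelli_rudin hp0 hp1
  refine ⟨C, hC, fun a ha ω hω => ?_⟩
  have h0 := h 0 (by simp)
  have m1 := measurable_jac a
  have m2 := measurable_Qa a
  have m3 := measurable_wt p a
  have e1 : ∫⁻ ζ in ball (0:ℂ) 1, ENNReal.ofReal (Qa a ζ ^ (-p)) * ENNReal.ofReal (jac a ζ ^ 2) ≤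
      ENNReal.ofReal C := by
    have := moebius_cv ha (fun η => ENNReal.ofReal ((1 - ‖η‖ ^ 2) ^ (-p)))
    change ∫⁻ ζ in ball (0:ℂ) 1, ENNReal.ofReal (Qa a ζ ^ (-p)) * ENNReal.ofReal (jac a ζ ^ 2) = _ at this
    rw [this]
    simpa [Kk] using h0
  calc _ = (∫⁻ ζ in ball (0:ℂ) 1, ((ENNReal.ofReal (Qa a ζ ^ (-p)) * ENNReal.ofReal (jac a ζ ^ 2)) *
        (ω ζ ^ 2 * wt p a ζ)) ^ (1/2:ℝ)) ^ 2 := by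
        congr 1
        refine setLIntegral_congr_fun measurableSet_ball fun ζ hζ => ?_
        rw [mem_ball_zero_iff] at hζ
        have hQ := Qa_pos ha hζ
        have hj := jac_pos ha hζ
        have e2 : ENNReal.ofReal (Qa a ζ ^ (-p)) * wt p a ζ = 1 := by
          rw [wt, ← ENNReal.ofReal_mul (Real.rpow_nonneg hQ.le _), ← Real.rpow_add hQ]; simp
        rw [show ENNReal.ofReal (Qa a ζ ^ (-p)) * ENNReal.ofReal (jac a ζ ^ 2) * (ω ζ ^ 2 * wt p a ζ) =
          (ENNReal.ofReal (Qa a ζ ^ (-p)) * wt p a ζ) * (ENNReal.ofReal (jac a ζ ^ 2) * ω ζ ^ 2) by ring,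
          e2, one_mul, ENNReal.ofReal_pow hj.le, ← mul_pow, ← ENNReal.rpow_two, ← ENNReal.rpow_mul]
        norm_num [mul_comm]
    _ ≤ _ := cs_sqrt (by fun_prop) (by fun_prop)
    _ ≤ _ := by gcongr

end

section

/-- the real-linear map `h ↦ α h + β conj h` -/
def cdm (α β : ℂ) : ℂ →L[ℝ] ℂ :=
  α • (ContinuousLinearMap.id ℝ ℂ) + β • (Complex.conjCLE : ℂ →L[ℝ] ℂ)

@[simp] lemma cdm_apply (α β h : ℂ) : cdm α β h = α * h + β * conj h := by
  simp [cdm]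

/-- Wirtinger derivatives at a point -/
def HasWD (f : ℂ → ℂ) (α β : ℂ) (z : ℂ) : Prop := HasFDerivAt f (cdm α β) z

lemma HasWD.congr_wd {f : ℂ → ℂ} {α β α' β' z : ℂ} (h : HasWD f α β z) (h1 : α = α') (h2 : β = β') :
    HasWD f α' β' z := by subst h1 h2; exact h

lemma cdm_eq (L : ℂ →L[ℝ] ℂ) : L = cdm ((L 1 - I * L I) / 2) ((L 1 + I * L I) / 2) := by
  ext h
  have hh : h = (h.re : ℝ) • (1 : ℂ) + (h.im : ℝ) • I := by simp
  rw [cdm_apply, hh, map_add, map_smul, map_smul]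
  simp only [real_smul, map_add, map_mul, conj_ofReal, conj_I, map_one]
  linear_combination ((h.im : ℂ) * L I) * I_sq

lemma hasWD_of_hasFDerivAt {f : ℂ → ℂ} {L : ℂ →L[ℝ] ℂ} {z : ℂ} (h : HasFDerivAt f L z) :
    HasWD f ((L 1 - I * L I) / 2) ((L 1 + I * L I) / 2) z := by
  unfold HasWD; rw [← cdm_eq]; exact h

lemma HasWD.wderiv {f : ℂ → ℂ} {α β z : ℂ} (h : HasWD f α β z) : wderiv f z = α := by
  unfold _root_.wderiv; rw [HasFDerivAt.fderiv h]; simp only [cdm_apply, map_one, conj_I]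
  linear_combination (-(α - β) / 2) * I_sq

lemma HasWD.wderivBar {f : ℂ → ℂ} {α β z : ℂ} (h : HasWD f α β z) : wderivBar f z = β := by
  unfold _root_.wderivBar; rw [HasFDerivAt.fderiv h]; simp only [cdm_apply, map_one, conj_I]
  linear_combination ((α - β) / 2) * I_sq

lemma HasWD.add {f g : ℂ → ℂ} {α β α' β' z : ℂ} (hf : HasWD f α β z) (hg : HasWD g α' β' z) :
    HasWD (fun z => f z + g z) (α + α') (β + β') z := by
  refine (HasFDerivAt.add hf hg).congr_fderiv ?_
  ext h; simp; ring

lemma HasWD.sub {f g : ℂ → ℂ} {α β α' β' z : ℂ} (hf : HasWD f α β z) (hg : HasWD g α' β' z) :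
    HasWD (fun z => f z - g z) (α - α') (β - β') z := by
  refine (HasFDerivAt.sub hf hg).congr_fderiv ?_
  ext h; simp; ring

lemma HasWD.mul {f g : ℂ → ℂ} {α β α' β' z : ℂ} (hf : HasWD f α β z) (hg : HasWD g α' β' z) :
    HasWD (fun z => f z * g z) (f z * α' + α * g z) (f z * β' + β * g z) z := by
  refine (HasFDerivAt.mul hf hg).congr_fderiv ?_
  ext h; simp; ring

lemma HasWD.sum {ι : Type*} (s : Finset ι) {f : ι → ℂ → ℂ} {α β : ι → ℂ} {z : ℂ}
    (hf : ∀ i ∈ s, HasWD (f i) (α i) (β i) z) :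
    HasWD (fun z => ∑ i ∈ s, f i z) (∑ i ∈ s, α i) (∑ i ∈ s, β i) z := by
  refine (HasFDerivAt.fun_sum hf).congr_fderiv ?_
  ext h; simp [Finset.sum_mul, Finset.sum_add_distrib]

lemma _root_.HasDerivAt.hasWD {f : ℂ → ℂ} {f' z : ℂ} (h : HasDerivAt f f' z) : HasWD f f' 0 z := by
  refine (h.hasFDerivAt.restrictScalars ℝ).congr_fderiv ?_
  ext h; simp [mul_comm]

lemma hasWD_const (c z : ℂ) : HasWD (fun _ => c) 0 0 z := (hasDerivAt_const z c).hasWD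

lemma HasWD.comp_hasDerivAt {φ f : ℂ → ℂ} {α β φ' z : ℂ} (hφ : HasDerivAt φ φ' (f z))
    (hf : HasWD f α β z) : HasWD (fun z => φ (f z)) (φ' * α) (φ' * β) z := by
  refine ((hφ.hasFDerivAt.restrictScalars ℝ).comp z hf).congr_fderiv ?_
  ext h; simp; ring

lemma HasWD.conj {f : ℂ → ℂ} {α β z : ℂ} (hf : HasWD f α β z) :
    HasWD (fun z => conj (f z)) (conj β) (conj α) z := by
  refine ((Complex.conjCLE : ℂ →L[ℝ] ℂ).hasFDerivAt.comp z hf).congr_fderiv ?_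
  ext h; simp; ring

lemma HasWD.hasDerivAt {f : ℂ → ℂ} {α z : ℂ} (hf : HasWD f α 0 z) : HasDerivAt f α z := by
  rw [hasDerivAt_iff_hasFDerivAt]
  refine hasFDerivAt_of_restrictScalars ℝ hf ?_
  ext h; simp [mul_comm]

lemma HasWD.congr_ev {f g : ℂ → ℂ} {α β z : ℂ} (hf : HasWD f α β z) (h : g =ᶠ[nhds z] f) :
    HasWD g α β z := HasFDerivAt.congr_of_eventuallyEq hf h

lemma HasWD.hasFDerivAt {f : ℂ → ℂ} {α β z : ℂ} (hf : HasWD f α β z) :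
    HasFDerivAt f (cdm α β) z := hf

lemma measurable_wderiv (f : ℂ → ℂ) : Measurable (wderiv f) := by
  unfold wderiv
  have h1 := measurable_fderiv_apply_const ℝ f 1
  have h2 := measurable_fderiv_apply_const ℝ f I
  fun_prop

lemma norm_polar {r : ℝ} (hr : 0 ≤ r) (θ : ℝ) : ‖(r * exp (θ * I) : ℂ)‖ = r := by
  rw [norm_mul, Complex.norm_exp_ofReal_mul_I]; simp [abs_of_nonneg hr]

lemma polar_eq (q : ℝ × ℝ) : Complex.polarCoord.symm q = q.1 * exp (q.2 * I) := by
  rw [Complex.polarCoord_symm_apply, Complex.exp_mul_I]; simp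

lemma integral_disk_polar (h : ℂ → ℂ) (hi : IntegrableOn h (ball 0 1)) :
    IntegrableOn (fun q : ℝ × ℝ => (q.1 : ℂ) * h (q.1 * exp (q.2 * I))) (Icc 0 1 ×ˢ Icc (-π) π) ∧
    ∫ ζ in ball (0:ℂ) 1, h ζ =
      ∫ q in Icc (0:ℝ) 1 ×ˢ Icc (-π) π, (q.1 : ℂ) * h (q.1 * exp (q.2 * I)) := by
  have hset : ((Icc (0:ℝ) 1 ×ˢ Icc (-π) π : Set (ℝ × ℝ))) =ᵐ[volume]
      (Ioo (0:ℝ) 1 ×ˢ Ioo (-π) π : Set (ℝ × ℝ)) := by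
    rw [Measure.volume_eq_prod]
    exact (Measure.set_prod_ae_eq Ioo_ae_eq_Icc Ioo_ae_eq_Icc).symm
  have key : ∀ q ∈ polarCoord.target, q.1 • (ball (0:ℂ) 1).indicator h (Complex.polarCoord.symm q)
      = (Ioo (0:ℝ) 1 ×ˢ Ioo (-π) π).indicator
        (fun q : ℝ × ℝ => (q.1 : ℂ) * h (q.1 * exp (q.2 * I))) q := by
    rintro ⟨r, θ⟩ hq
    rw [polarCoord_target] at hq
    obtain ⟨h0, h1⟩ := hq
    simp only [mem_Ioi] at h0
    simp only [polar_eq, indicator, mem_ball_zero_iff, norm_polar h0.le, mem_prod, mem_Ioo, h0, true_and]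
    simp only [mem_Ioo] at h1
    by_cases hr : r < 1 <;> simp [hr, h1]
  have hsub : Ioo (0:ℝ) 1 ×ˢ Ioo (-π) π ⊆ polarCoord.target := by
    rw [polarCoord_target]
    exact prod_mono (fun x hx => hx.1) le_rfl
  have hms : MeasurableSet (Ioo (0:ℝ) 1 ×ˢ Ioo (-π) π) := measurableSet_Ioo.prod measurableSet_Ioo
  constructor
  · rw [integrableOn_congr_set_ae hset]
    have hI : Integrable ((ball (0:ℂ) 1).indicator h) := hi.integrable_indicator measurableSet_ball
    have : IntegrableOn (fun q : ℝ × ℝ => q.1 • (ball (0:ℂ) 1).indicator h (Complex.polarCoord.symm q))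
        polarCoord.target := by
      have h1 : Integrable (fun x => (ball (0:ℂ) 1).indicator h (measurableEquivRealProd.symm x)) :=
        ((Complex.volume_preserving_equiv_real_prod.symm).integrable_comp_emb
          measurableEquivRealProd.symm.measurableEmbedding).2 hI
      have h2 := (integrableOn_image_iff_integrableOn_abs_det_fderiv_smul volume
        polarCoord.open_target.measurableSet
        (fun p _ => (hasFDerivAt_polarCoord_symm p).hasFDerivWithinAt) polarCoord.symm.injOn
        (fun x => (ball (0:ℂ) 1).indicator h (measurableEquivRealProd.symm x))).1 h1.integrableOn
      refine (integrableOn_congr_fun (fun q hq => ?_) polarCoord.open_target.measurableSet).1 h2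
      rw [det_fderivPolarCoordSymm, abs_of_pos hq.1, measurableEquivRealProd_symm_polarCoord_symm_apply]
    have h2 := (integrableOn_congr_fun key polarCoord.open_target.measurableSet).1 this
    have h3 := h2.mono_set hsub
    exact (integrableOn_congr_fun (fun q hq => by rw [indicator_of_mem hq]) hms).1 h3
  · rw [← integral_indicator measurableSet_ball, ← Complex.integral_comp_polarCoord_symm,
      setIntegral_congr_fun polarCoord.open_target.measurableSet key, setIntegral_congr_set hset,
      setIntegral_indicator hms, inter_eq_right.2 hsub]

lemma green {V α β : ℂ → ℂ} (hV : ContinuousOn V (closedBall 0 1))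
    (hd : ∀ z ∈ ball (0:ℂ) 1, HasWD V (α z) (β z) z) (hi : IntegrableOn α (ball 0 1)) :
    ∫ θ in (-π)..π, V (exp (θ * I)) * exp (-(θ * I)) = 2 * ∫ z in ball (0:ℂ) 1, α z := by
  set P : ℝ × ℝ → ℂ := fun q => q.1 * exp (q.2 * I) with hP
  set f : ℝ × ℝ → ℂ := fun q => q.1 * (V (P q) * exp (-(q.2 * I))) with hf
  set g : ℝ × ℝ → ℂ := fun q => -I * (V (P q) * exp (-(q.2 * I))) with hg
  have hπ : -π ≤ π := by linarith [Real.pi_pos]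
  have hPc : Continuous P := by unfold P; fun_prop
  have hPm : MapsTo P (uIcc (0:ℝ) 1 ×ˢ uIcc (-π) π) (closedBall 0 1) := by
    rintro ⟨r, θ⟩ ⟨h1, -⟩
    rw [uIcc_of_le zero_le_one] at h1
    rw [mem_closedBall_zero_iff]
    simp only [hP]
    rw [norm_polar h1.1]; exact h1.2
  have hVP : ContinuousOn (fun q => V (P q)) (uIcc (0:ℝ) 1 ×ˢ uIcc (-π) π) :=
    hV.comp hPc.continuousOn hPm
  have hPin : ∀ q ∈ Ioo (0:ℝ) 1 ×ˢ Ioo (-π) π, P q ∈ ball (0:ℂ) 1 := by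
    rintro ⟨r, θ⟩ ⟨h1, -⟩
    rw [mem_ball_zero_iff]
    simp only [hP]
    rw [norm_polar h1.1.le]; exact h1.2
  have hPd : ∀ q : ℝ × ℝ, DifferentiableAt ℝ P q := by
    intro q
    have h1 : DifferentiableAt ℝ (fun q : ℝ × ℝ => (q.1 : ℂ)) q :=
      Complex.ofRealCLM.differentiableAt.comp q differentiableAt_fst
    have h2 : DifferentiableAt ℝ (fun q : ℝ × ℝ => (q.2 : ℂ)) q :=
      Complex.ofRealCLM.differentiableAt.comp q differentiableAt_snd
    unfold P
    fun_prop
  have hVd : ∀ q ∈ Ioo (0:ℝ) 1 ×ˢ Ioo (-π) π,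
      DifferentiableAt ℝ (fun q : ℝ × ℝ => V (P q) * exp (-(q.2 * I))) q := by
    intro q hq
    have h0 : DifferentiableAt ℝ (fun q => V (P q)) q :=
      (hd _ (hPin q hq)).hasFDerivAt.differentiableAt.comp q (hPd q)
    have h2 : DifferentiableAt ℝ (fun q : ℝ × ℝ => (q.2 : ℂ)) q :=
      Complex.ofRealCLM.differentiableAt.comp q differentiableAt_snd
    exact h0.mul ((h2.mul_const I).neg.cexp)
  have hfd : ∀ q ∈ Ioo (0:ℝ) 1 ×ˢ Ioo (-π) π, DifferentiableAt ℝ f q := by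
    intro q hq
    have h1 : DifferentiableAt ℝ (fun q : ℝ × ℝ => (q.1 : ℂ)) q :=
      Complex.ofRealCLM.differentiableAt.comp q differentiableAt_fst
    exact h1.mul (hVd q hq)
  have hgd : ∀ q ∈ Ioo (0:ℝ) 1 ×ˢ Ioo (-π) π, DifferentiableAt ℝ g q := by
    intro q hq
    exact (hVd q hq).const_mul (-I)
  have hdiv : ∀ q ∈ Ioo (0:ℝ) 1 ×ˢ Ioo (-π) π,
      fderiv ℝ f q (1, 0) + fderiv ℝ g q (0, 1) = 2 * (q.1 * α (q.1 * exp (q.2 * I))) := by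
    rintro ⟨r, θ⟩ hq
    have hz := hd _ (hPin _ hq)
    simp only [hP] at hz
    have e1 : HasDerivAt (fun t : ℝ => f (t, θ)) (fderiv ℝ f (r, θ) (1, 0)) r :=
      HasFDerivAt.comp_hasDerivAt (f := fun t : ℝ => (t, θ)) r (hfd _ hq).hasFDerivAt ((hasDerivAt_id r).prodMk (hasDerivAt_const r θ))
    have e2 : HasDerivAt (fun t : ℝ => g (r, t)) (fderiv ℝ g (r, θ) (0, 1)) θ :=
      HasFDerivAt.comp_hasDerivAt (f := fun t : ℝ => (r, t)) θ (hgd _ hq).hasFDerivAt ((hasDerivAt_const θ r).prodMk (hasDerivAt_id θ))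
    have p1 : HasDerivAt (fun t : ℝ => (t * exp (θ * I) : ℂ)) (exp (θ * I)) r := by
      simpa using (Complex.ofRealCLM.hasDerivAt (x := r)).mul_const (exp (θ * I))
    have p2' : HasDerivAt (fun t : ℝ => exp (t * I)) (exp (θ * I) * I) θ := by
      simpa using ((Complex.ofRealCLM.hasDerivAt (x := θ)).mul_const I).cexp
    have p3 : HasDerivAt (fun t : ℝ => exp (-(t * I))) (exp (-(θ * I)) * -I) θ := by
      simpa using (((Complex.ofRealCLM.hasDerivAt (x := θ)).mul_const I).neg).cexp
    have p2 : HasDerivAt (fun t : ℝ => (r * exp (t * I) : ℂ)) (r * (exp (θ * I) * I)) θ :=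
      p2'.const_mul _
    have p0 : HasDerivAt (fun t : ℝ => (t : ℂ)) 1 r := by
      exact Complex.ofRealCLM.hasDerivAt (x := r)
    have v1 := hz.hasFDerivAt.comp_hasDerivAt r p1
    have v2 := hz.hasFDerivAt.comp_hasDerivAt θ p2
    have f1 := p0.mul (v1.mul_const (exp (-(θ * I))))
    have g1 := (v2.mul p3).const_mul (-I)
    rw [e1.unique f1, e2.unique g1]
    simp only [Function.comp, cdm_apply, map_mul, conj_I, conj_ofReal]
    rw [← Complex.exp_conj]
    simp only [map_mul, conj_I, conj_ofReal, mul_neg]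
    have ee : exp (θ * I) * exp (-(θ * I)) = 1 := by rw [← Complex.exp_add]; simp
    generalize α (r * exp (θ * I)) = A
    generalize β (r * exp (θ * I)) = B
    generalize V (r * exp (θ * I)) = W
    generalize exp (-(θ * I)) = E at *
    generalize exp (θ * I) = E' at *
    linear_combination (A * r - A * r * I ^ 2) * ee + (- A * r + W * E +  B * r * E ^ 2) * I_sq
  have hset : ((uIcc (0:ℝ) 1 ×ˢ uIcc (-π) π : Set (ℝ × ℝ))) =ᵐ[volume]
      (Ioo (0:ℝ) 1 ×ˢ Ioo (-π) π : Set (ℝ × ℝ)) := by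
    rw [Measure.volume_eq_prod, uIcc_of_le zero_le_one, uIcc_of_le hπ]
    exact (Measure.set_prod_ae_eq Ioo_ae_eq_Icc Ioo_ae_eq_Icc).symm
  have hms : MeasurableSet (Ioo (0:ℝ) 1 ×ˢ Ioo (-π) π) := measurableSet_Ioo.prod measurableSet_Ioo
  obtain ⟨i1, i2⟩ := integral_disk_polar α hi
  have hset' := hset
  rw [uIcc_of_le zero_le_one, uIcc_of_le hπ] at hset'
  have Hi : IntegrableOn (fun x => fderiv ℝ f x (1, 0) + fderiv ℝ g x (0, 1))
      (uIcc (0:ℝ) 1 ×ˢ uIcc (-π) π) := by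
    rw [integrableOn_congr_set_ae hset, integrableOn_congr_fun hdiv hms]
    rw [integrableOn_congr_set_ae hset'] at i1
    exact i1.const_mul 2
  have D := integral2_divergence_prod_of_hasFDerivAt f g (fderiv ℝ f) (fderiv ℝ g) 0 (-π) 1 π
    (by
      refine ContinuousOn.mul (by fun_prop) (hVP.mul (by fun_prop)))
    (by
      refine ContinuousOn.mul (by fun_prop) (hVP.mul (by fun_prop)))
    (by
      simp only [min_eq_left hπ, max_eq_right hπ, min_eq_left (zero_le_one' ℝ), max_eq_right (zero_le_one' ℝ)]
      exact fun q hq => (hfd q hq).hasFDerivAt)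
    (by
      simp only [min_eq_left hπ, max_eq_right hπ, min_eq_left (zero_le_one' ℝ), max_eq_right (zero_le_one' ℝ)]
      exact fun q hq => (hgd q hq).hasFDerivAt) Hi
  have L : (∫ x in (0:ℝ)..1, ∫ y in (-π)..π, fderiv ℝ f (x, y) (1, 0) + fderiv ℝ g (x, y) (0, 1)) =
      2 * ∫ z in ball (0:ℂ) 1, α z := by
    rw [i2, setIntegral_congr_set hset', ← integral_const_mul, ← setIntegral_congr_fun hms hdiv]
    rw [← setIntegral_congr_set hset]
    rw [uIcc_of_le zero_le_one, uIcc_of_le hπ] at Hi ⊢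
    rw [Measure.volume_eq_prod] at Hi ⊢
    rw [setIntegral_prod _ Hi]
    simp only [intervalIntegral.integral_of_le zero_le_one, intervalIntegral.integral_of_le hπ,
      integral_Icc_eq_integral_Ioc]
  rw [L] at D
  rw [D]
  have eπ : exp (π * I) = exp (-(π * I)) := by
    rw [Complex.exp_neg, Complex.exp_pi_mul_I]; norm_num
  have g0 : ∀ x : ℝ, g (x, π) = g (x, -π) := by
    intro x
    simp only [hg, hP, ofReal_neg, neg_mul, neg_neg, eπ]
  simp only [g0, sub_self, zero_add]
  simp [hf, hP]

lemma cauchy_deriv {F : ℂ → ℂ} (hF : DifferentiableOn ℂ F (ball 0 1))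
    (hFc : ContinuousOn F (closedBall 0 1)) {z : ℂ} (hz : z ∈ ball (0:ℂ) 1) :
    ∮ ζ in C(0, 1), ((ζ - z) ^ 2)⁻¹ * F ζ = 2 * π * I * deriv F z := by
  have hnb : ball (0:ℂ) 1 ∈ nhds z := isOpen_ball.mem_nhds hz
  have hnb' : closedBall (0:ℂ) 1 ∈ nhds z := mem_of_superset hnb ball_subset_closedBall
  have hFz : DifferentiableAt ℂ F z := hF.differentiableAt hnb
  have hdc : DiffContOnCl ℂ (dslope F z) (ball 0 1) := by
    refine ⟨(Complex.differentiableOn_dslope hnb).2 hF, ?_⟩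
    rw [closure_ball _ one_ne_zero]
    exact (continuousOn_dslope hnb').2 ⟨hFc, hFz⟩
  have h1 := hdc.circleIntegral_sub_inv_smul hz
  rw [dslope_same] at h1
  simp only [smul_eq_mul] at h1
  rw [← h1]
  have hne : ∀ ζ ∈ sphere (0:ℂ) 1, ζ - z ≠ 0 := by
    intro ζ hζ h
    rw [sub_eq_zero.1 h] at hζ
    simp only [mem_sphere_zero_iff_norm, mem_ball_zero_iff] at hζ hz
    linarith
  have h2 : ∮ ζ in C(0, 1), F z * (ζ - z) ^ (-2 : ℤ) = 0 := by
    rw [circleIntegral.integral_const_mul, circleIntegral.integral_sub_zpow_of_ne (by norm_num), mul_zero]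
  have h3 : ∮ ζ in C(0, 1), ((ζ - z) ^ 2)⁻¹ * F ζ =
      ∮ ζ in C(0, 1), ((ζ - z)⁻¹ * dslope F z ζ + F z * (ζ - z) ^ (-2 : ℤ)) := by
    refine circleIntegral.integral_congr zero_le_one fun ζ hζ => ?_
    have := hne ζ hζ
    rw [dslope_of_ne _ (sub_ne_zero.1 this), slope_def_field,
      show (ζ - z) ^ (-2 : ℤ) = ((ζ - z) ^ 2)⁻¹ from rfl]
    field_simp
    ring
  rw [h3, circleIntegral.integral_add, h2, add_zero]
  · refine ContinuousOn.circleIntegrable zero_le_one ?_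
    refine ContinuousOn.mul (ContinuousOn.inv₀ (by fun_prop) hne) ?_
    exact ((continuousOn_dslope hnb').2 ⟨hFc, hFz⟩).mono sphere_subset_closedBall
  · refine ContinuousOn.circleIntegrable zero_le_one ?_
    refine ContinuousOn.mul (by fun_prop) (ContinuousOn.zpow₀ (by fun_prop) _ fun a ha => Or.inl (hne a ha))

theorem deriv_bound {F U α β : ℂ → ℂ} (hF : DifferentiableOn ℂ F (ball 0 1))
    (hFc : ContinuousOn F (closedBall 0 1)) (hU : ContinuousOn U (closedBall 0 1))
    (hd : ∀ z ∈ ball (0:ℂ) 1, HasWD U (α z) (β z) z) (hi : IntegrableOn α (ball 0 1))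
    (hb : ∀ z ∈ sphere (0:ℂ) 1, F z = U z) {z : ℂ} (hz : z ∈ ball (0:ℂ) 1) :
    ‖deriv F z‖ₑ ≤ ENNReal.ofReal (1 / π) * TT (fun ζ => ‖α ζ‖ₑ) z := by
  have hz' : ‖z‖ < 1 := by simpa using hz
  have hden : ∀ ζ : ℂ, ‖ζ‖ ≤ 1 → 1 - z * conj ζ ≠ 0 := by
    intro ζ hζ h
    have := one_sub_le_den' (z := z) (ζ := ζ) hζ
    rw [mul_comm, h, norm_zero] at this
    linarith
  set k : ℂ → ℂ := fun ζ => ((1 - z * conj ζ) ^ 2)⁻¹ with hk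
  have hkc : ContinuousOn k (closedBall 0 1) := by
    refine ContinuousOn.inv₀ (by fun_prop) fun ζ hζ => pow_ne_zero _ (hden ζ (by simpa using hζ))
  have hkd : ∀ ζ ∈ ball (0:ℂ) 1, ∃ β', HasWD k 0 β' ζ := by
    intro ζ hζ
    have h1 : HasWD (fun ζ => 1 - z * conj ζ) 0 (-z) ζ := by
      refine ((hasWD_const 1 ζ).sub ((hasWD_const z ζ).mul (hasDerivAt_id ζ).hasWD.conj)).congr_wd ?_ ?_
      · simp
      · simp
    have h2 : DifferentiableAt ℂ (fun x : ℂ => (x ^ 2)⁻¹) (1 - z * conj ζ) := by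
      refine DifferentiableAt.inv (by fun_prop) (pow_ne_zero _ (hden ζ ?_))
      exact (by simpa using hζ : ‖ζ‖ < 1).le
    exact ⟨_, (HasWD.comp_hasDerivAt (φ := fun x : ℂ => (x ^ 2)⁻¹) (f := fun ζ => 1 - z * conj ζ) h2.hasDerivAt h1).congr_wd (mul_zero _) rfl⟩
  choose! βk hβk using hkd
  have hG := green (V := fun ζ => U ζ * k ζ) (α := fun ζ => α ζ * k ζ)
    (β := fun ζ => U ζ * βk ζ + β ζ * k ζ) (hU.mul hkc)
    (fun ζ hζ => ((hd ζ hζ).mul (hβk ζ hζ)).congr_wd (by simp) rfl) (by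
      have hkb : ∀ ζ ∈ ball (0:ℂ) 1, ‖k ζ‖ ≤ ((1 - ‖z‖) ^ 2)⁻¹ := by
        intro ζ hζ
        rw [hk]; simp only [norm_inv, norm_pow]
        have hζ' : ‖ζ‖ < 1 := by simpa using hζ
        have := one_sub_le_den' (z := z) hζ'.le
        rw [mul_comm] at this
        have : 0 < 1 - ‖z‖ := by linarith
        gcongr
      refine Integrable.mul_bdd (c := ((1 - ‖z‖) ^ 2)⁻¹) hi ?_ ?_
      · exact (hkc.mono ball_subset_closedBall).aestronglyMeasurable measurableSet_ball
      · exact (ae_restrict_iff' measurableSet_ball).2 (Eventually.of_forall hkb))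
  have hcirc : ∫ θ in (-π)..π, U (exp (θ * I)) * k (exp (θ * I)) * exp (-(θ * I)) =
      2 * π * deriv F z := by
    have hc := cauchy_deriv hF hFc hz
    rw [circleIntegral] at hc
    have hper : Function.Periodic
        (fun θ : ℝ => U (exp (θ * I)) * k (exp (θ * I)) * exp (-(θ * I))) (2 * π) := by
      intro θ
      have : exp ((θ + 2 * π : ℝ) * I) = exp (θ * I) := by
        push_cast; rw [add_mul, Complex.exp_add, Complex.exp_two_pi_mul_I, mul_one]
      beta_reduce
      rw [Complex.exp_neg, this, ← Complex.exp_neg]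
    have h2 := hper.intervalIntegral_add_eq (-π) 0
    rw [show -π + 2 * π = π by ring, zero_add] at h2
    rw [h2]
    have h3 : ∀ θ : ℝ, deriv (circleMap 0 1) θ • (((circleMap 0 1 θ - z) ^ 2)⁻¹ * F (circleMap 0 1 θ)) =
        I * (U (exp (θ * I)) * k (exp (θ * I)) * exp (-(θ * I))) := by
      intro θ
      have hs : exp (θ * I) ∈ sphere (0:ℂ) 1 := by simp [Complex.norm_exp_ofReal_mul_I]
      have hs1 : ‖exp (θ * I)‖ ≤ 1 := by simp [Complex.norm_exp_ofReal_mul_I]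
      have ee : exp (θ * I) * exp (-(θ * I)) = 1 := by rw [← Complex.exp_add]; simp
      have hne := hden _ hs1
      rw [deriv_circleMap, circleMap, hk]
      simp only [ofReal_one, one_mul, zero_add, smul_eq_mul]
      rw [hb _ hs, ← Complex.exp_conj]
      rw [← Complex.exp_conj] at hne
      simp only [map_mul, conj_I, conj_ofReal, mul_neg] at hne ⊢
      have e2 : exp (θ * I) - z = exp (θ * I) * (1 - z * exp (-(θ * I))) := by
        linear_combination z * ee
      rw [e2]
      have e3 : exp (-(θ * I)) = (exp (θ * I))⁻¹ := Complex.exp_neg _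
      rw [e3] at hne ⊢
      have := Complex.exp_ne_zero (θ * I)
      field_simp
    simp only [h3] at hc
    rw [intervalIntegral.integral_const_mul] at hc
    have := mul_left_cancel₀ I_ne_zero (hc.trans (by ring : _ = I * (2 * π * deriv F z)))
    exact this
  rw [hcirc] at hG
  have hπ : (π : ℂ) ≠ 0 := by exact_mod_cast Real.pi_ne_zero
  have hfin : deriv F z = ((1 / π : ℝ) : ℂ) * ∫ ζ in ball (0:ℂ) 1, α ζ * k ζ := by
    push_cast
    field_simp
    linear_combination hG / 2
  rw [hfin, enorm_mul]
  have e1 : ‖((1 / π : ℝ) : ℂ)‖ₑ = ENNReal.ofReal (1 / π) := by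
    rw [← ofReal_norm, Complex.norm_real, Real.norm_of_nonneg (by positivity)]
  rw [e1]
  gcongr
  refine (enorm_integral_le_lintegral_enorm _).trans (le_of_eq ?_)
  unfold TT
  congr 1
  ext ζ
  rw [enorm_mul, mul_comm]
  congr 1
  rw [← ofReal_norm, Kk, hk]
  simp only [norm_inv, norm_pow, one_div]
  rw [mul_comm]

end

section

lemma lintegral_inv_norm {δ : ℝ} (hδ : 0 ≤ δ) (z : ℂ) :
    ∫⁻ ζ in ball z δ, ENNReal.ofReal (1 / ‖z - ζ‖) ≤ ENNReal.ofReal (2 * π * δ) := by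
  have h0 : ∫⁻ ζ in ball z δ, ENNReal.ofReal (1 / ‖z - ζ‖) =
      ∫⁻ u, (ball (0:ℂ) δ).indicator (fun u => ENNReal.ofReal (1 / ‖u‖)) u := by
    rw [← lintegral_indicator measurableSet_ball,
      ← lintegral_sub_left_eq_self (fun u => (ball (0:ℂ) δ).indicator (fun u => ENNReal.ofReal (1 / ‖u‖)) u) z]
    congr 1; ext ζ
    by_cases h : ζ ∈ ball z δ
    · rw [indicator_of_mem h, indicator_of_mem]
      rw [mem_ball_zero_iff, norm_sub_rev]; simpa [dist_eq_norm] using h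
    · rw [indicator_of_notMem h, indicator_of_notMem]
      rw [mem_ball_zero_iff, norm_sub_rev]; simpa [dist_eq_norm] using h
  rw [h0, ← Complex.lintegral_comp_polarCoord_symm]
  calc _ ≤ ∫⁻ q in polarCoord.target, (Ioo (0:ℝ) δ ×ˢ Ioo (-π) π).indicator 1 q := by
        refine setLIntegral_mono' polarCoord.open_target.measurableSet fun q hq => ?_
        rw [polarCoord_target] at hq
        have hq1 : 0 < q.1 := hq.1
        rw [polar_eq, smul_eq_mul]
        by_cases h : q.1 < δ
        · rw [indicator_of_mem (by rw [mem_ball_zero_iff, norm_polar hq1.le]; exact h),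
            indicator_of_mem (show q ∈ Ioo (0:ℝ) δ ×ˢ Ioo (-π) π from ⟨⟨hq1, h⟩, hq.2⟩), norm_polar hq1.le,
            ← ENNReal.ofReal_mul hq1.le, mul_one_div_cancel hq1.ne']
          simp
        · rw [indicator_of_notMem (by rw [mem_ball_zero_iff, norm_polar hq1.le]; exact h)]
          simp
    _ ≤ ∫⁻ q, (Ioo (0:ℝ) δ ×ˢ Ioo (-π) π).indicator 1 q := setLIntegral_le_lintegral _ _
    _ = _ := by
        rw [lintegral_indicator_one (measurableSet_Ioo.prod measurableSet_Ioo), Measure.volume_eq_prod,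
          Measure.prod_prod, Real.volume_Ioo, Real.volume_Ioo, ← ENNReal.ofReal_mul (by linarith)]
        congr 1; ring

lemma integrableOn_inv_norm (δ : ℝ) (z : ℂ) :
    IntegrableOn (fun ζ => 1 / ‖z - ζ‖) (ball z δ) := by
  rcases lt_or_ge δ 0 with h | h
  · rw [ball_eq_empty.2 h.le]; simp
  refine ⟨(by fun_prop : Measurable fun ζ : ℂ => 1 / ‖z - ζ‖).aestronglyMeasurable, ?_⟩
  rw [HasFiniteIntegral]
  refine lt_of_le_of_lt (le_of_eq ?_) ((lintegral_inv_norm h z).trans_lt ENNReal.ofReal_lt_top)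
  congr 1; ext ζ
  rw [← ofReal_norm, Real.norm_of_nonneg (by positivity)]

lemma integrableOn_inv_norm_disk {z : ℂ} (hz : ‖z‖ ≤ 1) :
    IntegrableOn (fun ζ => 1 / ‖z - ζ‖) (ball 0 1) := by
  refine (integrableOn_inv_norm 2 z).mono_set fun ζ hζ => ?_
  rw [mem_ball_zero_iff] at hζ
  rw [mem_ball, dist_eq_norm]
  linarith [norm_sub_le ζ z]

lemma integral_inv_norm {δ : ℝ} (hδ : 0 ≤ δ) (z : ℂ) :
    ∫ ζ in ball z δ, 1 / ‖z - ζ‖ ≤ 2 * π * δ := by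
  rw [integral_eq_lintegral_of_nonneg_ae (Eventually.of_forall fun ζ => by positivity)
    (by fun_prop : Measurable fun ζ : ℂ => 1 / ‖z - ζ‖).aestronglyMeasurable]
  exact ENNReal.toReal_le_of_le_ofReal (by positivity) (lintegral_inv_norm hδ z)

theorem ws_continuousOn {N : ℂ → ℂ → ℂ} {C : ℝ} (hC : 0 ≤ C)
    (hm : ∀ z ∈ closedBall (0:ℂ) 1, AEStronglyMeasurable (N z) (volume.restrict (ball 0 1)))
    (hb : ∀ z ∈ closedBall (0:ℂ) 1, ∀ ζ ∈ ball (0:ℂ) 1, z ≠ ζ → ‖N z ζ‖ ≤ C / ‖z - ζ‖)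
    (hc : ∀ z ∈ closedBall (0:ℂ) 1, ∀ ζ ∈ ball (0:ℂ) 1, z ≠ ζ →
      ContinuousWithinAt (fun z => N z ζ) (closedBall 0 1) z) :
    ContinuousOn (fun z => ∫ ζ in ball (0:ℂ) 1, N z ζ) (closedBall 0 1) := by
  have hne : ∀ z : ℂ, ∀ᵐ ζ ∂(volume.restrict (ball (0:ℂ) 1)), ζ ∈ ball (0:ℂ) 1 ∧ z ≠ ζ := by
    intro z
    have h1 : ∀ᵐ ζ ∂(volume.restrict (ball (0:ℂ) 1)), ζ ≠ z := by
      exact ae_restrict_of_ae (Measure.ae_ne volume z)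
    filter_upwards [h1, ae_restrict_mem measurableSet_ball] with ζ h2 h3
    exact ⟨h3, h2.symm⟩
  have hintg : ∀ z ∈ closedBall (0:ℂ) 1, IntegrableOn (N z) (ball 0 1) := by
    intro z hz
    refine ((integrableOn_inv_norm_disk (z := z) (by simpa using hz)).const_mul C).mono' (hm z hz) ?_
    filter_upwards [hne z] with ζ hζ
    have := hb z hz ζ hζ.1 hζ.2
    rwa [mul_one_div]
  refine continuousOn_of_uniform_approx_of_continuousOn fun u hu => ?_
  obtain ⟨ε, hε, hεu⟩ := Metric.mem_uniformity_dist.1 hu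
  set δ : ℝ := ε / (2 * (2 * π * C + 1)) with hδ
  have hπ := Real.pi_pos
  have hδ0 : 0 < δ := by positivity
  set χ : ℂ → ℂ → ℝ := fun z ζ => min 1 (‖z - ζ‖ / δ) with hχ
  have hχ0 : ∀ z ζ, 0 ≤ χ z ζ := fun z ζ => le_min zero_le_one (by positivity)
  have hχ1 : ∀ z ζ, χ z ζ ≤ 1 := fun z ζ => min_le_left _ _
  have hbd : ∀ z ∈ closedBall (0:ℂ) 1, ∀ᵐ ζ ∂(volume.restrict (ball (0:ℂ) 1)),
      ‖(χ z ζ : ℂ) * N z ζ‖ ≤ C / δ := by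
    intro z hz
    filter_upwards [hne z] with ζ hζ
    have h1 := hb z hz ζ hζ.1 hζ.2
    have h2 : 0 < ‖z - ζ‖ := norm_pos_iff.2 (sub_ne_zero.2 hζ.2)
    rw [norm_mul, Complex.norm_real, Real.norm_of_nonneg (hχ0 z ζ)]
    calc _ ≤ ‖z - ζ‖ / δ * (C / ‖z - ζ‖) := by
          gcongr
          exact min_le_right _ _
      _ = C / δ := by field_simp
  have hm' : ∀ z ∈ closedBall (0:ℂ) 1,
      AEStronglyMeasurable (fun ζ => (χ z ζ : ℂ) * N z ζ) (volume.restrict (ball 0 1)) := by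
    intro z hz
    refine AEStronglyMeasurable.mul ?_ (hm z hz)
    refine Continuous.aestronglyMeasurable ?_
    simp only [hχ]; fun_prop
  have hfin : IsFiniteMeasure (volume.restrict (ball (0:ℂ) 1)) := ⟨by simp⟩
  have hI : ∀ z : ℂ, Integrable ((ball z δ).indicator (fun ζ => C * (1 / ‖z - ζ‖))) := fun z =>
    IntegrableOn.integrable_indicator ((integrableOn_inv_norm δ z).const_mul C) measurableSet_ball
  refine ⟨fun z => ∫ ζ in ball (0:ℂ) 1, (χ z ζ : ℂ) * N z ζ, ?_, ?_⟩
  · intro z hz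
    refine continuousWithinAt_of_dominated (bound := fun _ => C / δ) ?_ ?_ (integrable_const _) ?_
    · filter_upwards [self_mem_nhdsWithin] with z hz using hm' z hz
    · filter_upwards [self_mem_nhdsWithin] with z hz using hbd z hz
    · filter_upwards [hne z] with ζ hζ
      refine ContinuousWithinAt.mul ?_ (hc z hz ζ hζ.1 hζ.2)
      refine Continuous.continuousWithinAt ?_
      simp only [hχ]; fun_prop
  · intro z hz
    apply hεu
    rw [dist_eq_norm, ← integral_sub (hintg z hz) (Integrable.of_bound (hm' z hz) _ (hbd z hz))]
    have hle : ‖∫ ζ in ball (0:ℂ) 1, (N z ζ - (χ z ζ : ℂ) * N z ζ)‖ ≤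
        ∫ ζ in ball (0:ℂ) 1, (ball z δ).indicator (fun ζ => C * (1 / ‖z - ζ‖)) ζ := by
      refine norm_integral_le_of_norm_le (hI z).integrableOn ?_
      filter_upwards [hne z] with ζ hζ
      have h1 := hb z hz ζ hζ.1 hζ.2
      by_cases h : ζ ∈ ball z δ
      · rw [indicator_of_mem h, show N z ζ - (χ z ζ : ℂ) * N z ζ = ((1 - χ z ζ : ℝ) : ℂ) * N z ζ by
          push_cast; ring, norm_mul, Complex.norm_real, Real.norm_of_nonneg (by linarith [hχ1 z ζ]),
          mul_one_div]
        refine le_trans ?_ h1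
        exact mul_le_of_le_one_left (norm_nonneg _) (by linarith [hχ0 z ζ])
      · rw [indicator_of_notMem h]
        have : χ z ζ = 1 := by
          rw [hχ]
          refine min_eq_left ?_
          rw [mem_ball, dist_eq_norm, norm_sub_rev, not_lt] at h
          rwa [one_le_div hδ0]
        rw [this]; simp
    refine lt_of_le_of_lt hle ?_
    calc _ ≤ ∫ ζ, (ball z δ).indicator (fun ζ => C * (1 / ‖z - ζ‖)) ζ := by
          refine setIntegral_le_integral (hI z) (Eventually.of_forall fun ζ => ?_)
          exact indicator_nonneg (fun ζ _ => by positivity) ζ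
      _ = C * ∫ ζ in ball z δ, 1 / ‖z - ζ‖ := by
          rw [integral_indicator measurableSet_ball, integral_const_mul]
      _ ≤ C * (2 * π * δ) := by gcongr; exact integral_inv_norm hδ0.le z
      _ < ε := by
          have : (2 * π * C + 1) * δ = ε / 2 := by rw [hδ]; field_simp
          nlinarith

/-- holomorphic parameter integrals with bounded integrand -/
theorem differentiableAt_integral_param {X : Type*} [MeasurableSpace X] {μ : Measure X}
    [IsFiniteMeasure μ] {m : ℂ → X → ℂ} {z0 : ℂ}
    {ε C : ℝ} (hε : 0 < ε) (hm : ∀ z ∈ ball z0 ε, AEStronglyMeasurable (m z) μ)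
    (hd : ∀ᵐ ζ ∂μ, DifferentiableOn ℂ (fun z => m z ζ) (ball z0 ε))
    (hb : ∀ᵐ ζ ∂μ, ∀ z ∈ ball z0 ε, ‖m z ζ‖ ≤ C) :
    DifferentiableAt ℂ (fun z => ∫ ζ, m z ζ ∂μ) z0 := by
  have h := hasDerivAt_integral_of_dominated_loc_of_deriv_le (μ := μ) (F := m) (x₀ := z0)
    (s := ball z0 (ε / 2)) (bound := fun _ => C / (ε / 4)) (F' := fun z ζ => deriv (fun z => m z ζ) z)
    (ball_mem_nhds _ (by positivity)) ?_ ?_ ?_ ?_ (integrable_const _) ?_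
  · exact h.2.differentiableAt
  · filter_upwards [ball_mem_nhds z0 hε] with z hz using hm z hz
  · refine Integrable.of_bound (hm z0 (mem_ball_self hε)) C ?_
    filter_upwards [hb] with ζ hζ using hζ z0 (mem_ball_self hε)
  · have ht : Tendsto (fun n : ℕ => z0 + (ε / 2 : ℝ) * (1 / ((n : ℂ) + 1))) atTop (𝓝[≠] z0) := by
      refine tendsto_nhdsWithin_iff.2 ⟨?_, ?_⟩
      · have := (tendsto_one_div_add_atTop_nhds_zero_nat (𝕜 := ℂ)).const_mul ((ε / 2 : ℝ) : ℂ)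
        simpa using this.const_add z0
      · refine Eventually.of_forall fun n => ?_
        have h1 : ((ε / 2 : ℝ) : ℂ) ≠ 0 := by exact_mod_cast (by positivity : ε / 2 ≠ 0)
        have h2 : (n : ℂ) + 1 ≠ 0 := Nat.cast_add_one_ne_zero n
        simp only [mem_compl_iff, mem_singleton_iff, add_eq_left, mul_eq_zero, not_or]
        exact ⟨h1, one_div_ne_zero h2⟩
    refine aestronglyMeasurable_of_tendsto_ae atTop
      (f := fun (n : ℕ) ζ => slope (fun z => m z ζ) z0 (z0 + (ε / 2 : ℝ) * (1 / ((n : ℂ) + 1)))) ?_ ?_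
    · intro n
      simp only [slope_def_field]
      have : z0 + (ε / 2 : ℝ) * (1 / ((n : ℂ) + 1)) ∈ ball z0 ε := by
        rw [mem_ball, dist_eq_norm, add_sub_cancel_left, norm_mul, Complex.norm_real,
          Real.norm_of_nonneg (by positivity), norm_div, norm_one]
        have h2 : ‖(n : ℂ) + 1‖ = n + 1 := by
          have : (n : ℂ) + 1 = ((n + 1 : ℝ) : ℂ) := by push_cast; rfl
          rw [this, Complex.norm_real, Real.norm_of_nonneg (by positivity)]
        rw [h2]
        have h3 : 1 / ((n : ℝ) + 1) ≤ 1 := by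
          rw [div_le_one (by positivity)]; linarith [(Nat.cast_nonneg n : (0:ℝ) ≤ n)]
        nlinarith
      have h1 := hm _ this
      have h2 := hm z0 (mem_ball_self hε)
      simp only [div_eq_mul_inv]
      exact (h1.sub h2).mul_const _
    · filter_upwards [hd] with ζ hζ
      have := (hζ.differentiableAt (ball_mem_nhds z0 hε)).hasDerivAt
      exact (hasDerivAt_iff_tendsto_slope.1 this).comp ht
  · filter_upwards [hd, hb] with ζ hζ hζ2 z hz
    have hsub : closedBall z (ε / 4) ⊆ ball z0 ε := by
      intro w hw
      rw [mem_ball] at hz ⊢; rw [mem_closedBall] at hw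
      linarith [dist_triangle w z z0]
    refine Complex.norm_deriv_le_of_forall_mem_sphere_norm_le (by positivity) ?_ ?_
    · exact (hζ.mono hsub).diffContOnCl_ball le_rfl
    · intro w hw
      exact hζ2 w (hsub (sphere_subset_closedBall hw))
  · filter_upwards [hd] with ζ hζ z hz
    refine (hζ.differentiableAt (isOpen_ball.mem_nhds ?_)).hasDerivAt
    exact ball_subset_ball (by linarith) hz

end

section

lemma pompeiu {G : ℂ → ℂ} (hG : ContDiff ℝ 1 G) (hs : HasCompactSupport G) (z : ℂ) :
    ∫ u : ℂ, u⁻¹ * (fderiv ℝ G (z - u) 1 + I * fderiv ℝ G (z - u) I) = 2 * π * G z := by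
  have hπ : -π ≤ π := by linarith [Real.pi_pos]
  have hDc : Continuous (fderiv ℝ G) := hG.continuous_fderiv one_ne_zero
  obtain ⟨R, hR0, hR⟩ := (hs.isBounded.exists_pos_norm_lt)
  set R' := R + ‖z‖ with hR'
  have hR'0 : 0 ≤ R' := by positivity
  have hout : ∀ u : ℂ, R' ≤ ‖u‖ → z - u ∉ tsupport G := by
    intro u hu hm
    have := hR _ hm
    have h2 : ‖u‖ ≤ ‖z - u‖ + ‖z‖ := by
      rw [← norm_neg u]; calc ‖-u‖ = ‖(z - u) - z‖ := by congr 1; ring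
        _ ≤ _ := norm_sub_le _ _
    linarith
  have hGo : ∀ u : ℂ, R' ≤ ‖u‖ → G (z - u) = 0 := fun u hu => image_eq_zero_of_notMem_tsupport (hout u hu)
  have hDo : ∀ u : ℂ, R' ≤ ‖u‖ → fderiv ℝ G (z - u) = 0 := fun u hu => by
    by_contra h
    exact hout u hu (support_fderiv_subset ℝ (f := G) (Function.mem_support.2 h))
  set A : ℝ → ℝ → ℂ := fun r θ => fderiv ℝ G (z - r * exp (θ * I)) (exp (θ * I)) with hA
  set B : ℝ → ℝ → ℂ := fun r θ => fderiv ℝ G (z - r * exp (θ * I)) (exp (θ * I) * I) with hB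
  have hAc : Continuous (Function.uncurry A) := by
    simp only [hA, Function.uncurry_def]
    exact (hDc.comp (by fun_prop)).clm_apply (by fun_prop)
  have hBc : Continuous (Function.uncurry B) := by
    simp only [hB, Function.uncurry_def]
    exact (hDc.comp (by fun_prop)).clm_apply (by fun_prop)
  have hAi : IntegrableOn (Function.uncurry A) (Ioc 0 R' ×ˢ Ioc (-π) π) :=
    (hAc.continuousOn.integrableOn_compact (isCompact_Icc.prod isCompact_Icc)).mono_set
      (prod_mono Ioc_subset_Icc_self Ioc_subset_Icc_self)
  have hBi : IntegrableOn (Function.uncurry B) (Ioc 0 R' ×ˢ Ioc (-π) π) :=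
    (hBc.continuousOn.integrableOn_compact (isCompact_Icc.prod isCompact_Icc)).mono_set
      (prod_mono Ioc_subset_Icc_self Ioc_subset_Icc_self)
  have e1 : ∫ u : ℂ, u⁻¹ * (fderiv ℝ G (z - u) 1 + I * fderiv ℝ G (z - u) I) =
      ∫ q in Ioc 0 R' ×ˢ Ioc (-π) π, (Function.uncurry A q + I * Function.uncurry B q) := by
    rw [← Complex.integral_comp_polarCoord_symm]
    have hset : polarCoord.target =ᵐ[volume] (Ioi (0:ℝ) ×ˢ Ioc (-π) π : Set (ℝ × ℝ)) := by
      rw [Measure.volume_eq_prod, polarCoord_target]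
      exact (Measure.set_prod_ae_eq (ae_eq_refl _) Ioo_ae_eq_Ioc)
    rw [setIntegral_congr_set hset]
    have hms : MeasurableSet (Ioi (0:ℝ) ×ˢ Ioc (-π) π : Set (ℝ × ℝ)) := measurableSet_Ioi.prod measurableSet_Ioc
    rw [setIntegral_congr_fun hms (g := fun q => Function.uncurry A q + I * Function.uncurry B q)]
    · refine (setIntegral_eq_of_subset_of_forall_sdiff_eq_zero hms
        (prod_mono Ioc_subset_Ioi_self le_rfl) ?_)
      rintro ⟨r, θ⟩ ⟨h1, h2⟩
      simp only [mem_prod, mem_Ioi, mem_Ioc, not_and] at h1 h2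
      have hr : R' ≤ r := by
        by_contra h
        exact h2 ⟨h1.1, (not_le.1 h).le⟩ h1.2.1 h1.2.2
      have := hDo (r * exp (θ * I)) (by rw [norm_polar h1.1.le]; exact hr)
      simp [hA, hB, Function.uncurry, this]
    · rintro ⟨r, θ⟩ ⟨h1, h2⟩
      simp only [mem_Ioi] at h1
      simp only [polar_eq, hA, hB, Function.uncurry]
      generalize fderiv ℝ G (z - r * exp (θ * I)) = L
      rw [cdm_eq L]
      simp only [cdm_apply, map_mul, conj_I, map_one]
      rw [← Complex.exp_conj]
      simp only [map_mul, conj_I, conj_ofReal, mul_neg, real_smul]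
      have hr : (r : ℂ) ≠ 0 := by exact_mod_cast h1.ne'
      rw [Complex.exp_neg]
      have he := Complex.exp_ne_zero (θ * I)
      generalize exp (θ * I) = e at *
      generalize L 1 = a
      generalize L I = b
      field_simp
      ring_nf
      simp only [I_sq, show I ^ 3 = -I by rw [pow_succ, I_sq]; ring]
      ring
  rw [e1, integral_add hAi (hBi.const_mul I), integral_const_mul]
  have a1 : ∫ q in Ioc 0 R' ×ˢ Ioc (-π) π, Function.uncurry A q = 2 * π * G z := by
    rw [Measure.volume_eq_prod] at hAi ⊢
    rw [setIntegral_prod _ hAi]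
    simp only [Function.uncurry_apply_pair]
    rw [integral_integral_swap (by rw [Measure.prod_restrict]; exact hAi)]
    have : ∀ θ : ℝ, ∫ r in Ioc 0 R', A r θ = G z := by
      intro θ
      rw [← intervalIntegral.integral_of_le hR'0]
      have h := intervalIntegral.integral_eq_sub_of_hasDerivAt (a := 0) (b := R')
        (f := fun r : ℝ => - G (z - r * exp (θ * I))) (f' := fun r => A r θ) ?_ ?_
      · rw [h, hGo (R' * exp (θ * I)) (by rw [norm_polar hR'0])]; simp
      · intro r _
        have p1 : HasDerivAt (fun t : ℝ => (z - t * exp (θ * I) : ℂ)) (-exp (θ * I)) r := by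
          simpa using ((Complex.ofRealCLM.hasDerivAt (x := r)).mul_const (exp (θ * I))).const_sub z
        have := ((hG.differentiable one_ne_zero (z - r * exp (θ * I))).hasFDerivAt.comp_hasDerivAt r p1).neg
        refine this.congr_deriv ?_
        simp [hA]
      · exact (hAc.comp (by fun_prop : Continuous fun r : ℝ => (r, θ))).intervalIntegrable _ _
    simp only [this]
    rw [setIntegral_const, measureReal_def, Real.volume_Ioc, ENNReal.toReal_ofReal (by linarith)]
    rw [real_smul]; push_cast; ring
  have a2 : ∫ q in Ioc 0 R' ×ˢ Ioc (-π) π, Function.uncurry B q = 0 := by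
    rw [Measure.volume_eq_prod] at hBi ⊢
    rw [setIntegral_prod _ hBi]
    simp only [Function.uncurry_apply_pair]
    refine setIntegral_eq_zero_of_forall_eq_zero fun r hr => ?_
    rw [← intervalIntegral.integral_of_le hπ]
    have hr0 : (r : ℂ) ≠ 0 := by exact_mod_cast hr.1.ne'
    have h := intervalIntegral.integral_eq_sub_of_hasDerivAt (a := -π) (b := π)
      (f := fun θ : ℝ => - G (z - r * exp (θ * I)) / r) (f' := fun θ => B r θ) ?_ ?_
    · rw [h]
      have eπ : exp (π * I) = exp (((-π : ℝ) : ℂ) * I) := by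
        push_cast; rw [neg_mul, Complex.exp_neg, Complex.exp_pi_mul_I]; norm_num
      rw [eπ, sub_self]
    · intro θ _
      have p2' : HasDerivAt (fun t : ℝ => exp (t * I)) (exp (θ * I) * I) θ := by
        simpa using ((Complex.ofRealCLM.hasDerivAt (x := θ)).mul_const I).cexp
      have p2 := (p2'.const_mul (r : ℂ)).const_sub z
      have := (((hG.differentiable one_ne_zero (z - r * exp (θ * I))).hasFDerivAt.comp_hasDerivAt θ p2).neg).div_const (r : ℂ)
      refine this.congr_deriv ?_
      have e : -(r * (exp (θ * I) * I)) = (-r : ℝ) • (exp (θ * I) * I) := by simp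
      rw [e, map_smul]
      simp only [hB, real_smul]
      push_cast
      field_simp
    · exact (hBc.comp (by fun_prop : Continuous fun θ : ℝ => (r, θ))).intervalIntegrable _ _
  rw [a1, a2]; simp

lemma locallyIntegrable_inv : LocallyIntegrable (fun u : ℂ => u⁻¹) := by
  refine locallyIntegrable_of_norm_le_rpow (C := 1) (α := 1) (by simp) (by simp) ?_ ?_
  · refine Eventually.of_forall fun x => ?_
    rw [norm_inv, Real.rpow_neg_one, one_mul]
  · exact (by fun_prop : Measurable fun u : ℂ => u⁻¹).aestronglyMeasurable

/-- Cauchy transform -/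
theorem cauchy_transform {G : ℂ → ℂ} (hG : ContDiff ℝ 1 G) (hs : HasCompactSupport G) (z : ℂ) :
    ∃ α, HasWD (fun z => ∫ ζ, G ζ / (z - ζ)) α (π * G z) z := by
  have h := hs.hasFDerivAt_convolution_right (ContinuousLinearMap.mul ℝ ℂ) (μ := volume)
    locallyIntegrable_inv hG z
  have h2 := hasWD_of_hasFDerivAt h
  have e : (fun z => ∫ ζ, G ζ / (z - ζ)) =
      convolution (fun u : ℂ => u⁻¹) G (ContinuousLinearMap.mul ℝ ℂ) volume := by
    ext z
    rw [convolution_def, ← integral_sub_left_eq_self _ volume z]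
    congr 1; ext u
    simp [div_eq_mul_inv, mul_comm]
  rw [e]
  refine ⟨_, h2.congr_wd rfl ?_⟩
  have hDc : Continuous (fderiv ℝ G) := hG.continuous_fderiv one_ne_zero
  have hDs : HasCompactSupport (fderiv ℝ G) := hs.fderiv ℝ
  rw [convolution_precompR_apply _ locallyIntegrable_inv hDs hDc,
    convolution_precompR_apply _ locallyIntegrable_inv hDs hDc]
  have i1 : ∀ w : ℂ, Integrable fun u : ℂ => u⁻¹ * fderiv ℝ G (z - u) w := by
    intro w
    have hc : HasCompactSupport (fun a => fderiv ℝ G a w) :=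
      hDs.comp_left (g := fun L : ℂ →L[ℝ] ℂ => L w) (by simp)
    have := hc.convolutionExists_right (ContinuousLinearMap.mul ℝ ℂ) (μ := volume)
      locallyIntegrable_inv (by fun_prop) z
    exact this
  simp only [convolution_def, ContinuousLinearMap.mul_apply']
  rw [← integral_const_mul, ← integral_add (i1 1) ((i1 I).const_mul I)]
  have := pompeiu hG hs z
  rw [show (π : ℂ) * G z = (2 * π * G z) / 2 by ring, ← this]
  congr 1
  congr 1; ext u; ring

end

section

/-- the layer-cake trick -/
lemma layer_measure_le {X : Type*} [MeasurableSpace X] (ν : Measure X) [IsFiniteMeasure ν]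
    {τ : X → ℝ} (h0 : ∀ x, 0 ≤ τ x) {s : ℝ} :
    ν {x | ν.real {y | τ x ≤ τ y} ≤ s} ≤ ENNReal.ofReal s := by
  set S := {x | ν.real {y | τ x ≤ τ y} ≤ s} with hS
  have hle : ∀ x ∈ S, ν {y | τ x ≤ τ y} ≤ ENNReal.ofReal s := by
    intro x hx
    rw [← ENNReal.ofReal_toReal (measure_ne_top ν _)]
    exact ENNReal.ofReal_le_ofReal hx
  rcases S.eq_empty_or_nonempty with he | hne
  · rw [he]; simp
  by_cases hmin : ∃ x ∈ S, ∀ y ∈ S, τ x ≤ τ y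
  · obtain ⟨x, hx, hxy⟩ := hmin
    exact (measure_mono hxy).trans (hle x hx)
  push Not at hmin
  obtain ⟨u, hu1, hu2, hu3⟩ := exists_seq_tendsto_sInf (hne.image τ)
    ⟨0, by rintro _ ⟨x, -, rfl⟩; exact h0 x⟩
  choose v hv hv2 using hu3
  have hsub : S ⊆ ⋃ n, {y | u n ≤ τ y} := by
    intro x hx
    obtain ⟨y, hy, hyx⟩ := hmin x hx
    have h1 : sInf (τ '' S) ≤ τ y :=
      csInf_le ⟨0, by rintro _ ⟨x, -, rfl⟩; exact h0 x⟩ (mem_image_of_mem τ hy)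
    have := hu2.eventually (gt_mem_nhds (lt_of_le_of_lt h1 hyx))
    obtain ⟨n, hn⟩ := this.exists
    exact mem_iUnion.2 ⟨n, hn.le⟩
  refine (measure_mono hsub).trans ?_
  have hmono : Monotone fun n => {y | u n ≤ τ y} := fun m n hmn y hy => (hu1 hmn).trans hy
  rw [hmono.measure_iUnion]
  refine iSup_le fun n => ?_
  rw [← hv2 n]
  exact hle _ (hv n)

lemma layer_lemma {X : Type*} [MeasurableSpace X] (ν : Measure X) [IsFiniteMeasure ν]
    {τ : X → ℝ} (h0 : ∀ x, 0 ≤ τ x) (hm : Measurable fun x => ν.real {y | τ x ≤ τ y}) :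
    ∫⁻ x, ENNReal.ofReal (Real.exp (-ν.real {y | τ x ≤ τ y})) ∂ν ≤ 1 := by
  set M := fun x => ν.real {y | τ x ≤ τ y} with hM
  have hM0 : ∀ x, 0 ≤ M x := fun x => measureReal_nonneg
  have h1 : ∀ x, ENNReal.ofReal (Real.exp (-M x)) =
      ∫⁻ s in Ioi (0:ℝ), (if M x < s then ENNReal.ofReal (Real.exp (-s)) else 0) := by
    intro x
    rw [← integral_exp_neg_Ioi, ofReal_integral_eq_lintegral_ofReal (integrableOn_exp_neg_Ioi _)
      (Eventually.of_forall fun _ => (Real.exp_pos _).le)]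
    rw [← lintegral_indicator measurableSet_Ioi, ← lintegral_indicator measurableSet_Ioi]
    congr 1; ext s
    simp only [indicator, mem_Ioi]
    by_cases h : M x < s
    · simp [h, (hM0 x).trans_lt h]
    · simp [h]
  change ∫⁻ x, ENNReal.ofReal (Real.exp (-M x)) ∂ν ≤ 1
  simp only [h1]
  rw [lintegral_lintegral_swap]
  · calc _ ≤ ∫⁻ s in Ioi (0:ℝ), ENNReal.ofReal (Real.exp (-s) * s ^ ((2:ℝ) - 1)) := by
          refine setLIntegral_mono' measurableSet_Ioi fun s hs => ?_
          have : ∀ x, (if M x < s then ENNReal.ofReal (Real.exp (-s)) else 0) ≤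
              {x | M x ≤ s}.indicator (fun _ => ENNReal.ofReal (Real.exp (-s))) x := by
            intro x
            simp only [indicator, mem_ofPred_eq]
            by_cases h : M x < s
            · simp [h, h.le]
            · simp [h]
          refine (lintegral_mono this).trans ?_
          rw [lintegral_indicator_const (measurableSet_le hm measurable_const), ENNReal.ofReal_mul (Real.exp_pos _).le]
          gcongr
          rw [show (2:ℝ) - 1 = 1 by norm_num, Real.rpow_one]
          exact layer_measure_le ν h0
      _ = 1 := by
          rw [← ofReal_integral_eq_lintegral_ofReal (Real.GammaIntegral_convergent (by norm_num)),
            ← Real.Gamma_eq_integral (by norm_num), Real.Gamma_two, ENNReal.ofReal_one]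
          refine (ae_restrict_iff' measurableSet_Ioi).2 (Eventually.of_forall fun s hs => ?_)
          have : (0:ℝ) < s := hs
          positivity
  · refine Measurable.aemeasurable ?_
    refine Measurable.ite ?_ (by fun_prop) measurable_const
    exact measurableSet_lt (hm.comp measurable_fst) measurable_snd

/-- the kernel in the exponent -/
def hk (w z : ℂ) : ℂ := (1 + conj w * z) / (1 - conj w * z)

lemma norm_hk_le {w z : ℂ} (hw : ‖w‖ < 1) (hz : ‖z‖ ≤ 1) : ‖hk w z‖ ≤ 2 / ‖1 - conj w * z‖ := by
  unfold hk
  rw [norm_div]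
  gcongr
  refine (norm_add_le _ _).trans ?_
  rw [norm_one, norm_mul, RCLike.norm_conj]
  nlinarith [norm_nonneg w, norm_nonneg z]

lemma norm_hk_le' {w z : ℂ} (hw : ‖w‖ < 1) (hz : ‖z‖ ≤ 1) (hne : z ≠ w) : ‖hk w z‖ ≤ 2 / ‖z - w‖ := by
  refine (norm_hk_le hw hz).trans ?_
  have h1 := dist_le_den hz hw.le
  have h2 : 0 < ‖z - w‖ := norm_pos_iff.2 (sub_ne_zero.2 hne)
  gcongr

lemma hk_re (w z : ℂ) : (hk w z).re = (1 - ‖w‖ ^ 2 * ‖z‖ ^ 2) / ‖1 - conj w * z‖ ^ 2 := by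
  unfold hk
  have : ‖w‖ ^ 2 * ‖z‖ ^ 2 = Complex.normSq (conj w * z) := by
    rw [map_mul, Complex.normSq_conj, Complex.normSq_eq_norm_sq, Complex.normSq_eq_norm_sq]
  rw [this, ← Complex.normSq_eq_norm_sq]
  generalize conj w * z = q
  rw [Complex.div_re, Complex.normSq_apply q]
  simp
  ring

lemma measurable_hk : Measurable fun q : ℂ × ℂ => hk q.1 q.2 := by
  unfold hk
  have : Measurable fun q : ℂ × ℂ => conj q.1 := (Complex.continuous_conj.measurable).comp measurable_fst
  fun_prop

lemma hk_re_nonneg {w z : ℂ} (hw : ‖w‖ < 1) (hz : ‖z‖ ≤ 1) : 0 ≤ (hk w z).re := by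
  rw [hk_re]
  refine div_nonneg ?_ (by positivity)
  have : ‖w‖ * ‖z‖ ≤ 1 := by nlinarith [norm_nonneg w, norm_nonneg z]
  nlinarith [mul_nonneg (norm_nonneg w) (norm_nonneg z)]

lemma hasDerivAt_hk {w z : ℂ} (hw : ‖w‖ < 1) (hz : ‖z‖ ≤ 1) :
    HasDerivAt (hk w) (2 * conj w / (1 - conj w * z) ^ 2) z := by
  have hne := den_ne hz hw
  unfold hk
  have h1 : HasDerivAt (fun z => conj w * z) (conj w) z := by
    simpa using (hasDerivAt_id z).const_mul (conj w)
  refine ((h1.const_add 1).div (h1.const_sub 1) hne).congr_deriv ?_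
  field_simp
  ring

/-- exponent integrand -/
def PhiI (ρ : ℂ → ℝ) (z : ℂ) (t : ℝ) (w : ℂ) : ℂ := if t ≤ ‖w‖ then hk w z * ρ w else 0

def PhiJ (ρ : ℂ → ℝ) (z : ℂ) (t : ℝ) : ℂ := ∫ w in ball (0:ℂ) 1, PhiI ρ z t w

def PhiD (ρ : ℂ → ℝ) (z : ℂ) (t : ℝ) : ℂ := ∫ w in ball (0:ℂ) 1,
  if t ≤ ‖w‖ then 2 * conj w / (1 - conj w * z) ^ 2 * ρ w else 0

/-- hypotheses on the density -/
structure RhoH (ρ : ℂ → ℝ) (W : ℝ) : Prop where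
  meas : Measurable ρ
  nonneg : ∀ z, 0 ≤ ρ z
  le : ∀ z, ρ z ≤ W
  carl : ∀ a : ℂ, ‖a‖ < 1 → ∫⁻ w in ball (0:ℂ) 1, ENNReal.ofReal (ρ w * jac a w) ≤ 1

lemma RhoH.W0 {ρ : ℂ → ℝ} {W : ℝ} (H : RhoH ρ W) : 0 ≤ W := (H.nonneg 0).trans (H.le 0)

lemma RhoH.measI {ρ : ℂ → ℝ} {W : ℝ} (H : RhoH ρ W) : Measurable fun q : (ℂ × ℝ) × ℂ => PhiI ρ q.1.1 q.1.2 q.2 := by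
  unfold PhiI
  refine Measurable.ite (measurableSet_le (by fun_prop) (by fun_prop)) ?_ measurable_const
  have h1 : Measurable fun q : (ℂ × ℝ) × ℂ => hk q.2 q.1.1 := by
    unfold hk
    have h3 : Measurable fun q : (ℂ × ℝ) × ℂ => conj q.2 :=
      (Complex.continuous_conj.measurable).comp measurable_snd
    fun_prop
  have h2 : Measurable fun q : (ℂ × ℝ) × ℂ => (ρ q.2 : ℂ) :=
    Complex.measurable_ofReal.comp (H.meas.comp measurable_snd)
  exact h1.mul h2

lemma RhoH.measPhi {ρ : ℂ → ℝ} {W : ℝ} (H : RhoH ρ W) : Measurable fun q : ℂ × ℝ => PhiJ ρ q.1 q.2 := by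
  unfold PhiJ
  exact (StronglyMeasurable.integral_prod_right' (ν := volume.restrict (ball (0:ℂ) 1))
    (f := fun q : (ℂ × ℝ) × ℂ => PhiI ρ q.1.1 q.1.2 q.2) H.measI.stronglyMeasurable).measurable

lemma RhoH.measPhiD {ρ : ℂ → ℝ} {W : ℝ} (H : RhoH ρ W) : Measurable fun q : ℂ × ℝ => PhiD ρ q.1 q.2 := by
  refine (StronglyMeasurable.integral_prod_right' (ν := volume.restrict (ball (0:ℂ) 1))
    (f := fun q : (ℂ × ℝ) × ℂ => if q.1.2 ≤ ‖q.2‖ then 2 * conj q.2 / (1 - conj q.2 * q.1.1) ^ 2 * ρ q.2 else 0)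
    (Measurable.stronglyMeasurable ?_)).measurable
  refine Measurable.ite (measurableSet_le (by fun_prop) (by fun_prop)) ?_ measurable_const
  have : Measurable fun q : (ℂ × ℝ) × ℂ => conj q.2 := (Complex.continuous_conj.measurable).comp measurable_snd
  have h2 : Measurable fun q : (ℂ × ℝ) × ℂ => (ρ q.2 : ℂ) :=
    Complex.measurable_ofReal.comp (H.meas.comp measurable_snd)
  fun_prop

lemma RhoH.measI1 {ρ : ℂ → ℝ} {W : ℝ} (H : RhoH ρ W) (z : ℂ) (t : ℝ) : Measurable (PhiI ρ z t) :=
  H.measI.comp (by fun_prop : Measurable fun w : ℂ => (((z, t) : ℂ × ℝ), w))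

lemma RhoH.normI {ρ : ℂ → ℝ} {W : ℝ} (H : RhoH ρ W) {z w : ℂ} (t : ℝ) : ‖PhiI ρ z t w‖ ≤ ‖hk w z‖ * W := by
  unfold PhiI
  split_ifs
  · rw [norm_mul, Complex.norm_real, Real.norm_of_nonneg (H.nonneg w)]
    gcongr; exact H.le w
  · rw [norm_zero]; exact mul_nonneg (norm_nonneg _) H.W0

lemma RhoH.normI' {ρ : ℂ → ℝ} {W : ℝ} (H : RhoH ρ W) {z w : ℂ} (t : ℝ) (hw : ‖w‖ < 1) (hz : ‖z‖ ≤ 1) (hne : z ≠ w) :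
    ‖PhiI ρ z t w‖ ≤ 2 * W / ‖z - w‖ := by
  refine (H.normI t).trans ?_
  have := norm_hk_le' hw hz hne
  calc _ ≤ 2 / ‖z - w‖ * W := by gcongr; exact H.W0
    _ = _ := by ring

lemma RhoH.contI {ρ : ℂ → ℝ} {W : ℝ} (_H : RhoH ρ W) {z w : ℂ} (t : ℝ) (hw : ‖w‖ < 1) (hz : ‖z‖ ≤ 1) :
    ContinuousAt (fun z => PhiI ρ z t w) z := by
  unfold PhiI
  split_ifs
  · exact (hasDerivAt_hk hw hz).continuousAt.mul continuousAt_const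
  · exact continuousAt_const

lemma RhoH.integrableI {ρ : ℂ → ℝ} {W : ℝ} (H : RhoH ρ W) {z : ℂ} (t : ℝ) (hz : ‖z‖ ≤ 1) : IntegrableOn (PhiI ρ z t) (ball 0 1) := by
  refine ((integrableOn_inv_norm_disk hz).const_mul (2 * W)).mono' (H.measI1 z t).aestronglyMeasurable ?_
  filter_upwards [ae_restrict_mem measurableSet_ball, ae_restrict_of_ae (Measure.ae_ne volume z)] with w hw hne
  rw [mul_one_div]
  exact H.normI' t (by simpa using hw) hz hne.symm

lemma RhoH.contPhi {ρ : ℂ → ℝ} {W : ℝ} (H : RhoH ρ W) (t : ℝ) : ContinuousOn (fun z => PhiJ ρ z t) (closedBall 0 1) := by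
  refine ws_continuousOn (C := 2 * W) (by linarith [H.W0]) (fun z hz => (H.measI1 z t).aestronglyMeasurable) ?_ ?_
  · intro z hz w hw hne
    exact H.normI' t (by simpa using hw) (by simpa using hz) hne
  · intro z hz w hw hne
    exact (H.contI t (by simpa using hw) (by simpa using hz)).continuousWithinAt

lemma RhoH.derivPhi {ρ : ℂ → ℝ} {W : ℝ} (H : RhoH ρ W) (t : ℝ) {z : ℂ} (hz : ‖z‖ < 1) : HasDerivAt (fun z => PhiJ ρ z t) (PhiD ρ z t) z := by
  set ε := (1 - ‖z‖) / 2 with hε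
  have hε0 : 0 < ε := by rw [hε]; linarith
  have hball : ∀ y ∈ ball z ε, ε ≤ 1 - ‖y‖ := by
    intro y hy
    rw [mem_ball, dist_eq_norm] at hy
    have : ‖y‖ ≤ ‖y - z‖ + ‖z‖ := by simpa using norm_add_le (y - z) z
    rw [hε] at *; linarith
  have hfin : IsFiniteMeasure (volume.restrict (ball (0:ℂ) 1)) := ⟨by simp⟩
  have h := hasDerivAt_integral_of_dominated_loc_of_deriv_le (μ := volume.restrict (ball (0:ℂ) 1))
    (F := fun z w => PhiI ρ z t w) (x₀ := z) (s := ball z ε) (bound := fun _ => 2 / ε ^ 2 * W)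
    (F' := fun z w => if t ≤ ‖w‖ then 2 * conj w / (1 - conj w * z) ^ 2 * ρ w else 0)
    (ball_mem_nhds _ hε0) ?_ ?_ ?_ ?_ (integrable_const _) ?_
  · exact h.2
  · exact Eventually.of_forall fun y => (H.measI1 y t).aestronglyMeasurable
  · exact H.integrableI t hz.le
  · refine Measurable.aestronglyMeasurable ?_
    refine Measurable.ite (measurableSet_le (by fun_prop) (by fun_prop)) ?_ measurable_const
    have : Measurable fun w : ℂ => conj w := Complex.continuous_conj.measurable
    have h2 : Measurable fun w : ℂ => (ρ w : ℂ) := Complex.measurable_ofReal.comp H.meas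
    fun_prop
  · filter_upwards [ae_restrict_mem measurableSet_ball] with w hw y hy
    have hw' : ‖w‖ < 1 := by simpa using hw
    have h1 := hball y hy
    have h2 := one_sub_le_den' (z := y) hw'.le
    split_ifs
    · rw [norm_mul, Complex.norm_real, Real.norm_of_nonneg (H.nonneg w), norm_div, norm_mul, norm_pow,
        RCLike.norm_conj, RCLike.norm_ofNat]
      have := H.W0
      have h3 := H.le w
      have h4 := H.nonneg w
      gcongr
      · linarith
      · linarith
    · rw [norm_zero]; have := H.W0; positivity
  · filter_upwards [ae_restrict_mem measurableSet_ball] with w hw y hy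
    have hw' : ‖w‖ < 1 := by simpa using hw
    have h1 := hball y hy
    unfold PhiI
    split_ifs
    · exact (hasDerivAt_hk hw' (by linarith)).mul_const _
    · exact hasDerivAt_const _ _

lemma RhoH.normPhiD {ρ : ℂ → ℝ} {W : ℝ} (H : RhoH ρ W) (t : ℝ) (z : ℂ) :
    ‖PhiD ρ z t‖ₑ ≤ 2 * TT (fun w => ENNReal.ofReal (ρ w)) z := by
  unfold PhiD
  refine (enorm_integral_le_lintegral_enorm _).trans ?_
  unfold TT
  rw [← lintegral_const_mul' _ _ (by norm_num)]
  refine setLIntegral_mono' measurableSet_ball fun w hw => ?_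
  have hw' : ‖w‖ < 1 := by simpa using hw
  split_ifs
  · rw [← ofReal_norm, Kk, ← ENNReal.ofReal_mul (by positivity), show (2:ℝ≥0∞) = ENNReal.ofReal 2 by simp,
      ← ENNReal.ofReal_mul (by positivity)]
    apply ENNReal.ofReal_le_ofReal
    rw [norm_mul, Complex.norm_real, Real.norm_of_nonneg (H.nonneg w), norm_div, norm_mul, norm_pow,
      RCLike.norm_conj, RCLike.norm_ofNat]
    have h4 := H.nonneg w
    rw [← mul_assoc, mul_one_div]
    gcongr
    linarith
  · simp

end

section

def EE (ρ : ℂ → ℝ) (z ζ : ℂ) : ℂ := exp (PhiJ ρ ζ ‖ζ‖ - PhiJ ρ z ‖ζ‖)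
def mm (ρ : ℂ → ℝ) (z : ℂ) (t : ℝ) : ℝ := (PhiJ ρ z t).re

lemma RhoH.mm_eq {ρ : ℂ → ℝ} {W : ℝ} (H : RhoH ρ W) {z : ℂ} (hz : ‖z‖ ≤ 1) (t : ℝ) :
    mm ρ z t = ∫ w in ball (0:ℂ) 1, (PhiI ρ z t w).re := by
  unfold mm PhiJ
  have := Complex.reCLM.integral_comp_comm (H.integrableI t hz)
  simpa using this.symm

lemma RhoH.reI_nonneg {ρ : ℂ → ℝ} {W : ℝ} (H : RhoH ρ W) {z w : ℂ} (hz : ‖z‖ ≤ 1) (hw : ‖w‖ < 1) (t : ℝ) :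
    0 ≤ (PhiI ρ z t w).re := by
  unfold PhiI
  split_ifs
  · rw [re_mul_ofReal]; exact mul_nonneg (hk_re_nonneg hw hz) (H.nonneg w)
  · simp

lemma RhoH.mm_eq' {ρ : ℂ → ℝ} {W : ℝ} (H : RhoH ρ W) {z : ℂ} (hz : ‖z‖ ≤ 1) (t : ℝ) :
    ENNReal.ofReal (mm ρ z t) = ∫⁻ w in ball (0:ℂ) 1, ENNReal.ofReal (PhiI ρ z t w).re := by
  have hi : IntegrableOn (fun w => (PhiI ρ z t w).re) (ball 0 1) := (H.integrableI t hz).re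
  rw [H.mm_eq hz, ofReal_integral_eq_lintegral_ofReal hi]
  · filter_upwards [ae_restrict_mem measurableSet_ball] with w hw
    exact H.reI_nonneg hz (by simpa using hw) t

lemma RhoH.mm_nonneg {ρ : ℂ → ℝ} {W : ℝ} (H : RhoH ρ W) {z : ℂ} (hz : ‖z‖ ≤ 1) (t : ℝ) : 0 ≤ mm ρ z t := by
  rw [H.mm_eq hz]
  refine setIntegral_nonneg measurableSet_ball fun w hw => H.reI_nonneg hz (by simpa using hw) t

lemma RhoH.mm_diag {ρ : ℂ → ℝ} {W : ℝ} (H : RhoH ρ W) {ζ : ℂ} (hζ : ‖ζ‖ < 1) : mm ρ ζ ‖ζ‖ ≤ 2 := by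
  have h : ENNReal.ofReal (mm ρ ζ ‖ζ‖) ≤ ENNReal.ofReal 2 := by
    rw [H.mm_eq' hζ.le]
    calc _ ≤ ∫⁻ w in ball (0:ℂ) 1, ENNReal.ofReal 2 * ENNReal.ofReal (ρ w * jac ζ w) := by
          refine setLIntegral_mono' measurableSet_ball fun w hw => ?_
          have hw' : ‖w‖ < 1 := by simpa using hw
          rw [← ENNReal.ofReal_mul (by norm_num)]
          apply ENNReal.ofReal_le_ofReal
          have hj := (jac_pos hζ hw').le
          have h4 := H.nonneg w
          unfold PhiI
          split_ifs with h
          · rw [re_mul_ofReal, hk_re]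
            unfold jac
            have e : ‖1 - conj ζ * w‖ = ‖1 - conj w * ζ‖ := by
              rw [← RCLike.norm_conj]; congr 1; simp [mul_comm]
            rw [e]
            have e2 : 1 - ‖w‖ ^ 2 * ‖ζ‖ ^ 2 ≤ 2 * (1 - ‖ζ‖ ^ 2) := by
              have : ‖ζ‖ ^ 2 ≤ ‖w‖ ^ 2 := by gcongr
              have h5 : ‖ζ‖ ^ 2 ≤ 1 := by nlinarith [norm_nonneg ζ]
              nlinarith [sq_nonneg ‖ζ‖]
            calc _ ≤ (2 * (1 - ‖ζ‖ ^ 2)) / ‖1 - conj w * ζ‖ ^ 2 * ρ w := by gcongr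
              _ = _ := by ring
          · simp only [zero_re]; positivity
      _ = ENNReal.ofReal 2 * ∫⁻ w in ball (0:ℂ) 1, ENNReal.ofReal (ρ w * jac ζ w) :=
          lintegral_const_mul' _ _ (by simp)
      _ ≤ ENNReal.ofReal 2 * 1 := by gcongr; exact H.carl ζ hζ
      _ = _ := by rw [mul_one]
  exact (ENNReal.ofReal_le_ofReal_iff (by norm_num)).1 h

lemma RhoH.measmm {ρ : ℂ → ℝ} {W : ℝ} (H : RhoH ρ W) (z : ℂ) : Measurable fun ζ : ℂ => mm ρ z ‖ζ‖ := by
  unfold mm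
  have : Measurable fun ζ : ℂ => PhiJ ρ z ‖ζ‖ :=
    H.measPhi.comp (by fun_prop : Measurable fun ζ : ℂ => ((z, ‖ζ‖) : ℂ × ℝ))
  exact Complex.measurable_re.comp this

lemma RhoH.layer {ρ : ℂ → ℝ} {W : ℝ} (H : RhoH ρ W) {z : ℂ} (hz : ‖z‖ ≤ 1) :
    ∫⁻ ζ in ball (0:ℂ) 1, ENNReal.ofReal (ρ ζ * (hk ζ z).re * Real.exp (-mm ρ z ‖ζ‖)) ≤ 1 := by
  set d : ℂ → ℝ≥0∞ := fun ζ => ENNReal.ofReal (ρ ζ * (hk ζ z).re) with hd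
  have hhk : Measurable fun ζ : ℂ => hk ζ z := by
    unfold hk
    have h3 : Measurable fun q : ℂ => conj q := Complex.continuous_conj.measurable
    fun_prop
  have hdm : Measurable d :=
    (H.meas.mul (Complex.measurable_re.comp hhk)).ennreal_ofReal
  set ν := (volume.restrict (ball (0:ℂ) 1)).withDensity d with hν
  have hS : ∀ t : ℝ, ν {y | t ≤ ‖y‖} = ENNReal.ofReal (mm ρ z t) := by
    intro t
    have hms : MeasurableSet {y : ℂ | t ≤ ‖y‖} := measurableSet_le measurable_const measurable_norm
    rw [H.mm_eq' hz, hν, withDensity_apply _ hms, ← lintegral_indicator hms]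
    congr 1; ext w
    unfold PhiI
    by_cases h : t ≤ ‖w‖
    · rw [indicator_of_mem (by exact h), if_pos h, hd, re_mul_ofReal]
      simp only [mul_comm]
    · rw [indicator_of_notMem (by exact h), if_neg h]; simp
  have hfin : IsFiniteMeasure ν := by
    constructor
    have := hS 0
    have hu : {y : ℂ | (0:ℝ) ≤ ‖y‖} = univ := by ext; simp
    rw [hu] at this
    rw [this]; exact ENNReal.ofReal_lt_top
  have hSr : ∀ t : ℝ, ν.real {y | t ≤ ‖y‖} = mm ρ z t := by
    intro t
    rw [measureReal_def, hS, ENNReal.toReal_ofReal (H.mm_nonneg hz t)]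
  have key := layer_lemma ν (τ := fun x : ℂ => ‖x‖) (fun x => norm_nonneg x) (by
    simp only [hSr]; exact H.measmm z)
  simp only [hSr] at key
  rw [hν, lintegral_withDensity_eq_lintegral_mul _ hdm (by
    exact (Real.measurable_exp.comp (H.measmm z).neg).ennreal_ofReal)] at key
  refine le_trans (le_of_eq ?_) key
  refine setLIntegral_congr_fun measurableSet_ball fun w hw => ?_
  simp only [Pi.mul_apply, hd]
  rw [← ENNReal.ofReal_mul]
  exact mul_nonneg (H.nonneg w) (hk_re_nonneg (by simpa using hw) hz)

lemma RhoH.normEE {ρ : ℂ → ℝ} {W : ℝ} (H : RhoH ρ W) {z ζ : ℂ} (hζ : ‖ζ‖ < 1) :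
    ‖EE ρ z ζ‖ ≤ Real.exp 2 * Real.exp (-mm ρ z ‖ζ‖) := by
  unfold EE
  rw [Complex.norm_exp, ← Real.exp_add, sub_re]
  apply Real.exp_le_exp.2
  have := H.mm_diag hζ
  unfold mm at *
  linarith

lemma RhoH.normEE' {ρ : ℂ → ℝ} {W : ℝ} (H : RhoH ρ W) {z ζ : ℂ} (hζ : ‖ζ‖ < 1) (hz : ‖z‖ ≤ 1) :
    ‖EE ρ z ζ‖ ≤ Real.exp 2 := by
  refine (H.normEE hζ).trans (mul_le_of_le_one_right (Real.exp_pos _).le ?_)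
  rw [Real.exp_le_one_iff]
  linarith [H.mm_nonneg hz ‖ζ‖]

lemma RhoH.measEE {ρ : ℂ → ℝ} {W : ℝ} (H : RhoH ρ W) (z : ℂ) : Measurable (EE ρ z) := by
  unfold EE
  have h1 : Measurable fun ζ : ℂ => PhiJ ρ z ‖ζ‖ :=
    H.measPhi.comp (by fun_prop : Measurable fun ζ : ℂ => ((z, ‖ζ‖) : ℂ × ℝ))
  have h2 : Measurable fun ζ : ℂ => PhiJ ρ ζ ‖ζ‖ :=
    H.measPhi.comp (by fun_prop : Measurable fun ζ : ℂ => ((ζ, ‖ζ‖) : ℂ × ℝ))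
  exact Complex.measurable_exp.comp (h2.sub h1)

lemma EE_self (ρ : ℂ → ℝ) (ζ : ℂ) : EE ρ ζ ζ = 1 := by unfold EE; simp

lemma RhoH.contEE {ρ : ℂ → ℝ} {W : ℝ} (H : RhoH ρ W) (ζ : ℂ) :
    ContinuousOn (fun z => EE ρ z ζ) (closedBall 0 1) := by
  unfold EE
  exact (continuousOn_const.sub (H.contPhi ‖ζ‖)).cexp

lemma RhoH.derivEE {ρ : ℂ → ℝ} {W : ℝ} (H : RhoH ρ W) (ζ : ℂ) {z : ℂ} (hz : ‖z‖ < 1) :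
    HasDerivAt (fun z => EE ρ z ζ) (EE ρ z ζ * -PhiD ρ z ‖ζ‖) z := by
  unfold EE
  exact ((H.derivPhi ‖ζ‖ hz).const_sub _).cexp

/-- kernel of the analytic-type solution -/
def kJ (ρ : ℂ → ℝ) (z ζ : ℂ) : ℂ := ((1 - ‖ζ‖ ^ 2 : ℝ) : ℂ) / (1 - conj ζ * z) * EE ρ z ζ

def bJ (ρ : ℂ → ℝ) (G : ℂ → ℂ) (z : ℂ) : ℂ :=
  (1 / π : ℝ) * ∫ ζ in ball (0:ℂ) 1, G ζ * kJ ρ z ζ / (z - ζ)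

def BJ (ρ : ℂ → ℝ) (G : ℂ → ℂ) (z : ℂ) : ℂ :=
  (1 / π : ℝ) * (conj z * ∫ ζ in ball (0:ℂ) 1, G ζ * kJ ρ z ζ / (1 - ζ * conj z))

lemma RhoH.normkJ {ρ : ℂ → ℝ} {W : ℝ} (H : RhoH ρ W) {z ζ : ℂ} (hζ : ‖ζ‖ < 1) (hz : ‖z‖ ≤ 1) :
    ‖kJ ρ z ζ‖ ≤ 2 * Real.exp 2 := by
  unfold kJ
  have h0 := one_sub_sq_pos hζ
  rw [norm_mul, norm_div, Complex.norm_real, Real.norm_of_nonneg h0.le]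
  have h1 := one_sub_sq_le_den (z := z) (ζ := ζ) hz hζ.le
  have h2 := den_pos hz hζ
  have h3 := H.normEE' hζ hz
  have : (1 - ‖ζ‖ ^ 2) / ‖1 - conj ζ * z‖ ≤ 2 := by rwa [div_le_iff₀ h2]
  gcongr

lemma RhoH.measkJ {ρ : ℂ → ℝ} {W : ℝ} (H : RhoH ρ W) (z : ℂ) : Measurable (kJ ρ z) := by
  unfold kJ
  have h3 : Measurable fun q : ℂ => conj q := Complex.continuous_conj.measurable
  have := H.measEE z
  have h4 : Measurable fun q : ℂ => ((1 - ‖q‖ ^ 2 : ℝ) : ℂ) := Complex.measurable_ofReal.comp (by fun_prop)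
  exact (h4.div (by fun_prop)).mul this

lemma RhoH.contkJ {ρ : ℂ → ℝ} {W : ℝ} (H : RhoH ρ W) {ζ : ℂ} (hζ : ‖ζ‖ < 1) :
    ContinuousOn (fun z => kJ ρ z ζ) (closedBall 0 1) := by
  unfold kJ
  refine ContinuousOn.mul (ContinuousOn.div continuousOn_const (by fun_prop) ?_) (H.contEE ζ)
  intro z hz
  exact den_ne (by simpa using hz) hζ

lemma kJ_self (ρ : ℂ → ℝ) {ζ : ℂ} (hζ : ‖ζ‖ < 1) : kJ ρ ζ ζ = 1 := by
  unfold kJ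
  rw [EE_self, mul_one]
  have h := den_ne hζ.le hζ
  rw [div_eq_one_iff_eq h, mul_comm, Complex.mul_conj, Complex.normSq_eq_norm_sq]
  push_cast; ring

lemma RhoH.derivkJ {ρ : ℂ → ℝ} {W : ℝ} (H : RhoH ρ W) {z ζ : ℂ} (hζ : ‖ζ‖ < 1) (hz : ‖z‖ < 1) :
    HasDerivAt (fun z => kJ ρ z ζ) (kJ ρ z ζ * (conj ζ / (1 - conj ζ * z) - PhiD ρ z ‖ζ‖)) z := by
  have hne := den_ne hz.le hζ
  have h1 : HasDerivAt (fun z => 1 - conj ζ * z) (- conj ζ) z := by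
    simpa using ((hasDerivAt_id z).const_mul (conj ζ)).const_sub 1
  unfold kJ
  refine (((hasDerivAt_const z _).div h1 hne).mul (H.derivEE ζ hz)).congr_deriv ?_
  simp only [Pi.div_apply]
  field_simp
  ring

end

section

lemma den_conj (z ζ : ℂ) : ‖1 - ζ * conj z‖ = ‖1 - conj ζ * z‖ := by
  rw [← RCLike.norm_conj]; congr 1; simp

/-- hypotheses on the data of the d-bar problem -/
structure GH (ρ : ℂ → ℝ) (G : ℂ → ℂ) (K : ℝ) : Prop where
  smooth : ContDiff ℝ 1 G
  supp : HasCompactSupport G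
  K0 : 0 ≤ K
  le : ∀ ζ ∈ ball (0:ℂ) 1, ‖G ζ‖ ≤ K * ρ ζ

lemma GH.leW {ρ : ℂ → ℝ} {G : ℂ → ℂ} {K W : ℝ} (g : GH ρ G K) (H : RhoH ρ W) {ζ : ℂ} (hζ : ‖ζ‖ < 1) :
    ‖G ζ‖ ≤ K * W := (g.le ζ (by simpa using hζ)).trans (mul_le_mul_of_nonneg_left (H.le ζ) g.K0)

lemma GH.meas {ρ : ℂ → ℝ} {G : ℂ → ℂ} {K : ℝ} (g : GH ρ G K) : Measurable G :=
  g.smooth.continuous.measurable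

lemma GH.cont_bJ {ρ : ℂ → ℝ} {G : ℂ → ℂ} {K W : ℝ} (g : GH ρ G K) (H : RhoH ρ W) :
    ContinuousOn (bJ ρ G) (closedBall 0 1) := by
  unfold bJ
  refine continuousOn_const.mul ?_
  have hK := g.K0
  have hW := H.W0
  refine ws_continuousOn (C := K * W * (2 * Real.exp 2)) (by positivity) ?_ ?_ ?_
  · intro z hz
    have h1 := g.meas
    have h2 := H.measkJ z
    exact ((h1.mul h2).div (by fun_prop)).aestronglyMeasurable
  · intro z hz ζ hζ hne
    have hζ' : ‖ζ‖ < 1 := by simpa using hζ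
    rw [norm_div, norm_mul]
    have h1 := g.leW H hζ'
    have h2 := H.normkJ hζ' (by simpa using hz : ‖z‖ ≤ 1)
    gcongr
  · intro z hz ζ hζ hne
    have hζ' : ‖ζ‖ < 1 := by simpa using hζ
    refine ContinuousWithinAt.div (continuousWithinAt_const.mul (H.contkJ hζ' z hz)) (by fun_prop) ?_
    exact sub_ne_zero.2 hne

lemma GH.cont_BJ {ρ : ℂ → ℝ} {G : ℂ → ℂ} {K W : ℝ} (g : GH ρ G K) (H : RhoH ρ W) :
    ContinuousOn (BJ ρ G) (closedBall 0 1) := by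
  unfold BJ
  refine continuousOn_const.mul (ContinuousOn.mul (by fun_prop) ?_)
  have hK := g.K0
  have hW := H.W0
  refine ws_continuousOn (C := K * W * (2 * Real.exp 2)) (by positivity) ?_ ?_ ?_
  · intro z hz
    have h1 := g.meas
    have h2 := H.measkJ z
    exact ((h1.mul h2).div (by fun_prop)).aestronglyMeasurable
  · intro z hz ζ hζ hne
    have hζ' : ‖ζ‖ < 1 := by simpa using hζ
    have hz' : ‖z‖ ≤ 1 := by simpa using hz
    rw [norm_div, norm_mul, den_conj]
    have h1 := g.leW H hζ'
    have h2 := H.normkJ hζ' hz'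
    have h3 := dist_le_den hz' hζ'.le
    have h4 : 0 < ‖z - ζ‖ := norm_pos_iff.2 (sub_ne_zero.2 hne)
    gcongr
  · intro z hz ζ hζ hne
    have hζ' : ‖ζ‖ < 1 := by simpa using hζ
    refine ContinuousWithinAt.div (continuousWithinAt_const.mul (H.contkJ hζ' z hz)) (by fun_prop) ?_
    rw [← norm_pos_iff, den_conj]
    exact den_pos (by simpa using hz) hζ'

lemma bJ_eq_BJ (ρ : ℂ → ℝ) (G : ℂ → ℂ) {z : ℂ} (hz : z ∈ sphere (0:ℂ) 1) : bJ ρ G z = BJ ρ G z := by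
  have hz' : ‖z‖ = 1 := by simpa using hz
  unfold bJ BJ
  congr 1
  rw [← integral_const_mul]
  refine setIntegral_congr_fun measurableSet_ball fun ζ hζ => ?_
  have hζ' : ‖ζ‖ < 1 := by simpa using hζ
  have hzz : conj z * z = 1 := by
    rw [mul_comm, Complex.mul_conj, Complex.normSq_eq_norm_sq, hz']; simp
  have h1 : z - ζ ≠ 0 := by
    intro h
    rw [sub_eq_zero.1 h] at hz'; linarith
  have h2 : 1 - ζ * conj z ≠ 0 := by
    rw [← norm_pos_iff, den_conj]; exact den_pos hz'.le hζ'
  have h3 : 1 - ζ * conj z = conj z * (z - ζ) := by rw [mul_sub, hzz]; ring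
  have h4 : conj z ≠ 0 := fun h => by rw [h] at hzz; simp at hzz
  rw [h3]
  field_simp

lemma kker_le {ρ : ℂ → ℝ} {W : ℝ} (H : RhoH ρ W) {z ζ : ℂ} (hz : ‖z‖ ≤ 1) (hζ : ‖ζ‖ < 1) :
    ‖kJ ρ z ζ / (1 - ζ * conj z)‖ ≤ Real.exp 2 * ((hk ζ z).re * Real.exp (-mm ρ z ‖ζ‖)) := by
  unfold kJ
  have h0 := one_sub_sq_pos hζ
  rw [norm_div, norm_mul, norm_div, Complex.norm_real, Real.norm_of_nonneg h0.le, den_conj, hk_re]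
  have h1 := H.normEE (z := z) hζ
  have h2 := den_pos hz hζ
  calc _ = (1 - ‖ζ‖ ^ 2) / ‖1 - conj ζ * z‖ ^ 2 * ‖EE ρ z ζ‖ := by field_simp
    _ ≤ (1 - ‖ζ‖ ^ 2 * ‖z‖ ^ 2) / ‖1 - conj ζ * z‖ ^ 2 * (Real.exp 2 * Real.exp (-mm ρ z ‖ζ‖)) := by
        gcongr
        · have : ‖z‖ ^ 2 ≤ 1 := by nlinarith [norm_nonneg z]
          refine div_nonneg ?_ (by positivity)
          nlinarith [sq_nonneg ‖ζ‖]
        · have : ‖z‖ ^ 2 ≤ 1 := by nlinarith [norm_nonneg z]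
          nlinarith [sq_nonneg ‖ζ‖]
    _ = _ := by ring

lemma GH.layer {ρ : ℂ → ℝ} {G : ℂ → ℂ} {K W : ℝ} (g : GH ρ G K) (H : RhoH ρ W) {z : ℂ} (hz : ‖z‖ ≤ 1) :
    ∫⁻ ζ in ball (0:ℂ) 1, ‖G ζ * kJ ρ z ζ / (1 - ζ * conj z)‖ₑ ≤ ENNReal.ofReal (K * Real.exp 2) := by
  calc _ ≤ ∫⁻ ζ in ball (0:ℂ) 1, ENNReal.ofReal (K * Real.exp 2) *
        ENNReal.ofReal (ρ ζ * (hk ζ z).re * Real.exp (-mm ρ z ‖ζ‖)) := by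
        refine setLIntegral_mono' measurableSet_ball fun ζ hζ => ?_
        have hζ' : ‖ζ‖ < 1 := by simpa using hζ
        have hK := g.K0
        rw [← ofReal_norm, ← ENNReal.ofReal_mul (by positivity)]
        apply ENNReal.ofReal_le_ofReal
        rw [mul_div_assoc, norm_mul]
        have h1 := kker_le H hz hζ'
        have h2 := g.le ζ hζ
        have h3 := H.nonneg ζ
        calc _ ≤ K * ρ ζ * (Real.exp 2 * ((hk ζ z).re * Real.exp (-mm ρ z ‖ζ‖))) := by gcongr
          _ = _ := by ring
    _ = ENNReal.ofReal (K * Real.exp 2) * _ := lintegral_const_mul' _ _ (by simp)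
    _ ≤ ENNReal.ofReal (K * Real.exp 2) * 1 := by gcongr; exact H.layer hz
    _ = _ := mul_one _

lemma GH.norm_BJ {ρ : ℂ → ℝ} {G : ℂ → ℂ} {K W : ℝ} (g : GH ρ G K) (H : RhoH ρ W) {z : ℂ} (hz : ‖z‖ ≤ 1) :
    ‖BJ ρ G z‖ ≤ K * Real.exp 2 := by
  unfold BJ
  have hK := g.K0
  have h1 : ‖∫ ζ in ball (0:ℂ) 1, G ζ * kJ ρ z ζ / (1 - ζ * conj z)‖ ≤ K * Real.exp 2 := by
    rw [← toReal_enorm]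
    exact ENNReal.toReal_le_of_le_ofReal (by positivity)
      ((enorm_integral_le_lintegral_enorm _).trans (g.layer H hz))
  rw [norm_mul, norm_mul, Complex.norm_real, RCLike.norm_conj, Real.norm_of_nonneg (by positivity)]
  have h2 : 1 / π ≤ 1 := by rw [div_le_one Real.pi_pos]; linarith [Real.pi_gt_three]
  calc _ ≤ 1 * (1 * (K * Real.exp 2)) := by gcongr
    _ = _ := by ring

/-- integrability for the Cauchy kernel -/
lemma integrable_cauchy {G : ℂ → ℂ} (hG : Continuous G) (hs : HasCompactSupport G) (z : ℂ) :
    Integrable fun ζ => G ζ / (z - ζ) := by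
  have := hs.convolutionExists_right (ContinuousLinearMap.mul ℝ ℂ) (μ := volume)
      locallyIntegrable_inv hG z
  have h2 : Integrable fun u : ℂ => u⁻¹ * G (z - u) := this
  have h3 := h2.comp_sub_left z
  refine h3.congr (Eventually.of_forall fun u => ?_)
  simp [div_eq_mul_inv, mul_comm]

lemma GH.hasWD_bJ {ρ : ℂ → ℝ} {G : ℂ → ℂ} {K W : ℝ} (g : GH ρ G K) (H : RhoH ρ W) {z₀ : ℂ} (hz : ‖z₀‖ < 1) :
    ∃ α, HasWD (bJ ρ G) α (G z₀) z₀ := by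
  have hK := g.K0
  have hW := H.W0
  have hfin : IsFiniteMeasure (volume.restrict (ball (0:ℂ) 1)) := ⟨by simp⟩
  obtain ⟨α, hα⟩ := cauchy_transform g.smooth g.supp z₀
  set ε := (1 - ‖z₀‖) / 3 with hε
  have hε0 : 0 < ε := by rw [hε]; linarith
  have hbz : ∀ z ∈ ball z₀ (3 * ε), ‖z‖ < 1 := by
    intro z hz
    rw [mem_ball, dist_eq_norm] at hz
    have : ‖z‖ ≤ ‖z - z₀‖ + ‖z₀‖ := by simpa using norm_add_le (z - z₀) z₀
    rw [hε] at hz; linarith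
  have hbz1 : ∀ z ∈ ball z₀ ε, ‖z‖ < 1 := fun z h => hbz z (ball_subset_ball (by linarith) h)
  have hbz2 : ∀ z ∈ ball z₀ ε, ε ≤ 1 - ‖z‖ := by
    intro z hz
    rw [mem_ball, dist_eq_norm] at hz
    have : ‖z‖ ≤ ‖z - z₀‖ + ‖z₀‖ := by simpa using norm_add_le (z - z₀) z₀
    have : 3 * ε = 1 - ‖z₀‖ := by rw [hε]; ring
    linarith
  -- the regular part
  set m : ℂ → ℂ → ℂ := fun z ζ => G ζ * dslope (fun z => kJ ρ z ζ) ζ z with hm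
  have hkd : ∀ ζ : ℂ, ‖ζ‖ < 1 → DifferentiableOn ℂ (fun z => kJ ρ z ζ) (ball 0 1) := by
    intro ζ hζ z hz
    exact (H.derivkJ hζ (by simpa using hz)).differentiableAt.differentiableWithinAt
  have hmae : ∀ z, ∀ᵐ ζ ∂(volume.restrict (ball (0:ℂ) 1)),
      m z ζ = G ζ * kJ ρ z ζ / (z - ζ) - G ζ / (z - ζ) := by
    intro z
    filter_upwards [ae_restrict_mem measurableSet_ball, ae_restrict_of_ae (Measure.ae_ne volume z)] with ζ hζ hne
    have hζ' : ‖ζ‖ < 1 := by simpa using hζ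
    simp only [hm]
    rw [dslope_of_ne _ hne.symm, slope_def_field, kJ_self ρ hζ']
    ring
  have hmm : ∀ z ∈ ball z₀ ε, AEStronglyMeasurable (m z) (volume.restrict (ball (0:ℂ) 1)) := by
    intro z hz
    refine AEStronglyMeasurable.congr ?_ (EventuallyEq.symm (hmae z))
    have h1 := g.meas
    have h2 := H.measkJ z
    exact (((h1.mul h2).div (by fun_prop)).sub (h1.div (by fun_prop))).aestronglyMeasurable
  have hmb : ∀ ζ ∈ ball (0:ℂ) 1, ∀ z ∈ ball z₀ ε, ‖m z ζ‖ ≤ K * W * ((2 * Real.exp 2 + 2) / ε) := by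
    intro ζ hζ z hz
    have hζ' : ‖ζ‖ < 1 := by simpa using hζ
    simp only [hm]
    rw [norm_mul]
    have h1 := g.leW H hζ'
    have hk1 : ∀ y : ℂ, ‖y‖ ≤ 1 → ‖kJ ρ y ζ - kJ ρ ζ ζ‖ ≤ 2 * Real.exp 2 + 1 := by
      intro y hy
      refine (norm_sub_le _ _).trans ?_
      rw [kJ_self ρ hζ', norm_one]
      linarith [H.normkJ hζ' hy]
    have h2 : ‖dslope (fun z => kJ ρ z ζ) ζ z‖ ≤ (2 * Real.exp 2 + 2) / ε := by
      by_cases hc : ‖z - ζ‖ < ε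
      · have hsub : ball ζ ε ⊆ ball z₀ (3 * ε) := by
          intro y hy
          rw [mem_ball] at hy hz ⊢
          rw [← dist_eq_norm] at hc
          have := dist_triangle y ζ z₀
          have := dist_triangle ζ z z₀
          rw [dist_comm ζ z] at this
          linarith
        refine Complex.norm_dslope_le_div_of_mapsTo_ball (R₂ := 2 * Real.exp 2 + 2) ?_ ?_ ?_
        · exact (hkd ζ hζ').mono fun y hy => by simpa using hbz y (hsub hy)
        · intro y hy
          rw [mem_closedBall, dist_eq_norm]
          linarith [hk1 y (hbz y (hsub hy)).le]
        · rwa [mem_ball, dist_eq_norm]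
      · push Not at hc
        have hne : z ≠ ζ := by
          rintro rfl; rw [sub_self, norm_zero] at hc; linarith
        rw [dslope_of_ne _ hne, slope_def_field, norm_div]
        have := hk1 z (hbz1 z hz).le
        gcongr
        linarith
    gcongr
  have hreg : DifferentiableAt ℂ (fun z => ∫ ζ in ball (0:ℂ) 1, m z ζ) z₀ := by
    refine differentiableAt_integral_param (C := K * W * ((2 * Real.exp 2 + 2) / ε)) hε0 hmm ?_ ?_
    · filter_upwards [ae_restrict_mem measurableSet_ball] with ζ hζ
      have hζ' : ‖ζ‖ < 1 := by simpa using hζ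
      refine DifferentiableOn.const_mul (DifferentiableOn.mono
        ((Complex.differentiableOn_dslope (isOpen_ball.mem_nhds hζ)).2 (hkd ζ hζ')) ?_) _
      intro y hy
      simpa using hbz1 y hy
    · filter_upwards [ae_restrict_mem measurableSet_ball] with ζ hζ using hmb ζ hζ
  -- the exterior part
  obtain ⟨CG, hCG⟩ := g.smooth.continuous.bounded_above_of_compact_support g.supp
  have hCG0 : 0 ≤ CG := (norm_nonneg _).trans (hCG 0)
  have hfin2 : IsFiniteMeasure (volume.restrict (tsupport G ∩ (ball (0:ℂ) 1)ᶜ)) := by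
    refine ⟨?_⟩
    rw [Measure.restrict_apply_univ]
    exact (measure_mono inter_subset_left).trans_lt g.supp.measure_lt_top
  have hmsE : MeasurableSet (tsupport G ∩ (ball (0:ℂ) 1)ᶜ) :=
    (isClosed_tsupport G).measurableSet.inter measurableSet_ball.compl
  have hext : DifferentiableAt ℂ (fun z => ∫ ζ in tsupport G ∩ (ball (0:ℂ) 1)ᶜ, G ζ / (z - ζ)) z₀ := by
    refine differentiableAt_integral_param (C := CG / ε) hε0 ?_ ?_ ?_
    · intro z hz
      exact (g.meas.div (by fun_prop)).aestronglyMeasurable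
    · filter_upwards [ae_restrict_mem hmsE] with ζ hζ z hz
      refine DifferentiableAt.differentiableWithinAt ?_
      refine DifferentiableAt.div (by fun_prop) (by fun_prop) (sub_ne_zero.2 ?_)
      rintro rfl
      exact hζ.2 (by simpa using hbz1 z hz)
    · filter_upwards [ae_restrict_mem hmsE] with ζ hζ z hz
      rw [norm_div]
      have h1 := hbz2 z hz
      have h2 : 1 ≤ ‖ζ‖ := by simpa using hζ.2
      have h3 : ‖ζ‖ - ‖z‖ ≤ ‖z - ζ‖ := by rw [norm_sub_rev]; exact norm_sub_norm_le _ _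
      have := hCG ζ
      gcongr
      linarith
  have hfinal := (((hasWD_const ((1 / π : ℝ) : ℂ) z₀).mul
    ((hreg.hasDerivAt.hasWD).add (hα.sub hext.hasDerivAt.hasWD))))
  refine ⟨_, (hfinal.congr_ev ?_).congr_wd rfl ?_⟩
  · filter_upwards [ball_mem_nhds z₀ hε0] with z hz
    unfold bJ
    congr 1
    have i0 := integrable_cauchy g.smooth.continuous g.supp z
    have i1 : IntegrableOn (m z) (ball 0 1) := by
      refine Integrable.of_bound (hmm z hz) (K * W * ((2 * Real.exp 2 + 2) / ε)) ?_
      filter_upwards [ae_restrict_mem measurableSet_ball] with ζ hζ using hmb ζ hζ z hz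
    have e1 : ∫ ζ, G ζ / (z - ζ) = (∫ ζ in ball (0:ℂ) 1, G ζ / (z - ζ)) +
        ∫ ζ in tsupport G ∩ (ball (0:ℂ) 1)ᶜ, G ζ / (z - ζ) := by
      rw [← integral_add_compl measurableSet_ball i0]
      congr 1
      rw [inter_comm]
      refine setIntegral_eq_of_subset_of_forall_sdiff_eq_zero measurableSet_ball.compl inter_subset_left ?_
      rintro ζ ⟨h1, h2⟩
      have : ζ ∉ tsupport G := fun h => h2 ⟨h1, h⟩
      rw [image_eq_zero_of_notMem_tsupport this, zero_div]
    rw [e1, add_sub_cancel_right, ← integral_add i1 i0.integrableOn]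
    refine integral_congr_ae ?_
    filter_upwards [hmae z] with ζ hζ
    rw [hζ]; ring
  · have : (π : ℂ) ≠ 0 := by exact_mod_cast Real.pi_ne_zero
    push_cast
    field_simp
    ring

end

section

lemma norm_cdm_le (α β : ℂ) : ‖cdm α β‖ ≤ ‖α‖ + ‖β‖ := by
  refine ContinuousLinearMap.opNorm_le_bound _ (by positivity) fun h => ?_
  rw [cdm_apply]
  refine (norm_add_le _ _).trans ?_
  rw [norm_mul, norm_mul, RCLike.norm_conj, add_mul]

lemma hasWD_integral {μ : Measure ℂ} [IsFiniteMeasure μ] {m A B : ℂ → ℂ → ℂ} {z₀ : ℂ} {ε C : ℝ} (hε : 0 < ε)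
    (hm : ∀ z ∈ ball z₀ ε, AEStronglyMeasurable (m z) μ) (hi : Integrable (m z₀) μ)
    (hA : AEStronglyMeasurable (A z₀) μ) (hB : AEStronglyMeasurable (B z₀) μ)
    (hd : ∀ᵐ ζ ∂μ, ∀ z ∈ ball z₀ ε, HasWD (fun z => m z ζ) (A z ζ) (B z ζ) z)
    (hAb : ∀ᵐ ζ ∂μ, ∀ z ∈ ball z₀ ε, ‖A z ζ‖ ≤ C) (hBb : ∀ᵐ ζ ∂μ, ∀ z ∈ ball z₀ ε, ‖B z ζ‖ ≤ C) :
    HasWD (fun z => ∫ ζ, m z ζ ∂μ) (∫ ζ, A z₀ ζ ∂μ) (∫ ζ, B z₀ ζ ∂μ) z₀ := by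
  have hz0 : z₀ ∈ ball z₀ ε := mem_ball_self hε
  have hcm : AEStronglyMeasurable (fun ζ => cdm (A z₀ ζ) (B z₀ ζ)) μ := by
    unfold cdm
    exact (hA.smul_const _).add (hB.smul_const _)
  have h := hasFDerivAt_integral_of_dominated_of_fderiv_le (𝕜 := ℝ) (μ := μ)
    (F := m) (F' := fun z ζ => cdm (A z ζ) (B z ζ)) (x₀ := z₀) (s := ball z₀ ε)
    (bound := fun _ => C + C) (ball_mem_nhds _ hε)
    (by filter_upwards [ball_mem_nhds z₀ hε] with z hz using hm z hz) hi hcm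
    (by
      filter_upwards [hAb, hBb] with ζ h1 h2 z hz
      exact (norm_cdm_le _ _).trans (add_le_add (h1 z hz) (h2 z hz)))
    (integrable_const _) (by filter_upwards [hd] with ζ h1 z hz using h1 z hz)
  have iA : Integrable (A z₀) μ := Integrable.of_bound hA C (by
    filter_upwards [hAb] with ζ h1 using h1 _ hz0)
  have iB : Integrable (B z₀) μ := Integrable.of_bound hB C (by
    filter_upwards [hBb] with ζ h1 using h1 _ hz0)
  have ic : Integrable (fun ζ => cdm (A z₀ ζ) (B z₀ ζ)) μ := Integrable.of_bound hcm (C + C) (by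
    filter_upwards [hAb, hBb] with ζ h1 h2
    exact (norm_cdm_le _ _).trans (add_le_add (h1 _ hz0) (h2 _ hz0)))
  refine h.congr_fderiv ?_
  ext v
  rw [ContinuousLinearMap.integral_apply ic, cdm_apply]
  simp only [cdm_apply]
  rw [integral_add (iA.mul_const _) (iB.mul_const _), integral_mul_const, integral_mul_const]

lemma RhoH.normPhiD_le {ρ : ℂ → ℝ} {W : ℝ} (H : RhoH ρ W) (t : ℝ) {y : ℂ} {ε : ℝ} (hε : 0 < ε) (hy : ε ≤ 1 - ‖y‖) :
    ‖PhiD ρ y t‖ ≤ 2 / ε ^ 2 * W * volume.real (ball (0:ℂ) 1) := by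
  unfold PhiD
  refine norm_setIntegral_le_of_norm_le_const (by simp) fun w hw => ?_
  have hw' : ‖w‖ < 1 := by simpa using hw
  have h2 := one_sub_le_den' (z := y) hw'.le
  have := H.W0
  split_ifs
  · rw [norm_mul, Complex.norm_real, Real.norm_of_nonneg (H.nonneg w), norm_div, norm_mul, norm_pow,
      RCLike.norm_conj, RCLike.norm_ofNat]
    have h3 := H.le w
    have h4 := H.nonneg w
    gcongr
    · linarith
    · linarith
  · rw [norm_zero]; positivity

lemma GH.hasWD_BJ {ρ : ℂ → ℝ} {G : ℂ → ℂ} {K W : ℝ} (g : GH ρ G K) (H : RhoH ρ W) {z₀ : ℂ} (hz : ‖z₀‖ < 1) :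
    ∃ α β, HasWD (BJ ρ G) α β z₀ ∧
      ‖α‖ₑ ≤ ENNReal.ofReal (4 * Real.exp 2 * K) * TT (fun w => ENNReal.ofReal (ρ w)) z₀ := by
  have hK := g.K0
  have hW := H.W0
  have hfin : IsFiniteMeasure (volume.restrict (ball (0:ℂ) 1)) := ⟨by simp⟩
  set ε := (1 - ‖z₀‖) / 2 with hε
  have hε0 : 0 < ε := by rw [hε]; linarith
  have hball : ∀ y ∈ ball z₀ ε, ε ≤ 1 - ‖y‖ := by
    intro y hy
    rw [mem_ball, dist_eq_norm] at hy
    have : ‖y‖ ≤ ‖y - z₀‖ + ‖z₀‖ := by simpa using norm_add_le (y - z₀) z₀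
    rw [hε] at *; linarith
  set N : ℂ → ℂ → ℂ := fun z ζ => G ζ * kJ ρ z ζ / (1 - ζ * conj z) with hN
  set A : ℂ → ℂ → ℂ := fun z ζ => N z ζ * (conj ζ / (1 - conj ζ * z) - PhiD ρ z ‖ζ‖) with hA
  set B : ℂ → ℂ → ℂ := fun z ζ => N z ζ * (ζ / (1 - ζ * conj z)) with hB
  have hcm : Measurable fun q : ℂ => conj q := Complex.continuous_conj.measurable
  have hNm : ∀ z, Measurable (N z) := fun z =>
    (g.meas.mul (H.measkJ z)).div (by fun_prop)
  have hDm : ∀ z, Measurable fun ζ : ℂ => PhiD ρ z ‖ζ‖ := fun z =>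
    H.measPhiD.comp (by fun_prop : Measurable fun ζ : ℂ => ((z, ‖ζ‖) : ℂ × ℝ))
  have hAm : ∀ z, Measurable (A z) := fun z =>
    (hNm z).mul ((hcm.div (by fun_prop)).sub (hDm z))
  have hBm : ∀ z, Measurable (B z) := fun z =>
    (hNm z).mul (by fun_prop)
  set C1 := K * W * (2 * Real.exp 2) / ε with hC1
  set V := 2 / ε ^ 2 * W * volume.real (ball (0:ℂ) 1) with hV
  have hV0 : 0 ≤ V := by positivity
  have hC10 : 0 ≤ C1 := by positivity
  have hNb : ∀ z ∈ ball z₀ ε, ∀ ζ ∈ ball (0:ℂ) 1, ‖N z ζ‖ ≤ C1 := by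
    intro z hz ζ hζ
    have hζ' : ‖ζ‖ < 1 := by simpa using hζ
    have h1 := hball z hz
    have h2 := one_sub_le_den' (z := z) hζ'.le
    have h3 := g.leW H hζ'
    have h4 := H.normkJ (z := z) hζ' (by linarith)
    simp only [hN]
    rw [norm_div, norm_mul, den_conj, hC1]
    have h5 : ε ≤ ‖1 - conj ζ * z‖ := by linarith
    gcongr
  have hwd : ∀ z ∈ ball z₀ ε, ∀ ζ ∈ ball (0:ℂ) 1, HasWD (fun z => N z ζ) (A z ζ) (B z ζ) z := by
    intro z hz ζ hζ
    have hζ' : ‖ζ‖ < 1 := by simpa using hζ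
    have h1 := hball z hz
    have hz1 : ‖z‖ < 1 := by linarith
    have hne := den_ne hz1.le hζ'
    have hne' : 1 - ζ * conj z ≠ 0 := by
      rw [← norm_pos_iff, den_conj]; exact den_pos hz1.le hζ'
    have hk := ((H.derivkJ hζ' hz1).const_mul (G ζ)).hasWD
    have hc : HasWD (fun z => conj z) 0 1 z := by
      simpa using (hasDerivAt_id z).hasWD.conj
    have hden := (hasWD_const 1 z).sub ((hasWD_const ζ z).mul hc)
    have hinv := HasWD.comp_hasDerivAt (f := fun z => 1 - ζ * conj z) (hasDerivAt_inv hne') hden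
    have h := hk.mul hinv
    refine HasWD.congr_wd (h.congr_ev (Eventually.of_forall fun y => ?_)) ?_ ?_
    · simp only [hN, div_eq_mul_inv]
    · simp only [hA, hN]; field_simp; ring
    · simp only [hB, hN]; field_simp; ring
  have hAb : ∀ z ∈ ball z₀ ε, ∀ ζ ∈ ball (0:ℂ) 1, ‖A z ζ‖ ≤ C1 * (1 / ε + V) := by
    intro z hz ζ hζ
    have hζ' : ‖ζ‖ < 1 := by simpa using hζ
    have h1 := hball z hz
    have h2 := one_sub_le_den' (z := z) hζ'.le
    simp only [hA]
    rw [norm_mul]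
    refine mul_le_mul (hNb z hz ζ hζ) ?_ (norm_nonneg _) hC10
    refine (norm_sub_le _ _).trans (add_le_add ?_ (H.normPhiD_le _ hε0 h1))
    rw [norm_div, RCLike.norm_conj]
    gcongr
    linarith
  have hBb : ∀ z ∈ ball z₀ ε, ∀ ζ ∈ ball (0:ℂ) 1, ‖B z ζ‖ ≤ C1 * (1 / ε + V) := by
    intro z hz ζ hζ
    have hζ' : ‖ζ‖ < 1 := by simpa using hζ
    have h1 := hball z hz
    have h2 := one_sub_le_den' (z := z) hζ'.le
    simp only [hB]
    rw [norm_mul]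
    refine mul_le_mul (hNb z hz ζ hζ) ?_ (norm_nonneg _) hC10
    rw [norm_div, den_conj]
    have : ‖ζ‖ / ‖1 - conj ζ * z‖ ≤ 1 / ε := by
      gcongr
      linarith
    linarith
  have hmain := hasWD_integral (μ := volume.restrict (ball (0:ℂ) 1)) (m := N) (A := A) (B := B) hε0
    (fun z hz => (hNm z).aestronglyMeasurable)
    (Integrable.of_bound (hNm z₀).aestronglyMeasurable C1 (by
      filter_upwards [ae_restrict_mem measurableSet_ball] with ζ hζ using hNb _ (mem_ball_self hε0) ζ hζ))
    (hAm z₀).aestronglyMeasurable (hBm z₀).aestronglyMeasurable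
    (by filter_upwards [ae_restrict_mem measurableSet_ball] with ζ hζ z hz using hwd z hz ζ hζ)
    (by filter_upwards [ae_restrict_mem measurableSet_ball] with ζ hζ z hz using hAb z hz ζ hζ)
    (by filter_upwards [ae_restrict_mem measurableSet_ball] with ζ hζ z hz using hBb z hz ζ hζ)
  have hc : HasWD (fun z => conj z) 0 1 z₀ := by
    simpa using (hasDerivAt_id z₀).hasWD.conj
  have hfull := (hasWD_const ((1 / π : ℝ) : ℂ) z₀).mul (hc.mul hmain)
  have hfull2 := hfull.congr_wd (α' := ((1 / π : ℝ) : ℂ) * (conj z₀ * ∫ ζ in ball (0:ℂ) 1, A z₀ ζ)) (by ring) rfl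
  refine ⟨_, _, hfull2, ?_⟩
  set T := TT (fun w => ENNReal.ofReal (ρ w)) z₀ with hT
  have hb1 : ‖∫ ζ in ball (0:ℂ) 1, A z₀ ζ‖ₑ ≤ ENNReal.ofReal (4 * Real.exp 2 * K) * T := by
    refine (enorm_integral_le_lintegral_enorm _).trans ?_
    calc ∫⁻ ζ in ball (0:ℂ) 1, ‖A z₀ ζ‖ₑ
        ≤ ∫⁻ ζ in ball (0:ℂ) 1, (ENNReal.ofReal (2 * Real.exp 2 * K) * (Kk z₀ ζ * ENNReal.ofReal (ρ ζ))
            + ‖N z₀ ζ‖ₑ * (2 * T)) := by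
          refine setLIntegral_mono' measurableSet_ball fun ζ hζ => ?_
          have hζ' : ‖ζ‖ < 1 := by simpa using hζ
          have hdp := den_pos hz.le hζ'
          simp only [hA]
          rw [mul_sub]
          refine (enorm_sub_le).trans (add_le_add ?_ ?_)
          · rw [← ofReal_norm, Kk, ← ENNReal.ofReal_mul (by positivity), ← ENNReal.ofReal_mul (by positivity)]
            apply ENNReal.ofReal_le_ofReal
            simp only [hN]
            rw [norm_mul, norm_div, norm_mul, norm_div, den_conj, RCLike.norm_conj]
            have h3 := g.le ζ hζ
            have h4 := H.normkJ hζ' hz.le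
            have h5 := H.nonneg ζ
            calc _ ≤ K * ρ ζ * (2 * Real.exp 2) / ‖1 - conj ζ * z₀‖ * (1 / ‖1 - conj ζ * z₀‖) := by gcongr
              _ = _ := by field_simp
          · rw [enorm_mul]
            gcongr
            exact H.normPhiD _ _
      _ = ENNReal.ofReal (2 * Real.exp 2 * K) * T + (∫⁻ ζ in ball (0:ℂ) 1, ‖N z₀ ζ‖ₑ) * (2 * T) := by
          rw [lintegral_add_right _ ((hNm z₀).enorm.mul_const _), lintegral_const_mul' _ _ ENNReal.ofReal_ne_top,
            lintegral_mul_const _ (hNm z₀).enorm]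
          rfl
      _ ≤ ENNReal.ofReal (2 * Real.exp 2 * K) * T + ENNReal.ofReal (K * Real.exp 2) * (2 * T) := by
          gcongr
          exact g.layer H hz.le
      _ = _ := by
          rw [← mul_assoc, ← add_mul]
          congr 1
          rw [show (2:ℝ≥0∞) = ENNReal.ofReal 2 by simp, ← ENNReal.ofReal_mul (by positivity),
            ← ENNReal.ofReal_add (by positivity) (by positivity)]
          congr 1; ring
  rw [enorm_mul, enorm_mul]
  refine le_trans ?_ hb1
  have e1 : ‖((1 / π : ℝ) : ℂ)‖ₑ ≤ 1 := by
    rw [← ofReal_norm, Complex.norm_real, Real.norm_of_nonneg (by positivity)]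
    rw [← ENNReal.ofReal_one]
    apply ENNReal.ofReal_le_ofReal
    rw [div_le_one Real.pi_pos]
    linarith [Real.pi_gt_three]
  have e2 : ‖conj z₀‖ₑ ≤ 1 := by
    rw [← ofReal_norm, RCLike.norm_conj, ← ENNReal.ofReal_one]
    exact ENNReal.ofReal_le_ofReal hz.le
  calc _ ≤ 1 * (1 * ‖∫ ζ in ball (0:ℂ) 1, A z₀ ζ‖ₑ) := by gcongr
    _ = _ := by simp

end

section

def SS {n : ℕ} (u : Fin n → ℂ) : ℂ := ∑ j, u j * conj (u j)
def hv {n : ℕ} (u : Fin n → ℂ) (j : Fin n) : ℂ := conj (u j) * (SS u)⁻¹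
def hav {n : ℕ} (u v : Fin n → ℂ) (j : Fin n) : ℂ :=
  conj (u j) * (-(SS u ^ 2)⁻¹ * ∑ l, v l * conj (u l))
def hbv {n : ℕ} (u v : Fin n → ℂ) (j : Fin n) : ℂ :=
  conj (u j) * (-(SS u ^ 2)⁻¹ * ∑ l, u l * conj (v l)) + conj (v j) * (SS u)⁻¹

lemma SS_eq {n : ℕ} (u : Fin n → ℂ) : SS u = ((∑ j, ‖u j‖ ^ 2 : ℝ) : ℂ) := by
  unfold SS
  push_cast
  refine Finset.sum_congr rfl fun j _ => ?_
  rw [Complex.mul_conj, Complex.normSq_eq_norm_sq]; push_cast; rfl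

lemma SS_ne {n : ℕ} {u : Fin n → ℂ} (hu : 0 < ∑ j, ‖u j‖ ^ 2) : SS u ≠ 0 := by
  rw [SS_eq]; exact_mod_cast hu.ne'

lemma norm_SS {n : ℕ} (u : Fin n → ℂ) : ‖SS u‖ = ∑ j, ‖u j‖ ^ 2 := by
  rw [SS_eq, Complex.norm_real, Real.norm_of_nonneg (Finset.sum_nonneg fun _ _ => by positivity)]

lemma sum_hv {n : ℕ} {u : Fin n → ℂ} (hu : 0 < ∑ j, ‖u j‖ ^ 2) : ∑ j, u j * hv u j = 1 := by
  have h := SS_ne hu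
  unfold hv
  simp_rw [← mul_assoc]
  rw [← Finset.sum_mul]
  exact mul_inv_cancel₀ h

lemma sum_hbv {n : ℕ} {u : Fin n → ℂ} (v : Fin n → ℂ) (hu : 0 < ∑ j, ‖u j‖ ^ 2) :
    ∑ j, u j * hbv u v j = 0 := by
  have h := SS_ne hu
  unfold hbv
  simp_rw [mul_add, ← mul_assoc]
  rw [Finset.sum_add_distrib, ← Finset.sum_mul, ← Finset.sum_mul, ← Finset.sum_mul]
  change SS u * _ * _ + _ = 0
  field_simp
  ring

lemma norm_le_sqrtS {n : ℕ} (u : Fin n → ℂ) (j : Fin n) : ‖u j‖ ≤ √(∑ j, ‖u j‖ ^ 2) := by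
  apply Real.le_sqrt_of_sq_le
  exact Finset.single_le_sum (f := fun j => ‖u j‖ ^ 2) (fun _ _ => by positivity) (Finset.mem_univ j)

lemma norm_hv_le {n : ℕ} {u : Fin n → ℂ} (hu : 0 < ∑ j, ‖u j‖ ^ 2) (j : Fin n) :
    ‖hv u j‖ ≤ 1 / √(∑ j, ‖u j‖ ^ 2) := by
  have h1 := norm_le_sqrtS u j
  set s := √(∑ j, ‖u j‖ ^ 2) with hs
  have hs0 : 0 < s := Real.sqrt_pos.2 hu
  unfold hv
  rw [norm_mul, RCLike.norm_conj, norm_inv, norm_SS, ← Real.sq_sqrt hu.le, ← hs]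
  calc _ ≤ s * (s ^ 2)⁻¹ := by gcongr
    _ = _ := by field_simp

lemma norm_sum_uv {n : ℕ} {u v : Fin n → ℂ} :
    ‖∑ l, v l * conj (u l)‖ ≤ √(∑ j, ‖u j‖ ^ 2) * ∑ l, ‖v l‖ := by
  refine (norm_sum_le _ _).trans ?_
  rw [Finset.mul_sum]
  refine Finset.sum_le_sum fun l _ => ?_
  rw [norm_mul, RCLike.norm_conj, mul_comm]
  exact mul_le_mul_of_nonneg_right (norm_le_sqrtS u l) (norm_nonneg _)

lemma norm_sum_uv' {n : ℕ} {u v : Fin n → ℂ} :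
    ‖∑ l, u l * conj (v l)‖ ≤ √(∑ j, ‖u j‖ ^ 2) * ∑ l, ‖v l‖ := by
  refine (norm_sum_le _ _).trans ?_
  rw [Finset.mul_sum]
  refine Finset.sum_le_sum fun l _ => ?_
  rw [norm_mul, RCLike.norm_conj]
  exact mul_le_mul_of_nonneg_right (norm_le_sqrtS u l) (norm_nonneg _)

lemma norm_hav_le {n : ℕ} {u v : Fin n → ℂ} (hu : 0 < ∑ j, ‖u j‖ ^ 2) (j : Fin n) :
    ‖hav u v j‖ ≤ (∑ l, ‖v l‖) / √(∑ j, ‖u j‖ ^ 2) ^ 2 := by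
  have h1 := norm_le_sqrtS u j
  have h2 := norm_sum_uv (u := u) (v := v)
  unfold hav
  rw [norm_mul, norm_mul, norm_neg, RCLike.norm_conj, norm_inv, norm_pow, norm_SS]
  nth_rw 1 [← Real.sq_sqrt hu.le]
  set s := √(∑ j, ‖u j‖ ^ 2) with hs
  have hs0 : 0 < s := Real.sqrt_pos.2 hu
  calc _ ≤ s * (((s ^ 2) ^ 2)⁻¹ * (s * ∑ l, ‖v l‖)) := by gcongr
    _ = _ := by field_simp

lemma norm_hbv_le {n : ℕ} {u v : Fin n → ℂ} (hu : 0 < ∑ j, ‖u j‖ ^ 2) (j : Fin n) :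
    ‖hbv u v j‖ ≤ 2 * (∑ l, ‖v l‖) / √(∑ j, ‖u j‖ ^ 2) ^ 2 := by
  have h1 := norm_le_sqrtS u j
  have h2 := norm_sum_uv' (u := u) (v := v)
  have h3 : ‖v j‖ ≤ ∑ l, ‖v l‖ :=
    Finset.single_le_sum (f := fun j => ‖v j‖) (fun _ _ => by positivity) (Finset.mem_univ j)
  unfold hbv
  refine (norm_add_le _ _).trans ?_
  rw [norm_mul, norm_mul, norm_mul, norm_neg, RCLike.norm_conj, RCLike.norm_conj, norm_inv, norm_inv, norm_pow, norm_SS]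
  rw [← Real.sq_sqrt hu.le, Real.sqrt_sq (Real.sqrt_nonneg _)]
  set s := √(∑ j, ‖u j‖ ^ 2) with hs
  have hs0 : 0 < s := Real.sqrt_pos.2 hu
  calc _ ≤ s * (((s ^ 2) ^ 2)⁻¹ * (s * ∑ l, ‖v l‖)) + (∑ l, ‖v l‖) * (s ^ 2)⁻¹ := by gcongr
    _ = _ := by field_simp; ring

lemma hasWD_hv {n : ℕ} {f : Fin n → ℂ → ℂ} {z : ℂ} (hf : ∀ j, DifferentiableAt ℂ (f j) z)
    (hu : 0 < ∑ j, ‖f j z‖ ^ 2) (j : Fin n) :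
    HasWD (fun z => hv (fun l => f l z) j) (hav (fun l => f l z) (fun l => deriv (f l) z) j)
      (hbv (fun l => f l z) (fun l => deriv (f l) z) j) z := by
  have h1 : ∀ l, HasWD (f l) (deriv (f l) z) 0 z := fun l => (hf l).hasDerivAt.hasWD
  have hS := HasWD.sum Finset.univ (fun l _ => (h1 l).mul (h1 l).conj)
  have hne := SS_ne (u := fun l => f l z) hu
  have hi := HasWD.comp_hasDerivAt (f := fun z => ∑ l, f l z * conj (f l z)) (hasDerivAt_inv hne) hS
  have h := (h1 j).conj.mul hi
  refine h.congr_wd ?_ ?_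
  · simp [hav, SS]
  · simp [hbv, SS]

lemma contDiffAt_real_of_differentiableOn {f : ℂ → ℂ} {R : ℝ} (hf : DifferentiableOn ℂ f (ball 0 R)) {z : ℂ}
    (hz : z ∈ ball (0:ℂ) R) : ContDiffAt ℝ 1 f z :=
  ((hf.analyticAt (isOpen_ball.mem_nhds hz)).contDiffAt (n := 1)).restrict_scalars ℝ

lemma contDiffAt_conj {f : ℂ → ℂ} {z : ℂ} (hf : ContDiffAt ℝ 1 f z) : ContDiffAt ℝ 1 (fun z => conj (f z)) z :=
  (Complex.conjCLE : ℂ →L[ℝ] ℂ).contDiff.contDiffAt.comp z hf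

/-- the data of the d-bar equations before cutting off -/
def G0 {n : ℕ} (g : ℂ → ℂ) (f : Fin n → ℂ → ℂ) (j k : Fin n) (z : ℂ) : ℂ :=
  g z ^ 3 * (hv (fun l => f l z) j * hbv (fun l => f l z) (fun l => deriv (f l) z) k)

lemma contDiffAt_G0 {n : ℕ} {g : ℂ → ℂ} {f : Fin n → ℂ → ℂ} {R : ℝ} (hg : DifferentiableOn ℂ g (ball 0 R))
    (hf : ∀ j, DifferentiableOn ℂ (f j) (ball 0 R)) {z : ℂ} (hz : z ∈ ball (0:ℂ) R)
    (hu : 0 < ∑ j, ‖f j z‖ ^ 2) (j k : Fin n) : ContDiffAt ℝ 1 (G0 g f j k) z := by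
  have hg1 := contDiffAt_real_of_differentiableOn hg hz
  have hf1 := fun j => contDiffAt_real_of_differentiableOn (hf j) hz
  have hf2 := fun j => contDiffAt_conj (hf1 j)
  have hf3 := fun j => contDiffAt_conj
    (contDiffAt_real_of_differentiableOn ((hf j).deriv isOpen_ball) hz)
  have hne := SS_ne (u := fun l => f l z) hu
  have hS : ContDiffAt ℝ 1 (fun z => SS (fun l => f l z)) z := by
    unfold SS
    exact ContDiffAt.sum fun l _ => (hf1 l).mul (hf2 l)
  have hSi := hS.inv hne
  have hSi2 := (hS.pow 2).inv (pow_ne_zero 2 hne)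
  unfold G0 hv hbv
  refine (hg1.pow 3).mul (((hf2 j).mul hSi).mul ((((hf2 k).mul (hSi2.neg.mul ?_))).add ((hf3 k).mul hSi)))
  exact ContDiffAt.sum fun l _ => (hf1 l).mul (hf3 l)

lemma exists_cutoff {X : ℂ → ℂ} {R : ℝ} (hR : 1 < R) (hX : ∀ z ∈ ball (0:ℂ) R, ContDiffAt ℝ 1 X z) :
    ∃ Y : ℂ → ℂ, ContDiff ℝ 1 Y ∧ HasCompactSupport Y ∧ ∀ z ∈ closedBall (0:ℂ) 1, Y z = X z := by
  let χ : ContDiffBump (0:ℂ) := ⟨1, (1 + R) / 2, one_pos, by linarith⟩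
  have hts : tsupport χ ⊆ ball 0 R := by
    rw [χ.tsupport_eq]
    exact closedBall_subset_ball (by change (1 + R) / 2 < R; linarith)
  refine ⟨fun z => (χ z : ℂ) * X z, ?_, ?_, ?_⟩
  · rw [contDiff_iff_contDiffAt]
    intro z
    by_cases hz : z ∈ tsupport χ
    · exact (Complex.ofRealCLM.contDiff.contDiffAt.comp z χ.contDiff.contDiffAt).mul (hX z (hts hz))
    · have : (fun z => (χ z : ℂ) * X z) =ᶠ[𝓝 z] fun _ => 0 := by
        filter_upwards [(isClosed_tsupport χ).isOpen_compl.mem_nhds hz] with y hy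
        rw [image_eq_zero_of_notMem_tsupport hy]; simp
      exact contDiffAt_const.congr_of_eventuallyEq this
  · refine HasCompactSupport.mul_right ?_
    exact χ.hasCompactSupport.comp_left (g := fun x : ℝ => (x:ℂ)) (by simp)
  · intro z hz
    simp [χ.one_of_mem_closedBall hz]

lemma norm_G0_le {n : ℕ} {g : ℂ → ℂ} {f : Fin n → ℂ → ℂ} {z : ℂ} 
    (hu : 0 < ∑ j, ‖f j z‖ ^ 2) (hgf : ‖g z‖ ≤ √(∑ j, ‖f j z‖ ^ 2)) (j k : Fin n) :
    ‖G0 g f j k z‖ ≤ 2 * ∑ l, ‖deriv (f l) z‖ := by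
  have h1 := norm_hv_le hu j
  have h2 := norm_hbv_le (v := fun l => deriv (f l) z) hu k
  unfold G0
  rw [norm_mul, norm_mul, norm_pow]
  set s := √(∑ j, ‖f j z‖ ^ 2) with hs
  have hs0 : 0 < s := Real.sqrt_pos.2 hu
  calc _ ≤ s ^ 3 * (1 / s * (2 * (∑ l, ‖deriv (f l) z‖) / s ^ 2)) := by gcongr
    _ = _ := by field_simp

end

section

lemma qp_eq (p : ℝ) (f : ℂ → ℂ) (a : ℂ) :
    qpIntegral p f a = ∫⁻ z in ball (0:ℂ) 1, ‖deriv f z‖ₑ ^ 2 * wt p a z := by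
  unfold qpIntegral unitDisk
  refine lintegral_congr fun z => ?_
  rw [ENNReal.ofReal_mul (by positivity), ENNReal.ofReal_pow (norm_nonneg _), ofReal_norm]
  rfl

def om {n : ℕ} (g : ℂ → ℂ) (f : Fin n → ℂ → ℂ) (z : ℂ) : ℝ := ‖deriv g z‖ + ∑ l, ‖deriv (f l) z‖

lemma om_nonneg {n : ℕ} (g : ℂ → ℂ) (f : Fin n → ℂ → ℂ) (z : ℂ) : 0 ≤ om g f z :=
  add_nonneg (norm_nonneg _) (Finset.sum_nonneg fun _ _ => norm_nonneg _)

lemma measurable_om {n : ℕ} (g : ℂ → ℂ) (f : Fin n → ℂ → ℂ) : Measurable (om g f) := by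
  unfold om
  have h1 := measurable_deriv g
  have h2 := fun l => measurable_deriv (f l)
  exact h1.norm.add (Finset.measurable_sum _ fun l _ => (h2 l).norm)

lemma om_sq_le {n : ℕ} (g : ℂ → ℂ) (f : Fin n → ℂ → ℂ) (z : ℂ) :
    om g f z ^ 2 ≤ 2 * ‖deriv g z‖ ^ 2 + ∑ l, 2 * n * ‖deriv (f l) z‖ ^ 2 := by
  unfold om
  have h1 := sq_sum_le_card_mul_sum_sq (s := Finset.univ) (f := fun l => ‖deriv (f l) z‖)
  rw [Finset.card_univ, Fintype.card_fin] at h1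
  rw [← Finset.mul_sum]
  nlinarith [sq_nonneg (‖deriv g z‖ - ∑ l, ‖deriv (f l) z‖)]

lemma om_int {n : ℕ} {p : ℝ} {g : ℂ → ℂ} {f : Fin n → ℂ → ℂ} {C : ℝ} (hC : 0 ≤ C) {a : ℂ}
    (hg : qpIntegral p g a ≤ ENNReal.ofReal C) (hf : ∀ j, qpIntegral p (f j) a ≤ ENNReal.ofReal C) :
    ∫⁻ z in ball (0:ℂ) 1, ENNReal.ofReal (om g f z) ^ 2 * wt p a z ≤ ENNReal.ofReal ((2 + n * (2 * n)) * C) := by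
  have hm : ∀ f : ℂ → ℂ, Measurable fun z => ‖deriv f z‖ₑ ^ 2 * wt p a z := fun f =>
    ((measurable_deriv f).enorm.pow_const 2).mul (measurable_wt p a)
  calc _ ≤ ∫⁻ z in ball (0:ℂ) 1, (ENNReal.ofReal 2 * (‖deriv g z‖ₑ ^ 2 * wt p a z)
        + ∑ l, ENNReal.ofReal (2 * n) * (‖deriv (f l) z‖ₑ ^ 2 * wt p a z)) := by
        refine lintegral_mono fun z => ?_
        have h1 := ENNReal.ofReal_le_ofReal (om_sq_le g f z)
        rw [ENNReal.ofReal_pow (om_nonneg _ _ _), ENNReal.ofReal_add (by positivity)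
          (Finset.sum_nonneg fun _ _ => by positivity), ENNReal.ofReal_sum_of_nonneg (fun _ _ => by positivity),
          ENNReal.ofReal_mul (by positivity), ENNReal.ofReal_pow (by positivity), ofReal_norm] at h1
        calc _ ≤ _ := mul_le_mul_left h1 _
          _ = _ := by
            rw [add_mul, Finset.sum_mul, mul_assoc]
            congr 1
            refine Finset.sum_congr rfl fun l _ => ?_
            rw [ENNReal.ofReal_mul (by positivity), ENNReal.ofReal_pow (by positivity), ofReal_norm, mul_assoc]
    _ = ENNReal.ofReal 2 * qpIntegral p g a + ∑ l, ENNReal.ofReal (2 * n) * qpIntegral p (f l) a := by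
        rw [lintegral_add_left ((hm g).const_mul _), lintegral_const_mul _ (hm g),
          lintegral_finsetSum _ (fun l _ => (hm (f l)).const_mul _), qp_eq]
        congr 1
        refine Finset.sum_congr rfl fun l _ => ?_
        rw [lintegral_const_mul _ (hm _), qp_eq]
    _ ≤ ENNReal.ofReal 2 * ENNReal.ofReal C + ∑ l : Fin n, ENNReal.ofReal (2 * n) * ENNReal.ofReal C := by
        gcongr with l
        exact hf l
    _ = _ := by
        rw [Finset.sum_const, Finset.card_univ, Fintype.card_fin, ← ENNReal.ofReal_mul (by positivity),
          ← ENNReal.ofReal_mul (by positivity), ← ENNReal.ofReal_nsmul, ← ENNReal.ofReal_add (by positivity) (by positivity)]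
        congr 1
        simp; ring

lemma TT_mono {ω ω' : ℂ → ℝ≥0∞} (h : ∀ z ∈ ball (0:ℂ) 1, ω z ≤ ω' z) (z : ℂ) : TT ω z ≤ TT ω' z :=
  setLIntegral_mono' measurableSet_ball fun ζ hζ => mul_le_mul_right (h ζ hζ) _

lemma TT_const_mul (c : ℝ) (ω : ℂ → ℝ≥0∞) (z : ℂ) :
    TT (fun w => ENNReal.ofReal c * ω w) z = ENNReal.ofReal c * TT ω z := by
  unfold TT
  rw [← lintegral_const_mul' _ _ ENNReal.ofReal_ne_top]
  refine lintegral_congr fun ζ => ?_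
  ring

lemma TT_integrable {Ω : ℂ → ℝ≥0∞} {W : ℝ} (h : ∀ z ∈ ball (0:ℂ) 1, Ω z ≤ ENNReal.ofReal W) :
    ∫⁻ z in ball (0:ℂ) 1, TT Ω z < ⊤ := by
  obtain ⟨C, hC, hF⟩ := forelli_rudin (s := 1 / 2) (by norm_num) (by norm_num)
  have h1 : ∀ ζ ∈ ball (0:ℂ) 1, (1:ℝ≥0∞) ≤ ENNReal.ofReal ((1 - ‖ζ‖ ^ 2) ^ (-(1 / 2) : ℝ)) := by
    intro ζ hζ
    have hζ' : ‖ζ‖ < 1 := by simpa using hζ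
    rw [← ENNReal.ofReal_one]
    apply ENNReal.ofReal_le_ofReal
    exact Real.one_le_rpow_of_pos_of_le_one_of_nonpos (one_sub_sq_pos hζ') (by nlinarith [norm_nonneg ζ]) (by norm_num)
  have h0 := hF 0 (by simp)
  calc _ ≤ ∫⁻ z in ball (0:ℂ) 1, ENNReal.ofReal W * (ENNReal.ofReal C * (Kk 0 z * ENNReal.ofReal ((1 - ‖z‖ ^ 2) ^ (-(1 / 2) : ℝ)))) := by
        refine setLIntegral_mono' measurableSet_ball fun z hz => ?_
        have hk : Kk 0 z = 1 := by unfold Kk; simp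
        rw [hk, one_mul, ← ENNReal.ofReal_mul hC.le]
        refine le_trans ?_ (mul_le_mul_right (hF z hz) _)
        unfold TT
        rw [← lintegral_const_mul' _ _ ENNReal.ofReal_ne_top]
        refine setLIntegral_mono' measurableSet_ball fun ζ hζ => ?_
        calc _ ≤ Kk z ζ * ENNReal.ofReal W := mul_le_mul_right (h ζ hζ) _
          _ = ENNReal.ofReal W * (Kk z ζ * 1) := by ring
          _ ≤ _ := by gcongr; exact h1 ζ hζ
    _ = ENNReal.ofReal W * (ENNReal.ofReal C * ∫⁻ z in ball (0:ℂ) 1, (Kk 0 z * ENNReal.ofReal ((1 - ‖z‖ ^ 2) ^ (-(1 / 2) : ℝ)))) := by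
        rw [lintegral_const_mul' _ _ ENNReal.ofReal_ne_top, lintegral_const_mul' _ _ ENNReal.ofReal_ne_top]
    _ < ⊤ := by
        refine ENNReal.mul_lt_top ENNReal.ofReal_lt_top (ENNReal.mul_lt_top ENNReal.ofReal_lt_top ?_)
        exact h0.trans_lt ENNReal.ofReal_lt_top

/-- the final `Q_p` estimate -/
lemma qp_final {p : ℝ} {Ct : ℝ} (hCt : 0 < Ct)
    (hT : ∀ a : ℂ, ‖a‖ < 1 → ∀ ω : ℂ → ℝ≥0∞, Measurable ω →
      ∫⁻ z in ball (0:ℂ) 1, (TT ω z) ^ 2 * wt p a z ≤ ENNReal.ofReal Ct * ∫⁻ ζ in ball (0:ℂ) 1, ω ζ ^ 2 * wt p a ζ)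
    {F : ℂ → ℂ} {Ω : ℂ → ℝ≥0∞} (hΩ : Measurable Ω) {C1 E : ℝ} (hC1 : 0 ≤ C1)
    (hF : ∀ z ∈ ball (0:ℂ) 1, ‖deriv F z‖ₑ ≤ ENNReal.ofReal C1 * TT (fun w => Ω w + TT Ω w) z)
    {a : ℂ} (ha : ‖a‖ < 1) (hE : ∫⁻ ζ in ball (0:ℂ) 1, Ω ζ ^ 2 * wt p a ζ ≤ ENNReal.ofReal E) :
    qpIntegral p F a ≤ ENNReal.ofReal (C1 ^ 2 * (Ct * (2 * (1 + Ct)))) * ENNReal.ofReal E := by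
  have hm1 : Measurable fun ζ => Ω ζ ^ 2 * wt p a ζ := (hΩ.pow_const 2).mul (measurable_wt p a)
  have hm2 : Measurable fun ζ => TT Ω ζ ^ 2 * wt p a ζ := ((measurable_TT hΩ).pow_const 2).mul (measurable_wt p a)
  rw [qp_eq]
  calc _ ≤ ∫⁻ z in ball (0:ℂ) 1, ENNReal.ofReal (C1 ^ 2) * ((TT (fun w => Ω w + TT Ω w) z) ^ 2 * wt p a z) := by
        refine setLIntegral_mono' measurableSet_ball fun z hz => ?_
        calc _ ≤ (ENNReal.ofReal C1 * TT (fun w => Ω w + TT Ω w) z) ^ 2 * wt p a z := by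
              gcongr; exact hF z hz
          _ = _ := by rw [mul_pow, ENNReal.ofReal_pow hC1, mul_assoc]
    _ = ENNReal.ofReal (C1 ^ 2) * ∫⁻ z in ball (0:ℂ) 1, ((TT (fun w => Ω w + TT Ω w) z) ^ 2 * wt p a z) :=
        lintegral_const_mul' _ _ ENNReal.ofReal_ne_top
    _ ≤ ENNReal.ofReal (C1 ^ 2) * (ENNReal.ofReal Ct * ∫⁻ z in ball (0:ℂ) 1, ((Ω z + TT Ω z) ^ 2 * wt p a z)) := by
        gcongr
        exact hT a ha _ (hΩ.add (measurable_TT hΩ))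
    _ ≤ ENNReal.ofReal (C1 ^ 2) * (ENNReal.ofReal Ct * (2 * (ENNReal.ofReal E + ENNReal.ofReal Ct * ENNReal.ofReal E))) := by
        gcongr
        calc _ ≤ ∫⁻ z in ball (0:ℂ) 1, 2 * ((Ω z ^ 2 * wt p a z) + (TT Ω z ^ 2 * wt p a z)) := by
              refine lintegral_mono fun z => ?_
              have : (Ω z + TT Ω z) ^ 2 ≤ 2 * (Ω z ^ 2 + TT Ω z ^ 2) := by
                have h := ENNReal.rpow_add_le_mul_rpow_add_rpow (Ω z) (TT Ω z) (p := 2) (by norm_num)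
                norm_num at h
                exact_mod_cast h
              calc _ ≤ _ := mul_le_mul_left this _
                _ = _ := by ring
          _ = 2 * ((∫⁻ z in ball (0:ℂ) 1, (Ω z ^ 2 * wt p a z)) + ∫⁻ z in ball (0:ℂ) 1, (TT Ω z ^ 2 * wt p a z)) := by
              rw [lintegral_const_mul' _ _ (by norm_num), lintegral_add_left hm1]
          _ ≤ _ := by
              gcongr
              exact (hT a ha Ω hΩ).trans (by gcongr)
    _ = _ := by
        rw [ENNReal.ofReal_mul (by positivity), ENNReal.ofReal_mul (by positivity), ENNReal.ofReal_mul (by positivity),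
          ENNReal.ofReal_add (by positivity) (by positivity)]
        simp only [ENNReal.ofReal_one, ENNReal.ofReal_ofNat]
        ring

end

section

theorem core {n : ℕ} {R M K W : ℝ} (hR : 1 < R) (hK : 0 ≤ K) (hM : 0 ≤ M) {g : ℂ → ℂ} {f : Fin n → ℂ → ℂ}
    {ρ : ℂ → ℝ} (hg : DifferentiableOn ℂ g (ball 0 R)) (hf : ∀ j, DifferentiableOn ℂ (f j) (ball 0 R))
    (hu : ∀ z ∈ ball (0:ℂ) R, 0 < ∑ j, ‖f j z‖ ^ 2)
    (hgf : ∀ z ∈ ball (0:ℂ) R, ‖g z‖ ≤ √(∑ j, ‖f j z‖ ^ 2))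
    (hgM : ∀ z ∈ ball (0:ℂ) R, ‖g z‖ ≤ M) (hfM : ∀ j, ∀ z ∈ ball (0:ℂ) R, ‖f j z‖ ≤ M)
    (H : RhoH ρ W) (hρ : ∀ z ∈ ball (0:ℂ) 1, om g f z = K * ρ z) :
    ∃ F : Fin n → ℂ → ℂ, (∀ j, DifferentiableOn ℂ (F j) (ball 0 1) ∧
      (∀ z ∈ ball (0:ℂ) 1, ‖F j z‖ ≤ M ^ 2 + n * (M * (2 * (2 * K * Real.exp 2)))) ∧
      (∀ z ∈ ball (0:ℂ) 1, ‖deriv (F j) z‖ₑ ≤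
        ENNReal.ofReal ((4 * M + 4 * K * Real.exp 2) * K + n * (M * (2 * (4 * Real.exp 2 * (2 * K))))) *
          TT (fun w => ENNReal.ofReal (ρ w) + TT (fun w => ENNReal.ofReal (ρ w)) w) z)) ∧
      ∀ z ∈ ball (0:ℂ) 1, ∑ j, f j z * F j z = g z ^ 3 := by
  have hsub : closedBall (0:ℂ) 1 ⊆ ball 0 R := closedBall_subset_ball hR
  have hsub1 : ball (0:ℂ) 1 ⊆ ball 0 R := ball_subset_closedBall.trans hsub
  have hcut : ∀ j k : Fin n, ∃ Y : ℂ → ℂ, ContDiff ℝ 1 Y ∧ HasCompactSupport Y ∧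
      ∀ z ∈ closedBall (0:ℂ) 1, Y z = G0 g f j k z := fun j k =>
    exists_cutoff hR fun z hz => contDiffAt_G0 hg hf hz (hu z hz) j k
  choose G hG1 hG2 hG3 using hcut
  have gh : ∀ j k, GH ρ (G j k) (2 * K) := by
    intro j k
    refine ⟨hG1 j k, hG2 j k, by positivity, fun ζ hζ => ?_⟩
    rw [hG3 j k ζ (ball_subset_closedBall hζ)]
    refine (norm_G0_le (hu ζ (hsub1 hζ)) (hgf ζ (hsub1 hζ)) j k).trans ?_
    rw [mul_assoc, ← hρ ζ hζ]
    unfold om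
    linarith [norm_nonneg (deriv g ζ)]
  have hfd : ∀ j, ∀ z ∈ ball (0:ℂ) R, DifferentiableAt ℂ (f j) z := fun j z hz =>
    (hf j).differentiableAt (isOpen_ball.mem_nhds hz)
  have hgd : ∀ z ∈ ball (0:ℂ) R, DifferentiableAt ℂ g z := fun z hz =>
    hg.differentiableAt (isOpen_ball.mem_nhds hz)
  have hhwd := fun (j : Fin n) (z : ℂ) (hz : z ∈ ball (0:ℂ) R) =>
    (((hgd z hz).hasDerivAt.pow 3).hasWD).mul (hasWD_hv (fun l => hfd l z hz) (hu z hz) j)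
  have hfwd : ∀ (j : Fin n) (z : ℂ), z ∈ ball (0:ℂ) R → HasWD (f j) (deriv (f j) z) 0 z :=
    fun j z hz => (hfd j z hz).hasDerivAt.hasWD
  set X : Fin n → ℂ → ℂ := fun j z => g z ^ 3 * hv (fun l => f l z) j with hX
  have hXc : ∀ j, ContinuousOn (X j) (closedBall 0 1) := fun j z hz =>
    ((hhwd j z (hsub hz)).hasFDerivAt.continuousAt).continuousWithinAt
  have hfc : ∀ j, ContinuousOn (f j) (closedBall 0 1) := fun j => (hf j).continuousOn.mono hsub
  set F : Fin n → ℂ → ℂ := fun j z => X j z + ∑ k, f k z * (bJ ρ (G j k) z - bJ ρ (G k j) z) with hF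
  set U : Fin n → ℂ → ℂ := fun j z => X j z + ∑ k, f k z * (BJ ρ (G j k) z - BJ ρ (G k j) z) with hU
  have hFc : ∀ j, ContinuousOn (F j) (closedBall 0 1) := fun j =>
    (hXc j).add (continuousOn_finsetSum _ fun k _ => (hfc k).mul
      (((gh j k).cont_bJ H).sub ((gh k j).cont_bJ H)))
  have hUc : ∀ j, ContinuousOn (U j) (closedBall 0 1) := fun j =>
    (hXc j).add (continuousOn_finsetSum _ fun k _ => (hfc k).mul
      (((gh j k).cont_BJ H).sub ((gh k j).cont_BJ H)))
  have hFU : ∀ j, ∀ z ∈ sphere (0:ℂ) 1, F j z = U j z := by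
    intro j z hz
    simp only [hF, hU, bJ_eq_BJ ρ _ hz]
  -- analyticity
  have hFd : ∀ j, DifferentiableOn ℂ (F j) (ball 0 1) := by
    intro j z hz
    have hz' : ‖z‖ < 1 := by simpa using hz
    choose αb hαb using fun j k => (gh j k).hasWD_bJ H hz'
    have h := (hhwd j z (hsub1 hz)).add (HasWD.sum Finset.univ fun k _ =>
      (hfwd k z (hsub1 hz)).mul ((hαb j k).sub (hαb k j)))
    refine (h.congr_wd rfl ?_).hasDerivAt.differentiableAt.differentiableWithinAt
    have s1 := sum_hv (hu z (hsub1 hz))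
    have s2 := sum_hbv (fun l => deriv (f l) z) (hu z (hsub1 hz))
    have e : ∀ k, f k z * (G j k z - G k j z) + 0 * (bJ ρ (G j k) z - bJ ρ (G k j) z) =
        g z ^ 3 * hv (fun l => f l z) j * (f k z * hbv (fun l => f l z) (fun l => deriv (f l) z) k)
        - g z ^ 3 * hbv (fun l => f l z) (fun l => deriv (f l) z) j * (f k z * hv (fun l => f l z) k) := by
      intro k
      rw [hG3 j k z (ball_subset_closedBall hz), hG3 k j z (ball_subset_closedBall hz)]
      unfold G0
      ring
    simp only [e]
    rw [Finset.sum_sub_distrib, ← Finset.mul_sum, ← Finset.mul_sum, s1, s2]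
    simp
  have hdens : ∀ z ∈ ball (0:ℂ) R, ∀ j, ‖g z‖ * ‖hv (fun l => f l z) j‖ ≤ 1 := by
    intro z hz j
    have h1 := norm_hv_le (hu z hz) j
    have h2 := hgf z hz
    set s := √(∑ j, ‖f j z‖ ^ 2) with hs
    have hs0 : 0 < s := Real.sqrt_pos.2 (hu z hz)
    calc _ ≤ s * (1 / s) := by gcongr
      _ = 1 := by field_simp
  have hUb : ∀ j, ∀ z ∈ closedBall (0:ℂ) 1, ‖U j z‖ ≤ M ^ 2 + n * (M * (2 * (2 * K * Real.exp 2))) := by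
    intro j z hz
    have hz' : ‖z‖ ≤ 1 := by simpa using hz
    have hzR := hsub hz
    simp only [hU]
    refine (norm_add_le _ _).trans (add_le_add ?_ ?_)
    · simp only [hX]
      rw [norm_mul, norm_pow]
      calc ‖g z‖ ^ 3 * ‖hv (fun l => f l z) j‖ = ‖g z‖ ^ 2 * (‖g z‖ * ‖hv (fun l => f l z) j‖) := by ring
        _ ≤ M ^ 2 * 1 := by
          gcongr
          · exact hgM z hzR
          · exact hdens z hzR j
        _ = _ := by ring
    · refine (norm_sum_le _ _).trans ?_
      calc _ ≤ ∑ k : Fin n, M * (2 * (2 * K * Real.exp 2)) := by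
            refine Finset.sum_le_sum fun k _ => ?_
            rw [norm_mul]
            have h1 := (gh j k).norm_BJ H hz'
            have h2 := (gh k j).norm_BJ H hz'
            refine mul_le_mul (hfM k z hzR) ?_ (norm_nonneg _) hM
            refine (norm_sub_le _ _).trans ?_
            linarith
        _ = _ := by simp
  set C1 := (4 * M + 4 * K * Real.exp 2) * K + n * (M * (2 * (4 * Real.exp 2 * (2 * K)))) with hC1
  set Ω : ℂ → ℝ≥0∞ := fun w => ENNReal.ofReal (ρ w) with hΩ
  have hΩm : Measurable Ω := H.meas.ennreal_ofReal
  have hUwd : ∀ j, ∀ z ∈ ball (0:ℂ) 1, ∃ α β, HasWD (U j) α β z ∧ ‖α‖ₑ ≤ ENNReal.ofReal C1 * (Ω z + TT Ω z) := by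
    intro j z hz
    have hz' : ‖z‖ < 1 := by simpa using hz
    have hzR := hsub1 hz
    choose αb βb hαb hαb2 using fun j k => (gh j k).hasWD_BJ H hz'
    have h := (hhwd j z hzR).add (HasWD.sum Finset.univ fun k _ =>
      (hfwd k z hzR).mul ((hαb j k).sub (hαb k j)))
    refine ⟨_, _, h, ?_⟩
    set A1 : ℂ := g z ^ 3 * hav (fun l => f l z) (fun l => deriv (f l) z) j +
      ((3:ℕ) * g z ^ (3 - 1) * deriv g z) * hv (fun l => f l z) j +
      ∑ k, deriv (f k) z * (BJ ρ (G j k) z - BJ ρ (G k j) z) with hA1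
    set A2 : ℂ := ∑ k, f k z * (αb j k - αb k j) with hA2
    have hom := hρ z hz
    have hρ0 := H.nonneg z
    have b1 : ‖A1‖ ≤ ((4 * M + 4 * K * Real.exp 2) * K) * ρ z := by
      have hD0 : 0 ≤ ∑ l, ‖deriv (f l) z‖ := Finset.sum_nonneg fun _ _ => norm_nonneg _
      have t1 : ‖g z ^ 3 * hav (fun l => f l z) (fun l => deriv (f l) z) j‖ ≤ M * ∑ l, ‖deriv (f l) z‖ := by
        rw [norm_mul, norm_pow]
        have h1 := norm_hav_le (v := fun l => deriv (f l) z) (hu z hzR) j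
        have h2 := hgf z hzR
        have h3 := hgM z hzR
        set s := √(∑ j, ‖f j z‖ ^ 2) with hs
        have hs0 : 0 < s := Real.sqrt_pos.2 (hu z hzR)
        calc _ = ‖g z‖ * ‖g z‖ ^ 2 * ‖hav (fun l => f l z) (fun l => deriv (f l) z) j‖ := by ring
          _ ≤ M * s ^ 2 * ((∑ l, ‖deriv (f l) z‖) / s ^ 2) := by gcongr
          _ = _ := by field_simp
      have t2 : ‖((3:ℕ) * g z ^ (3 - 1) * deriv g z) * hv (fun l => f l z) j‖ ≤ 3 * M * ‖deriv g z‖ := by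
        have h1 := hdens z hzR j
        have h3 := hgM z hzR
        rw [norm_mul, norm_mul, norm_mul, norm_pow]
        norm_num
        calc _ = 3 * ‖g z‖ * ‖deriv g z‖ * (‖g z‖ * ‖hv (fun l => f l z) j‖) := by ring
          _ ≤ 3 * M * ‖deriv g z‖ * 1 := by gcongr
          _ = _ := by ring
      have t3 : ‖∑ k, deriv (f k) z * (BJ ρ (G j k) z - BJ ρ (G k j) z)‖ ≤ (4 * K * Real.exp 2) * ∑ l, ‖deriv (f l) z‖ := by
        refine (norm_sum_le _ _).trans ?_
        rw [Finset.mul_sum]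
        refine Finset.sum_le_sum fun k _ => ?_
        rw [norm_mul, mul_comm]
        have h1 := (gh j k).norm_BJ H hz'.le
        have h2 := (gh k j).norm_BJ H hz'.le
        refine mul_le_mul_of_nonneg_right ?_ (norm_nonneg _)
        refine (norm_sub_le _ _).trans ?_
        linarith
      rw [mul_assoc, ← hom]
      unfold om
      have e0 : 0 ≤ K * Real.exp 2 := by positivity
      calc ‖A1‖ ≤ M * (∑ l, ‖deriv (f l) z‖) + 3 * M * ‖deriv g z‖ + (4 * K * Real.exp 2) * ∑ l, ‖deriv (f l) z‖ := by
            rw [hA1]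
            refine (norm_add_le _ _).trans (add_le_add ((norm_add_le _ _).trans (add_le_add t1 t2)) t3)
        _ ≤ _ := by nlinarith [norm_nonneg (deriv g z), mul_nonneg hM hD0, mul_nonneg hM (norm_nonneg (deriv g z)), mul_nonneg e0 (norm_nonneg (deriv g z))]
    have b2 : ‖A2‖ₑ ≤ ENNReal.ofReal (n * (M * (2 * (4 * Real.exp 2 * (2 * K))))) * TT Ω z := by
      refine (enorm_sum_le _ _).trans ?_
      calc _ ≤ ∑ k : Fin n, ENNReal.ofReal M * (2 * (ENNReal.ofReal (4 * Real.exp 2 * (2 * K)) * TT Ω z)) := by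
            refine Finset.sum_le_sum fun k _ => ?_
            rw [enorm_mul]
            refine mul_le_mul' ?_ ?_
            · rw [← ofReal_norm]; exact ENNReal.ofReal_le_ofReal (hfM k z hzR)
            · refine enorm_sub_le.trans ?_
              rw [two_mul]
              exact add_le_add (hαb2 j k) (hαb2 k j)
        _ = _ := by
            rw [Finset.sum_const, Finset.card_univ, Fintype.card_fin, nsmul_eq_mul]
            generalize 4 * Real.exp 2 * (2 * K) = e0
            rw [ENNReal.ofReal_mul (by positivity), ENNReal.ofReal_mul hM, ENNReal.ofReal_mul (p := 2) (by positivity)]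
            simp only [ENNReal.ofReal_natCast, ENNReal.ofReal_ofNat]
            ring
    calc _ = ‖A1 + A2‖ₑ := by
          congr 1
          rw [hA1, hA2, Finset.sum_add_distrib]
          simp only [Pi.pow_apply]
          ring
      _ ≤ ENNReal.ofReal ((4 * M + 4 * K * Real.exp 2) * K) * Ω z +
          ENNReal.ofReal (n * (M * (2 * (4 * Real.exp 2 * (2 * K))))) * TT Ω z := by
          refine (enorm_add_le _ _).trans (add_le_add ?_ b2)
          rw [← ofReal_norm, hΩ, ← ENNReal.ofReal_mul (by positivity)]
          exact ENNReal.ofReal_le_ofReal b1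
      _ ≤ ENNReal.ofReal C1 * Ω z + ENNReal.ofReal C1 * TT Ω z := by
          gcongr
          · rw [hC1]; exact le_add_of_nonneg_right (by positivity)
          · rw [hC1]; exact le_add_of_nonneg_left (by positivity)
      _ = _ := by rw [mul_add]
  refine ⟨F, fun j => ⟨hFd j, ?_, ?_⟩, ?_⟩
  · intro z hz
    have hdc : DiffContOnCl ℂ (F j) (ball 0 1) :=
      ⟨hFd j, by rw [closure_ball _ one_ne_zero]; exact hFc j⟩
    refine Complex.norm_le_of_forall_mem_frontier_norm_le isBounded_ball hdc ?_ (subset_closure hz)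
    rw [frontier_ball _ one_ne_zero]
    intro w hw
    rw [hFU j w hw]
    exact hUb j w (sphere_subset_closedBall hw)
  · intro z hz
    have hd : ∀ z ∈ ball (0:ℂ) 1, HasWD (U j) (wderiv (U j) z) (wderivBar (U j) z) z := by
      intro z hz
      obtain ⟨α, β, h1, h2⟩ := hUwd j z hz
      rw [h1.wderiv, h1.wderivBar]; exact h1
    have hbd : ∀ z ∈ ball (0:ℂ) 1, ‖wderiv (U j) z‖ₑ ≤ ENNReal.ofReal C1 * (Ω z + TT Ω z) := by
      intro z hz
      obtain ⟨α, β, h1, h2⟩ := hUwd j z hz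
      rw [h1.wderiv]; exact h2
    have hi : IntegrableOn (wderiv (U j)) (ball 0 1) := by
      refine ⟨(measurable_wderiv _).aestronglyMeasurable, ?_⟩
      have hΩW : ∀ z ∈ ball (0:ℂ) 1, Ω z ≤ ENNReal.ofReal W := fun z _ => ENNReal.ofReal_le_ofReal (H.le z)
      refine (setLIntegral_mono' measurableSet_ball hbd).trans_lt ?_
      rw [lintegral_const_mul' _ _ ENNReal.ofReal_ne_top, lintegral_add_left hΩm]
      refine ENNReal.mul_lt_top ENNReal.ofReal_lt_top (ENNReal.add_lt_top.2 ⟨?_, TT_integrable hΩW⟩)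
      refine (setLIntegral_mono' measurableSet_ball hΩW).trans_lt ?_
      rw [lintegral_const]
      exact ENNReal.mul_lt_top ENNReal.ofReal_lt_top (by simp)
    refine (deriv_bound (hFd j) (hFc j) (hUc j) hd hi (hFU j) hz).trans ?_
    rw [← TT_const_mul C1]
    calc _ ≤ 1 * TT (fun ζ => ‖wderiv (U j) ζ‖ₑ) z := by
          gcongr
          rw [← ENNReal.ofReal_one]
          apply ENNReal.ofReal_le_ofReal
          rw [div_le_one Real.pi_pos]
          linarith [Real.pi_gt_three]
      _ ≤ _ := by
          rw [one_mul]
          exact TT_mono hbd z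
  · intro z hz
    have s1 := sum_hv (hu z (hsub1 hz))
    simp only [hF, hX, mul_add, Finset.sum_add_distrib]
    have e1 : ∑ j, f j z * (g z ^ 3 * hv (fun l => f l z) j) = g z ^ 3 := by
      calc _ = g z ^ 3 * ∑ j, f j z * hv (fun l => f l z) j := by
            rw [Finset.mul_sum]; exact Finset.sum_congr rfl fun _ _ => by ring
        _ = _ := by rw [s1, mul_one]
    have e2 : ∑ j, f j z * ∑ k, f k z * (bJ ρ (G j k) z - bJ ρ (G k j) z) = 0 := by
      simp only [Finset.mul_sum, mul_sub, Finset.sum_sub_distrib]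
      rw [sub_eq_zero]
      conv_rhs => rw [Finset.sum_comm]
      refine Finset.sum_congr rfl fun j _ => Finset.sum_congr rfl fun k _ => by ring
    rw [e1, e2, add_zero]

end

section

theorem uniform_case {p : ℝ} (hp0 : 0 < p) (hp1 : p < 1) (n : ℕ) {M C : ℝ} (hM : 0 ≤ M) (hC : 0 ≤ C) :
    ∃ C' : ℝ, ∀ (R : ℝ) (g : ℂ → ℂ) (f : Fin n → ℂ → ℂ), 1 < R →
    DifferentiableOn ℂ g (ball 0 R) → (∀ j, DifferentiableOn ℂ (f j) (ball 0 R)) →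
    (∀ z ∈ ball (0:ℂ) R, 0 < ∑ j, ‖f j z‖ ^ 2) →
    (∀ z ∈ ball (0:ℂ) R, ‖g z‖ ≤ √(∑ j, ‖f j z‖ ^ 2)) →
    (∀ z ∈ ball (0:ℂ) R, ‖g z‖ ≤ M) → (∀ j, ∀ z ∈ ball (0:ℂ) R, ‖f j z‖ ≤ M) →
    (∀ a : ℂ, ‖a‖ < 1 → qpIntegral p g a ≤ ENNReal.ofReal C) →
    (∀ j, ∀ a : ℂ, ‖a‖ < 1 → qpIntegral p (f j) a ≤ ENNReal.ofReal C) →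
    ∃ F : Fin n → ℂ → ℂ, (∀ j, DifferentiableOn ℂ (F j) (ball 0 1) ∧
      (∀ z ∈ ball (0:ℂ) 1, ‖F j z‖ ≤ C') ∧
      (∀ a : ℂ, ‖a‖ < 1 → qpIntegral p (F j) a ≤ ENNReal.ofReal C')) ∧
      ∀ z ∈ ball (0:ℂ) 1, ∑ j, f j z * F j z = g z ^ 3 := by
  obtain ⟨Ct, hCt, hT⟩ := TT_bound hp0 hp1
  obtain ⟨Cc, hCc, hcar⟩ := carleson_bound hp0 hp1
  set E := (2 + n * (2 * n)) * C with hE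
  have hE0 : 0 ≤ E := by positivity
  set s := √(Cc * E) with hs
  have hs0 : 0 ≤ s := Real.sqrt_nonneg _
  set K := s + 1 with hK
  have hK1 : 1 ≤ K := by rw [hK]; linarith
  have hK0 : 0 < K := by linarith
  set C1 := (4 * M + 4 * K * Real.exp 2) * K + n * (M * (2 * (4 * Real.exp 2 * (2 * K)))) with hC1
  have hC10 : 0 ≤ C1 := by positivity
  set C2 := M ^ 2 + n * (M * (2 * (2 * K * Real.exp 2))) with hC2
  have hC20 : 0 ≤ C2 := by positivity
  set C3 := (C1 ^ 2 * (Ct * (2 * (1 + Ct)))) * E with hC3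
  have hC30 : 0 ≤ C3 := by positivity
  refine ⟨C2 + C3, fun R g f hR hg hf hu hgf hgM hfM hgq hfq => ?_⟩
  have hsub : closedBall (0:ℂ) 1 ⊆ ball 0 R := closedBall_subset_ball hR
  have homc : ContinuousOn (om g f) (closedBall 0 1) := by
    unfold om
    have h1 := (hg.deriv isOpen_ball).continuousOn.mono hsub
    have h2 := fun j => ((hf j).deriv isOpen_ball).continuousOn.mono hsub
    exact h1.norm.add (continuousOn_finsetSum _ fun j _ => (h2 j).norm)
  obtain ⟨W, hW⟩ := (isCompact_closedBall (0:ℂ) 1).bddAbove_image homc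
  have hW' : ∀ z ∈ closedBall (0:ℂ) 1, om g f z ≤ W := fun z hz => hW (mem_image_of_mem _ hz)
  have hW0 : 0 ≤ W := (om_nonneg g f 0).trans (hW' 0 (by simp))
  set ρ : ℂ → ℝ := (ball (0:ℂ) 1).indicator fun z => om g f z / K with hρ
  have hρin : ∀ z ∈ ball (0:ℂ) 1, ρ z = om g f z / K := fun z hz => indicator_of_mem hz _
  have hρ0 : ∀ z, 0 ≤ ρ z := fun z => indicator_nonneg (fun w _ => div_nonneg (om_nonneg g f w) hK0.le) z
  have hρle : ∀ z ∈ ball (0:ℂ) 1, ρ z ≤ om g f z := fun z hz => by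
    rw [hρin z hz]; exact div_le_self (om_nonneg g f z) hK1
  have hρm : Measurable ρ := ((measurable_om g f).div_const K).indicator measurableSet_ball
  have hEa : ∀ a : ℂ, ‖a‖ < 1 → ∫⁻ z in ball (0:ℂ) 1, ENNReal.ofReal (om g f z) ^ 2 * wt p a z ≤ ENNReal.ofReal E :=
    fun a ha => om_int hC (hgq a ha) fun j => hfq j a ha
  have H : RhoH ρ W := by
    refine ⟨hρm, hρ0, ?_, ?_⟩
    · intro z
      by_cases hz : z ∈ ball (0:ℂ) 1
      · exact (hρle z hz).trans (hW' z (ball_subset_closedBall hz))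
      · rw [hρ, indicator_of_notMem hz]; exact hW0
    · intro a ha
      have h1 := hcar a ha (fun z => ENNReal.ofReal (om g f z)) (measurable_om g f).ennreal_ofReal
      have h2 := h1.trans (mul_le_mul_right (hEa a ha) _)
      rw [← ENNReal.ofReal_mul hCc.le, ← Real.sq_sqrt (by positivity : 0 ≤ Cc * E), ← hs,
        ENNReal.ofReal_pow hs0] at h2
      have h3 := (ENNReal.pow_right_strictMono two_ne_zero).le_iff_le.1 h2
      calc _ = ∫⁻ w in ball (0:ℂ) 1, ENNReal.ofReal (1 / K) * (ENNReal.ofReal (om g f w) * ENNReal.ofReal (jac a w)) := by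
            refine setLIntegral_congr_fun measurableSet_ball fun w hw => ?_
            rw [hρin w hw, ← ENNReal.ofReal_mul (om_nonneg g f w), ← ENNReal.ofReal_mul (by positivity)]
            congr 1; ring
        _ = ENNReal.ofReal (1 / K) * ∫⁻ w in ball (0:ℂ) 1, (ENNReal.ofReal (om g f w) * ENNReal.ofReal (jac a w)) :=
            lintegral_const_mul' _ _ ENNReal.ofReal_ne_top
        _ ≤ ENNReal.ofReal (1 / K) * ENNReal.ofReal s := mul_le_mul_right h3 _
        _ ≤ 1 := by
            rw [← ENNReal.ofReal_mul (by positivity), ← ENNReal.ofReal_one]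
            apply ENNReal.ofReal_le_ofReal
            rw [one_div_mul_eq_div, div_le_one hK0]
            linarith
  obtain ⟨F, hF, hid⟩ := core hR hK0.le hM hg hf hu hgf hgM hfM H (K := K)
    (fun z hz => by rw [hρin z hz]; field_simp)
  refine ⟨F, fun j => ⟨(hF j).1, fun z hz => ?_, fun a ha => ?_⟩, hid⟩
  · exact ((hF j).2.1 z hz).trans (by linarith)
  · have hb := qp_final hCt hT (F := F j) (hρm.ennreal_ofReal) hC10 (hF j).2.2 ha (E := E) (by
      refine le_trans ?_ (hEa a ha)
      refine setLIntegral_mono' measurableSet_ball fun z hz => ?_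
      gcongr
      exact hρle z hz)
    rw [← ENNReal.ofReal_mul (by positivity)] at hb
    exact hb.trans (ENNReal.ofReal_le_ofReal (by linarith))

end

section

lemma Qa_dilate {r : ℝ} (hr0 : 0 < r) (hr1 : r < 1) {a z : ℂ} (ha : ‖a‖ < 1) (hz : ‖z‖ < 1) :
    Qa a z ≤ Qa (r * a) (r * z) := by
  have hq : ‖conj a * z‖ < 1 := by
    rw [norm_mul, RCLike.norm_conj]
    nlinarith [norm_nonneg a, norm_nonneg z]
  have hra : ‖(r:ℂ) * a‖ < 1 := by
    rw [norm_mul, Complex.norm_real, Real.norm_of_nonneg hr0.le]; nlinarith [norm_nonneg a]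
  have hrz : ‖(r:ℂ) * z‖ < 1 := by
    rw [norm_mul, Complex.norm_real, Real.norm_of_nonneg hr0.le]; nlinarith [norm_nonneg z]
  have key : r * ‖1 - conj a * z‖ ≤ ‖1 - conj ((r:ℂ) * a) * (r * z)‖ := by
    have e : conj ((r:ℂ) * a) * (r * z) = (r^2 : ℝ) * (conj a * z) := by
      rw [map_mul, Complex.conj_ofReal]; push_cast; ring
    rw [e]
    set q := conj a * z
    refine le_of_sq_le_sq ?_ (norm_nonneg _)
    rw [mul_pow, ← Complex.normSq_eq_norm_sq, ← Complex.normSq_eq_norm_sq, Complex.normSq_apply,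
      Complex.normSq_apply]
    have h2 : q.re * q.re + q.im * q.im < 1 := by
      rw [← Complex.normSq_apply, Complex.normSq_eq_norm_sq]; nlinarith [norm_nonneg q]
    simp only [sub_re, one_re, sub_im, one_im, re_ofReal_mul, im_ofReal_mul]
    have : 0 ≤ (1 - r^2) * (1 - r^2 * (q.re * q.re + q.im * q.im)) := by
      apply mul_nonneg <;> nlinarith [sq_nonneg q.re, sq_nonneg q.im, sq_nonneg r]
    nlinarith
  unfold Qa
  have hm : ‖moebius (r * a) (r * z)‖ ≤ ‖moebius a z‖ := by
    unfold moebius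
    rw [norm_div, norm_div, ← mul_sub, norm_mul, Complex.norm_real, Real.norm_of_nonneg hr0.le]
    have h1 : 0 < ‖1 - conj a * z‖ := norm_pos_iff.2 (den_ne hz.le ha)
    have h2 : 0 < ‖1 - conj ((r:ℂ) * a) * (r * z)‖ := norm_pos_iff.2 (den_ne hrz.le hra)
    rw [div_le_div_iff₀ h2 h1]
    nlinarith [norm_nonneg (a - z)]
  have := pow_le_pow_left₀ (norm_nonneg _) hm 2
  linarith

lemma dilate_cv {r : ℝ} (hr0 : 0 < r) (hr1 : r < 1) (h : ℂ → ℝ≥0∞) :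
    ∫⁻ z in ball (0:ℂ) 1, h (r * z) * ENNReal.ofReal (r ^ 2) ≤ ∫⁻ z in ball (0:ℂ) 1, h z := by
  have hsub : (fun z : ℂ => (r:ℂ) * z) '' ball (0:ℂ) 1 ⊆ ball 0 1 := by
    rintro _ ⟨z, hz, rfl⟩
    rw [mem_ball_zero_iff] at *
    rw [norm_mul, Complex.norm_real, Real.norm_of_nonneg hr0.le]; nlinarith [norm_nonneg z]
  have hrc : (r:ℂ) ≠ 0 := by exact_mod_cast hr0.ne'
  have hinj : InjOn (fun z : ℂ => (r:ℂ) * z) (ball 0 1) := fun x _ y _ hxy => mul_left_cancel₀ hrc hxy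
  refine le_trans (le_of_eq ?_) (lintegral_mono_set hsub)
  rw [lintegral_image_eq_lintegral_abs_det_fderiv_mul volume measurableSet_ball
    (f' := fun z => (ContinuousLinearMap.toSpanSingleton ℂ (r:ℂ) : ℂ →L[ℂ] ℂ).restrictScalars ℝ) ?_ hinj]
  · refine setLIntegral_congr_fun measurableSet_ball fun z hz => ?_
    rw [mul_comm, det_mul_complex, abs_of_nonneg (by positivity), Complex.norm_real, Real.norm_of_nonneg hr0.le]
  · intro z hz
    have : HasDerivAt (fun z : ℂ => (r:ℂ) * z) r z := by
      simpa using (hasDerivAt_id z).const_mul (r:ℂ)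
    exact (this.hasFDerivAt.restrictScalars ℝ).hasFDerivWithinAt

lemma qp_dilate {p : ℝ} (hp0 : 0 < p) {r : ℝ} (hr0 : 0 < r) (hr1 : r < 1) (f : ℂ → ℂ) {a : ℂ} (ha : ‖a‖ < 1) :
    qpIntegral p (fun z => f (r * z)) a ≤ qpIntegral p f (r * a) := by
  rw [qp_eq, qp_eq]
  refine le_trans ?_ (dilate_cv hr0 hr1 _)
  refine setLIntegral_mono' measurableSet_ball fun z hz => ?_
  rw [mem_ball_zero_iff] at hz
  have hd : deriv (fun z => f (r * z)) z = r * deriv f (r * z) := by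
    simpa using deriv_comp_mul_left (r:ℂ) f z
  rw [hd, enorm_mul, mul_pow]
  have h1 : wt p a z ≤ wt p (r * a) (r * z) :=
    ENNReal.ofReal_le_ofReal (Real.rpow_le_rpow (Qa_pos ha hz).le (Qa_dilate hr0 hr1 ha hz) hp0.le)
  have h2 : ‖(r:ℂ)‖ₑ ^ 2 = ENNReal.ofReal (r^2) := by
    rw [ENNReal.ofReal_pow hr0.le, ← ofReal_norm, Complex.norm_real, Real.norm_of_nonneg hr0.le]
  rw [h2]
  calc _ ≤ ENNReal.ofReal (r^2) * ‖deriv f (r*z)‖ₑ^2 * wt p (r * a) (r * z) := by gcongr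
    _ = _ := by ring

/-- Montel along an ultrafilter. -/
lemma montel_ultra (U : Ultrafilter ℕ) {C : ℝ} (F : ℕ → ℂ → ℂ)
    (hF : ∀ k, DifferentiableOn ℂ (F k) (ball 0 1)) (hb : ∀ k, ∀ z ∈ ball (0:ℂ) 1, ‖F k z‖ ≤ C) :
    ∃ L : ℂ → ℂ, (∀ z ∈ ball (0:ℂ) 1, ‖L z‖ ≤ C) ∧ TendstoLocallyUniformlyOn F L U (ball 0 1) := by
  have hC : 0 ≤ C := (norm_nonneg _).trans (hb 0 0 (by simp))
  have hex : ∀ z : ℂ, ∃ w : ℂ, z ∈ ball (0:ℂ) 1 → ‖w‖ ≤ C ∧ Tendsto (fun k => F k z) U (𝓝 w) := by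
    intro z
    by_cases hz : z ∈ ball (0:ℂ) 1
    · obtain ⟨w, hw, hlim⟩ := (isCompact_closedBall (0:ℂ) C).ultrafilter_le_nhds (U.map fun k => F k z) (by
        rw [le_principal_iff]
        refine Filter.mem_map.2 (Eventually.of_forall fun k => ?_)
        simpa using hb k z hz)
      exact ⟨w, fun _ => ⟨by simpa using hw, hlim⟩⟩
    · exact ⟨0, fun h => absurd h hz⟩
  choose L hL using hex
  refine ⟨L, fun z hz => (hL z hz).1, ?_⟩
  rw [Metric.tendstoLocallyUniformlyOn_iff]
  intro ε hε x hx
  have hx1 : ‖x‖ < 1 := by simpa using hx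
  set d := 1 - ‖x‖ with hd
  have hd0 : 0 < d := by linarith
  have hsub : ball x d ⊆ ball 0 1 := ball_subset_ball' (by rw [dist_zero_right]; linarith)
  have heq : ∀ k, ∀ z ∈ ball x d, dist (F k z) (F k x) ≤ (2 * C) / d * dist z x := by
    intro k z hz
    refine Complex.dist_le_div_mul_dist_of_mapsTo_ball ((hF k).mono hsub) ?_ hz
    intro w hw
    rw [mem_closedBall, dist_eq_norm]
    calc _ ≤ ‖F k w‖ + ‖F k x‖ := norm_sub_le _ _
      _ ≤ 2 * C := by linarith [hb k w (hsub hw), hb k x hx]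
  have heqL : ∀ z ∈ ball x d, dist (L z) (L x) ≤ (2 * C) / d * dist z x := by
    intro z hz
    exact le_of_tendsto ((hL z (hsub hz)).2.dist (hL x hx).2) (Eventually.of_forall fun k => heq k z hz)
  set δ := min d (ε / (3 * (2 * C / d + 1))) with hδ
  have hK : 0 ≤ 2 * C / d := by positivity
  have hδ0 : 0 < δ := lt_min hd0 (by positivity)
  refine ⟨ball x δ, mem_nhdsWithin_of_mem_nhds (ball_mem_nhds x hδ0), ?_⟩
  have hev := (Metric.tendsto_nhds.1 (hL x hx).2) (ε / 3) (by positivity)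
  filter_upwards [hev] with k hk y hy
  have hyd : y ∈ ball x d := ball_subset_ball (min_le_left _ _) hy
  have hsm : 2 * C / d * dist y x < ε / 3 := by
    have h1 : dist y x < ε / (3 * (2 * C / d + 1)) := lt_of_lt_of_le (mem_ball.1 hy) (min_le_right _ _)
    rw [lt_div_iff₀ (by positivity)] at h1
    nlinarith [dist_nonneg (x := y) (y := x)]
  have h1 := heq k y hyd
  have h2 := heqL y hyd
  calc dist (L y) (F k y) ≤ dist (L y) (L x) + dist (L x) (F k x) + dist (F k x) (F k y) := dist_triangle4 _ _ _ _
    _ < ε := by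
      rw [dist_comm (L x), dist_comm (F k x) (F k y)]; linarith

lemma qp_limit {p : ℝ} (U : Ultrafilter ℕ) {B : ℝ≥0∞} {F : ℕ → ℂ → ℂ} {L : ℂ → ℂ}
    (hF : ∀ k, DifferentiableOn ℂ (F k) (ball 0 1))
    (hL : TendstoLocallyUniformlyOn F L U (ball 0 1)) {a : ℂ}
    (hB : ∀ k, qpIntegral p (F k) a ≤ B) : qpIntegral p L a ≤ B := by
  have hd := hL.deriv (Eventually.of_forall hF) isOpen_ball
  rw [tendstoLocallyUniformlyOn_iff_forall_isCompact isOpen_ball] at hd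
  have hsel : ∀ m : ℕ, ∃ k, ∀ z ∈ closedBall (0:ℂ) (1 - 1 / ((m:ℝ) + 1)),
      dist (deriv L z) (deriv (F k) z) < 1 / ((m:ℝ) + 1) := by
    intro m
    have hpos : (0:ℝ) < 1 / ((m:ℝ) + 1) := by positivity
    have := hd (closedBall (0:ℂ) (1 - 1 / ((m:ℝ) + 1)))
      (closedBall_subset_ball (by linarith)) (isCompact_closedBall _ _)
    rw [Metric.tendstoUniformlyOn_iff] at this
    obtain ⟨k, hk⟩ := (this _ hpos).exists
    exact ⟨k, hk⟩
  choose κ hκ using hsel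
  have hpt : ∀ z ∈ ball (0:ℂ) 1, Tendsto (fun m => deriv (F (κ m)) z) atTop (𝓝 (deriv L z)) := by
    intro z hz
    have hz1 : ‖z‖ < 1 := by simpa using hz
    have h0 := tendsto_one_div_add_atTop_nhds_zero_nat (𝕜 := ℝ)
    rw [tendsto_iff_dist_tendsto_zero]
    refine squeeze_zero' (Eventually.of_forall fun _ => dist_nonneg) ?_ h0
    filter_upwards [h0.eventually (gt_mem_nhds (show 0 < 1 - ‖z‖ by linarith))] with m hm
    rw [dist_comm]
    refine (hκ m z ?_).le
    rw [mem_closedBall_zero_iff]; linarith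
  rw [qp_eq]
  have hle : ∫⁻ z in ball (0:ℂ) 1, ‖deriv L z‖ₑ ^ 2 * wt p a z =
      ∫⁻ z in ball (0:ℂ) 1, liminf (fun m => ‖deriv (F (κ m)) z‖ₑ ^ 2 * wt p a z) atTop := by
    refine setLIntegral_congr_fun measurableSet_ball fun z hz => ?_
    have h1 : Tendsto (fun m => ‖deriv (F (κ m)) z‖ₑ ^ 2 * wt p a z) atTop (𝓝 (‖deriv L z‖ₑ ^ 2 * wt p a z)) := by
      refine ENNReal.Tendsto.mul_const ?_ (Or.inr ENNReal.ofReal_ne_top)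
      exact ENNReal.Tendsto.pow (hpt z hz).enorm
    exact h1.liminf_eq.symm
  rw [hle]
  refine (lintegral_liminf_le fun m => ?_).trans ?_
  · exact ((measurable_deriv _).enorm.pow_const 2).mul (measurable_wt p a)
  · refine liminf_le_of_le ?_ ?_
    · isBoundedDefault
    · intro b hb
      obtain ⟨m, hm⟩ := hb.exists
      refine hm.trans ?_
      rw [← qp_eq]; exact hB _

lemma qp_const (p : ℝ) (c a : ℂ) : qpIntegral p (fun _ => c) a = 0 := by
  rw [qp_eq]; simp

lemma h2Bounded_of_bdd {f : ℂ → ℂ} {M : ℝ} (hM : ∀ z ∈ ball (0:ℂ) 1, ‖f z‖ ≤ M) : h2Bounded f := by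
  refine ⟨M ^ 2 * |2 * π - 0|, fun r hr => ?_⟩
  refine (le_abs_self _).trans ?_
  rw [← Real.norm_eq_abs]
  refine intervalIntegral.norm_integral_le_of_norm_le_const fun t _ => ?_
  rw [Real.norm_of_nonneg (by positivity)]
  refine pow_le_pow_left₀ (norm_nonneg _) (hM _ ?_) 2
  rw [mem_ball_zero_iff, norm_mul, mul_comm I, Complex.norm_exp_ofReal_mul_I, Complex.norm_real, Real.norm_of_nonneg hr.1]
  simpa using hr.2

end

section

theorem wolff_main (p : ℝ) (hp0 : 0 < p) (hp1 : p < 1)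
    (n : ℕ) (g : ℂ → ℂ) (f : Fin n → ℂ → ℂ)
    (hg : MemHinf g ∧ MemQp p g) (hf : ∀ j, MemHinf (f j) ∧ MemQp p (f j))
    (hsize : ∀ z ∈ unitDisk, ‖g z‖ ≤ Real.sqrt (∑ j, ‖f j z‖ ^ 2)) :
    ∃ G : Fin n → ℂ → ℂ, (∀ j, MemHinf (G j) ∧ MemQp p (G j)) ∧
      ∀ z ∈ unitDisk, ∑ j, f j z * G j z = (g z) ^ 3 := by
  unfold unitDisk at hsize
  obtain ⟨⟨hgd, Mg, hMg⟩, -, -, Cg, hCg⟩ := hg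
  have hfd : ∀ j, DifferentiableOn ℂ (f j) (ball 0 1) := fun j => (hf j).1.1
  choose Mf hMf using fun j => (hf j).1.2
  choose Cf hCf using fun j => (hf j).2.2.2
  unfold unitDisk at hgd hMg hCg hMf hCf
  -- uniform constants
  set M : ℝ := 1 + |Mg| + ∑ j, |Mf j| with hMdef
  set C : ℝ := |Cg| + ∑ j, |Cf j| with hCdef
  have hsM : 0 ≤ ∑ j, |Mf j| := Finset.sum_nonneg fun j _ => abs_nonneg _
  have hsC : 0 ≤ ∑ j, |Cf j| := Finset.sum_nonneg fun j _ => abs_nonneg _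
  have hM0 : 0 ≤ M := by positivity
  have hC0 : 0 ≤ C := by positivity
  have hM1 : 1 ≤ M := by linarith [abs_nonneg Mg]
  have hMfj : ∀ j, Mf j ≤ M := fun j => by
    have := Finset.single_le_sum (f := fun j => |Mf j|) (fun j _ => abs_nonneg _) (Finset.mem_univ j)
    linarith [le_abs_self (Mf j), abs_nonneg Mg]
  have hCfj : ∀ j, Cf j ≤ C := fun j => by
    have := Finset.single_le_sum (f := fun j => |Cf j|) (fun j _ => abs_nonneg _) (Finset.mem_univ j)
    linarith [le_abs_self (Cf j), abs_nonneg Cg]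
  obtain ⟨C', hC'⟩ := uniform_case hp0 hp1 (n + 1) hM0 hC0
  -- dilation parameters
  set ε : ℕ → ℝ := fun k => 1 / ((k:ℝ) + 1) with hεdef
  set r : ℕ → ℝ := fun k => 1 - 1 / (((k + 1 : ℕ) : ℝ) + 1) with hrdef
  have hε0 : ∀ k, 0 < ε k := fun k => by simp only [hεdef]; positivity
  have hε1 : ∀ k, ε k ≤ 1 := fun k => by
    simp only [hεdef]
    rw [div_le_one (by positivity)]
    linarith [(Nat.cast_nonneg k : (0:ℝ) ≤ k)]
  have hr1 : ∀ k, r k < 1 := fun k => by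
    simp only [hrdef]
    have : (0:ℝ) < 1 / (((k + 1 : ℕ) : ℝ) + 1) := by positivity
    linarith
  have hr0 : ∀ k, 0 < r k := fun k => by
    simp only [hrdef]
    rw [sub_pos, div_lt_one (by positivity)]
    push_cast
    linarith [(Nat.cast_nonneg k : (0:ℝ) ≤ k)]
  have hεlim : Tendsto ε atTop (𝓝 0) := tendsto_one_div_add_atTop_nhds_zero_nat
  have hrlim : Tendsto r atTop (𝓝 1) := by
    have := (tendsto_add_atTop_iff_nat 1).2 (tendsto_one_div_add_atTop_nhds_zero_nat (𝕜 := ℝ))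
    simpa [hrdef] using this.const_sub 1
  have hball : ∀ k, ∀ z ∈ ball (0:ℂ) (1 / r k), (r k : ℂ) * z ∈ ball (0:ℂ) 1 := by
    intro k z hz
    rw [mem_ball_zero_iff] at *
    rw [norm_mul, Complex.norm_real, Real.norm_of_nonneg (hr0 k).le]
    rwa [lt_div_iff₀ (hr0 k), mul_comm] at hz
  have hra : ∀ k, ∀ a : ℂ, ‖a‖ < 1 → (r k : ℂ) * a ∈ ball (0:ℂ) 1 := by
    intro k a ha
    rw [mem_ball_zero_iff, norm_mul, Complex.norm_real, Real.norm_of_nonneg (hr0 k).le]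
    nlinarith [norm_nonneg a, hr0 k, hr1 k]
  let h : ℕ → Fin (n + 1) → ℂ → ℂ := fun k =>
    Fin.cons (fun _ => (ε k : ℂ)) (fun j z => f j (r k * z))
  have hh0 : ∀ k, h k 0 = fun _ => (ε k : ℂ) := fun k => rfl
  have hhs : ∀ k j, h k (Fin.succ j) = fun z => f j (r k * z) := fun k j => rfl
  have hsum : ∀ k z, ∑ j, ‖h k j z‖ ^ 2 = ε k ^ 2 + ∑ j, ‖f j (r k * z)‖ ^ 2 := by
    intro k z
    rw [Fin.sum_univ_succ, hh0]
    simp only [hhs]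
    rw [Complex.norm_real, Real.norm_of_nonneg (hε0 k).le]
  have hdil : ∀ k (u : ℂ → ℂ), DifferentiableOn ℂ u (ball 0 1) →
      DifferentiableOn ℂ (fun z => u (r k * z)) (ball 0 (1 / r k)) := by
    intro k u hu
    exact hu.comp (g := u) (f := fun z : ℂ => (r k : ℂ) * z) (by fun_prop) (hball k)
  have hstep := fun k => hC' (1 / r k) (fun z => g (r k * z)) (h k)
    (by rw [lt_div_iff₀ (hr0 k)]; linarith [hr1 k]) (hdil k g hgd)
    (by
      intro j
      refine Fin.cases ?_ (fun j => ?_) j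
      · rw [hh0]; exact differentiableOn_const _
      · rw [hhs]; exact hdil k _ (hfd j))
    (by
      intro z _
      rw [hsum]
      have : 0 ≤ ∑ j, ‖f j (r k * z)‖ ^ 2 := Finset.sum_nonneg fun j _ => by positivity
      have := pow_pos (hε0 k) 2
      linarith)
    (by
      intro z hz
      refine (hsize _ (hball k z hz)).trans (Real.sqrt_le_sqrt ?_)
      rw [hsum]
      have := pow_pos (hε0 k) 2
      linarith)
    (by
      intro z hz
      refine (hMg _ (hball k z hz)).trans ?_
      linarith [le_abs_self Mg])
    (by
      intro j
      refine Fin.cases ?_ (fun j => ?_) j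
      · intro z _
        rw [hh0, Complex.norm_real, Real.norm_of_nonneg (hε0 k).le]
        linarith [hε1 k]
      · intro z hz
        rw [hhs]
        exact (hMf j _ (hball k z hz)).trans (hMfj j))
    (by
      intro a ha
      refine (qp_dilate hp0 (hr0 k) (hr1 k) g ha).trans ((hCg _ (hra k a ha)).trans ?_)
      exact ENNReal.ofReal_le_ofReal (by linarith [le_abs_self Cg]))
    (by
      intro j
      refine Fin.cases ?_ (fun j => ?_) j
      · intro a _
        rw [hh0, qp_const]; exact zero_le
      · intro a ha
        rw [hhs]
        refine (qp_dilate hp0 (hr0 k) (hr1 k) (f j) ha).trans ((hCf j _ (hra k a ha)).trans ?_)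
        exact ENNReal.ofReal_le_ofReal (hCfj j))
  choose F hF hFsum using hstep
  let U : Ultrafilter ℕ := hyperfilter ℕ
  have hU : (U : Filter ℕ) ≤ atTop := by
    rw [← Nat.cofinite_eq_atTop]; exact hyperfilter_le_cofinite
  choose L hLb hL using fun j : Fin (n + 1) => montel_ultra U (fun k => F k j)
    (fun k => (hF k j).1) (fun k => (hF k j).2.1)
  have hLd : ∀ j, DifferentiableOn ℂ (L j) (ball 0 1) := fun j =>
    (hL j).differentiableOn (Eventually.of_forall fun k => (hF k j).1) isOpen_ball
  refine ⟨fun j => L j.succ, fun j => ⟨⟨hLd _, C', hLb _⟩, hLd _, h2Bounded_of_bdd (hLb _), C', ?_⟩, ?_⟩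
  · intro a ha
    have ha' : ‖a‖ < 1 := by simpa [unitDisk] using ha
    exact qp_limit U (fun k => (hF k _).1) (hL _) (fun k => (hF k _).2.2 a ha')
  · intro z hz
    have hz' : z ∈ ball (0:ℂ) 1 := hz
    have hlim : ∀ u : ℂ → ℂ, DifferentiableOn ℂ u (ball 0 1) →
        Tendsto (fun k => u (r k * z)) U (𝓝 (u z)) := by
      intro u hu
      have hc : ContinuousAt u z := hu.continuousOn.continuousAt (isOpen_ball.mem_nhds hz')
      have h1 : Tendsto (fun k => (r k : ℂ) * z) U (𝓝 z) := by
        have h2 : Tendsto (fun k => (r k : ℂ)) atTop (𝓝 ((1:ℝ):ℂ)) :=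
          (Complex.continuous_ofReal.tendsto 1).comp hrlim
        simpa using (h2.mul_const z).mono_left hU
      exact hc.tendsto.comp h1
    have hFl : ∀ j, Tendsto (fun k => F k j z) U (𝓝 (L j z)) := fun j => (hL j).tendsto_at hz'
    have hεU : Tendsto (fun k => (ε k : ℂ)) U (𝓝 0) := by
      have h2 : Tendsto (fun k => (ε k : ℂ)) atTop (𝓝 ((0:ℝ):ℂ)) :=
        (Complex.continuous_ofReal.tendsto 0).comp hεlim
      simpa using h2.mono_left hU
    have hA : Tendsto (fun k => (ε k : ℂ) * F k 0 z + ∑ j : Fin n, f j (r k * z) * F k j.succ z) U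
        (𝓝 (0 * L 0 z + ∑ j : Fin n, f j z * L j.succ z)) :=
      (hεU.mul (hFl 0)).add (tendsto_finsetSum _ fun j _ => (hlim _ (hfd j)).mul (hFl _))
    have hB : Tendsto (fun k => g (r k * z) ^ 3) U (𝓝 (g z ^ 3)) := (hlim g hgd).pow 3
    have hAB : (fun k => (ε k : ℂ) * F k 0 z + ∑ j : Fin n, f j (r k * z) * F k j.succ z) =
        fun k => g (r k * z) ^ 3 := by
      funext k
      have := hFsum k z hz'
      rw [Fin.sum_univ_succ, hh0] at this
      simpa only [hhs] using this
    rw [hAB] at hA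
    have := tendsto_nhds_unique hA hB
    simpa using this

end

/-- **Wolff's ideal theorem on `H^∞(𝔻) ∩ Q_p`.** If `g, f₁, …, fₙ ∈ H^∞(𝔻) ∩ Q_p` and
`|g(z)| ≤ (∑ⱼ |fⱼ(z)|²)^{1/2}` on the disk, then `g³` belongs to the ideal generated by
the `fⱼ` in `H^∞(𝔻) ∩ Q_p`. -/
theorem wolff_ideal_Hinf_inter_Qp (p : ℝ) (hp0 : 0 < p) (hp1 : p < 1)
    (n : ℕ) (g : ℂ → ℂ) (f : Fin n → ℂ → ℂ)
    (hg : MemHinf g ∧ MemQp p g) (hf : ∀ j, MemHinf (f j) ∧ MemQp p (f j))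
    (hsize : ∀ z ∈ unitDisk, ‖g z‖ ≤ Real.sqrt (∑ j, ‖f j z‖ ^ 2)) :
    ∃ G : Fin n → ℂ → ℂ, (∀ j, MemHinf (G j) ∧ MemQp p (G j)) ∧
      ∀ z ∈ unitDisk, ∑ j, f j z * G j z = (g z) ^ 3 :=
  wolff_main p hp0 hp1 n g f hg hf hsize

end
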